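/- Let d > 1 be a cube-free integer of one of the following forms, where q₁, q₂, q₃ are pairwise distinct primes ≡ −1 (mod 3) and e, f₁, f₂, f₃ ∈ {1, 2}: d = 3^{e} q₁^{f₁} with q₁ ≡ −1 (mod 9); d = q₁^{f₁} q₂^{f₂} with q₁ ≡ q₂ ≡ −1 (mod 9); d = q₁^{f₁} q₂^{f₂} ≢ ±1 (mod 9) with some q_i ≢ −1 (mod 9); d = 3^{e} q₁^{f₁} q₂^{f₂} with some q_i ≢ −1 (mod 9); d = q₁^{f₁} q₂^{f₂} q₃^{f₃} ≡ ±1 (mod 9) with q₁, q₂ ≡ 2 or 5 (mod 9) and q₃ ≡ −1 (mod 9); d = q₁^{f₁} q₂^{f₂} q₃^{f₃} ≡ ±1 (mod 9) with q₁, q₂, q₃ ≡ 2 or 5 (mod 9). Then the 3-class group C_{L,3} of L = ℚ(∛d) is cyclic (of order 3^w for some w ≥ 1). -/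

import Mathlib

open IntermediateField NumberField
open scoped nonZeroDivisors

set_option synthInstance.maxHeartbeats 1000000
set_option maxHeartbeats 2000000

noncomputable section

instance : Fact (Nat.Prime 3) := ⟨by norm_num⟩

/-- A positive integer is cube-free if no prime cube divides it. -/
def IsCubeFree (d : ℕ) : Prop := ∀ p : ℕ, p.Prime → ¬ (p ^ 3 ∣ d)

/-- The primitive cube root of unity `ζ₃ = e^{2πi/3}`. -/
def zeta3 : ℂ := Complex.exp (2 * Real.pi * Complex.I / 3)

lemma zeta3_isPrimitiveRoot : IsPrimitiveRoot zeta3 3 := by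
  simpa [zeta3] using Complex.isPrimitiveRoot_exp 3 (by norm_num)

lemma isIntegral_zeta3 : IsIntegral ℚ zeta3 :=
  (zeta3_isPrimitiveRoot.isIntegral (by norm_num)).tower_top

/-- The real cube root of `d`, as a complex number. -/
def cbrt (d : ℕ) : ℂ := ((d : ℝ) ^ ((3 : ℝ)⁻¹) : ℝ)

lemma cbrt_pow_three (d : ℕ) : (cbrt d) ^ 3 = (d : ℂ) := by
  have h : ((d : ℝ) ^ ((3 : ℝ)⁻¹)) ^ (3 : ℕ) = (d : ℝ) := by
    rw [← Real.rpow_natCast ((d : ℝ) ^ ((3 : ℝ)⁻¹)) 3, ← Real.rpow_mul (by positivity)]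
    norm_num
  calc (cbrt d) ^ 3 = (((((d : ℝ) ^ ((3 : ℝ)⁻¹)) ^ (3:ℕ) : ℝ)) : ℂ) := by
        push_cast [cbrt]; ring
    _ = ((d : ℝ) : ℂ) := by rw [h]
    _ = (d : ℂ) := by norm_num

lemma isIntegral_cbrt (d : ℕ) : IsIntegral ℚ (cbrt d) := by
  have h : IsIntegral ℤ (cbrt d) := by
    refine ⟨Polynomial.X ^ 3 - Polynomial.C (d : ℤ), ?_, ?_⟩
    · exact Polynomial.monic_X_pow_sub_C _ (by norm_num)
    · simp [Polynomial.eval₂, cbrt_pow_three d]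
  exact h.tower_top

/-- `L = ℚ(∛d)`, the pure cubic field, realized as a subfield of `ℂ`. -/
def Lc (d : ℕ) : IntermediateField ℚ ℂ := ℚ⟮cbrt d⟯

instance (d : ℕ) : NumberField (Lc d) where
  to_finiteDimensional := by
    apply IntermediateField.finiteDimensional_adjoin
    rintro x rfl
    exact isIntegral_cbrt d

section IdealCube

open IsDedekindDomain IsDedekindDomain.HeightOneSpectrum WithZero

/-- `x` has valuation divisible by three at every prime of the Dedekind domain `R`. -/
def IsIdealCube (R : Type*) [CommRing R] [IsDedekindDomain R] {F : Type*} [Field F] [Algebra R F]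
    [IsFractionRing R F] (x : F) : Prop :=
  ∀ v : HeightOneSpectrum R, ∃ m : ℤᵐ⁰, v.valuation F x = m ^ 3

variable {R F : Type*} [CommRing R] [IsDedekindDomain R] [Field F] [Algebra R F]
  [IsFractionRing R F]

lemma IsIdealCube.mul {x y : F} (hx : IsIdealCube R x) (hy : IsIdealCube R y) :
    IsIdealCube R (x * y) := fun v => by
  obtain ⟨m, hm⟩ := hx v
  obtain ⟨n, hn⟩ := hy v
  exact ⟨m * n, by rw [map_mul, hm, hn, mul_pow]⟩

lemma IsIdealCube.inv {x : F} (hx : IsIdealCube R x) : IsIdealCube R x⁻¹ := fun v => by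
  obtain ⟨m, hm⟩ := hx v
  exact ⟨m⁻¹, by rw [map_inv₀, hm, inv_pow]⟩

lemma IsIdealCube.div {x y : F} (hx : IsIdealCube R x) (hy : IsIdealCube R y) :
    IsIdealCube R (x / y) := div_eq_mul_inv x y ▸ hx.mul hy.inv

lemma isIdealCube_pow_three (x : F) : IsIdealCube R (x ^ 3) := fun v =>
  ⟨v.valuation F x, map_pow _ _ _⟩

lemma isIdealCube_one : IsIdealCube R (1 : F) := by
  simpa using isIdealCube_pow_three (R := R) (1 : F)

lemma IsIdealCube.pow {x : F} (hx : IsIdealCube R x) (n : ℕ) : IsIdealCube R (x ^ n) := by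
  induction n with
  | zero => simpa using isIdealCube_one
  | succ n ih => rw [pow_succ]; exact ih.mul hx

lemma exp_eq_cube {n : ℤ} {m : ℤᵐ⁰} (h : exp n = m ^ 3) : 3 ∣ n := by
  have hm : m ≠ 0 := by rintro rfl; simp at h
  refine ⟨log m, ?_⟩
  have := congrArg log h
  simpa using this

lemma valuation_unit (v : HeightOneSpectrum R) (u : Rˣ) : v.valuation F (algebraMap R F u) = 1 := by
  rw [valuation_of_algebraMap, intValuation_eq_one_iff_mem_primeCompl]
  exact fun h => v.isPrime.ne_top (Ideal.eq_top_of_isUnit_mem _ h u.isUnit)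

lemma isIdealCube_unit (u : Rˣ) : IsIdealCube R (algebraMap R F u) := fun v =>
  ⟨1, by rw [valuation_unit, one_pow]⟩

lemma IsIdealCube.exists_span_eq_pow {g : R} (hg : g ≠ 0)
    (h : IsIdealCube R (algebraMap R F g)) : ∃ I : Ideal R, Ideal.span {g} = I ^ 3 := by
  have hI : Ideal.span {g} ≠ ⊥ := by simpa using hg
  have h3 : ∀ v : HeightOneSpectrum R, 3 ∣ multiplicity v.asIdeal (Ideal.span {g}) := fun v => by
    obtain ⟨m, hm⟩ := h v
    rw [valuation_of_algebraMap, intValuation_eq_exp_neg_multiplicity v hg] at hm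
    have := exp_eq_cube hm
    rw [dvd_neg] at this
    exact_mod_cast this
  refine ⟨∏ᶠ v : HeightOneSpectrum R,
    v.asIdeal ^ (multiplicity v.asIdeal (Ideal.span {g}) / 3), ?_⟩
  rw [finprod_pow]
  · conv_lhs => rw [← Ideal.finprod_heightOneSpectrum_pow_multiplicity hI]
    refine finprod_congr fun v => ?_
    rw [← pow_mul, Nat.div_mul_cancel (h3 v)]
  · refine (Ideal.hasFiniteMulSupport hI).subset fun v hv hv1 => hv ?_
    replace hv1 : v.maxPowDividing (Ideal.span {g}) = 1 := hv1
    rw [maxPowDividing_eq_pow_multiplicity hI] at hv1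
    obtain ⟨k, hk⟩ := h3 v
    rw [hk, mul_comm, pow_mul] at hv1
    have hu : IsUnit (v.asIdeal ^ k) := .of_pow_eq_one hv1 (by norm_num)
    rw [Ideal.isUnit_iff, ← Ideal.one_eq_top] at hu
    simpa [hk] using hu

lemma isIdealCube_div_of_span_mul {x y : R} (hx : x ≠ 0) (hy : y ≠ 0) {A B : Ideal R}
    (hA : A ≠ ⊥) (hB : B ≠ ⊥) (h : Ideal.span {x} * A ^ 3 = Ideal.span {y} * B ^ 3) :
    IsIdealCube R (algebraMap R F x / algebraMap R F y) := fun v => by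
  have hf : ∀ {I : Ideal R}, I ≠ ⊥ → FiniteMultiplicity v.asIdeal I :=
    fun hI => FiniteMultiplicity.of_prime_left v.prime hI
  have hx' : Ideal.span {x} ≠ ⊥ := by simpa using hx
  have hy' : Ideal.span {y} ≠ ⊥ := by simpa using hy
  have h1 := congrArg (multiplicity v.asIdeal) h
  rw [multiplicity_mul v.prime (hf (mul_ne_zero hx' (pow_ne_zero 3 hA))),
    multiplicity_mul v.prime (hf (mul_ne_zero hy' (pow_ne_zero 3 hB))),
    (hf hA).multiplicity_pow v.prime, (hf hB).multiplicity_pow v.prime] at h1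
  refine ⟨exp ((multiplicity v.asIdeal A : ℤ) - multiplicity v.asIdeal B), ?_⟩
  rw [map_div₀, valuation_of_algebraMap, valuation_of_algebraMap,
    intValuation_eq_exp_neg_multiplicity v hx, intValuation_eq_exp_neg_multiplicity v hy,
    ← exp_sub, ← exp_nsmul, exp_inj]
  zify at h1
  simp only [nsmul_eq_mul, Nat.cast_ofNat]
  linarith

lemma isIdealCube_of_span_eq_pow {x : R} {I : Ideal R} (hx : x ≠ 0)
    (h : Ideal.span {x} = I ^ 3) : IsIdealCube R (algebraMap R F x) := by
  have hI : I ≠ ⊥ := by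
    rintro rfl
    simp [hx] at h
  simpa using isIdealCube_div_of_span_mul (F := F) (B := I) hx one_ne_zero
    (top_ne_bot (α := Ideal R)) hI
    (by rw [h, ← Ideal.one_eq_top, one_pow, mul_one, Ideal.span_singleton_one, ← Ideal.one_eq_top,
      one_mul])

lemma IsIdealCube.exists_eq_unit_mul_pow [IsPrincipalIdealRing R] {x : F} (hx : x ≠ 0)
    (h : IsIdealCube R x) : ∃ (u : Rˣ) (y : F), x = algebraMap R F u * y ^ 3 := by
  obtain ⟨a, b, hb, rfl⟩ := IsFractionRing.div_surjective (A := R) x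
  have hb0 : algebraMap R F b ≠ 0 := by
    simpa using nonZeroDivisors.ne_zero hb
  have ha0 : a ≠ 0 := by rintro rfl; simp at hx
  have h1 : IsIdealCube R (algebraMap R F (a * b ^ 2)) := by
    have := h.mul (isIdealCube_pow_three (algebraMap R F b))
    convert this using 1
    simp only [map_mul, map_pow]; field_simp
  obtain ⟨I, hI⟩ := h1.exists_span_eq_pow
    (mul_ne_zero ha0 (pow_ne_zero 2 (nonZeroDivisors.ne_zero hb)))
  obtain ⟨t, rfl⟩ := (IsPrincipalIdealRing.principal I).principal
  rw [Ideal.submodule_span_eq, Ideal.span_singleton_pow,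
    Ideal.span_singleton_eq_span_singleton] at hI
  obtain ⟨u, hu⟩ := hI.symm
  refine ⟨u, algebraMap R F t / algebraMap R F b, ?_⟩
  have := congrArg (algebraMap R F) hu
  simp only [map_mul, map_pow] at this
  field_simp
  rw [← this]; ring

/-- The preimage of a height one prime under a ring automorphism. -/
def comapPrime (e : R ≃+* R) (v : HeightOneSpectrum R) : HeightOneSpectrum R :=
  ⟨v.asIdeal.comap (e : R →+* R), inferInstance, by
    intro hb
    obtain ⟨y, hy, hy0⟩ := Submodule.exists_mem_ne_zero_of_ne_bot v.ne_bot
    have : e.symm y ∈ v.asIdeal.comap (e : R →+* R) := by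
      change e (e.symm y) ∈ v.asIdeal
      rwa [RingEquiv.apply_symm_apply]
    rw [hb, Ideal.mem_bot] at this
    exact hy0 (by simpa using this)⟩

lemma valuation_comapPrime (e : R ≃+* R) (f : F ≃+* F)
    (hef : ∀ r, f (algebraMap R F r) = algebraMap R F (e r)) (v : HeightOneSpectrum R) (x : F) :
    (comapPrime e v).valuation F x = v.valuation F (f x) := by
  have hle : ∀ (r : R) (n : ℕ), r ∈ (comapPrime e v).asIdeal ^ n ↔ e r ∈ v.asIdeal ^ n :=
    fun r n => by
    have : (comapPrime e v).asIdeal ^ n = (v.asIdeal ^ n).comap (e : R →+* R) := by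
      change (Ideal.comap e v.asIdeal) ^ n = Ideal.comap e (v.asIdeal ^ n)
      rw [← Ideal.map_symm, ← Ideal.map_symm, Ideal.map_pow]
    rw [this]; rfl
  have hint : ∀ r : R, (comapPrime e v).intValuation r = v.intValuation (e r) := fun r => by
    by_cases hr : r = 0
    · simp [hr]
    have her : e r ≠ 0 := by simpa using hr
    have h1 := fun n : ℕ => (intValuation_le_pow_iff_mem (comapPrime e v) r n).trans
      ((hle r n).trans (intValuation_le_pow_iff_mem v (e r) n).symm)
    rw [intValuation_eq_exp_neg_multiplicity (comapPrime e v) hr,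
      intValuation_eq_exp_neg_multiplicity v her] at *
    exact le_antisymm ((h1 _).2 le_rfl) ((h1 _).1 le_rfl)
  obtain ⟨a, b, hb, rfl⟩ := IsFractionRing.div_surjective (A := R) x
  simp only [map_div₀, hef, valuation_of_algebraMap, hint]

lemma IsIdealCube.map_ringEquiv {x : F} (h : IsIdealCube R x) (e : R ≃+* R) (f : F ≃+* F)
    (hef : ∀ r, f (algebraMap R F r) = algebraMap R F (e r)) : IsIdealCube R (f x) := fun v => by
  obtain ⟨m, hm⟩ := h (comapPrime e v)
  exact ⟨m, by rw [← valuation_comapPrime e f hef, hm]⟩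

lemma valuation_eq_of_stable (e : R ≃+* R) (f : F ≃+* F)
    (hef : ∀ r, f (algebraMap R F r) = algebraMap R F (e r)) (v : HeightOneSpectrum R)
    (hv : ∀ r ∈ v.asIdeal, e r ∈ v.asIdeal) (x : F) : v.valuation F (f x) = v.valuation F x := by
  have : v = comapPrime e v := by
    ext1
    exact v.isMaximal.eq_of_le (comapPrime e v).isPrime.ne_top hv
  rw [← valuation_comapPrime e f hef, ← this]

section Extension

variable {S E : Type*} [CommRing S] [IsDedekindDomain S] [Field E] [Algebra S E]
  [IsFractionRing S E] [Algebra R S] [Module.IsTorsionFree R S] [Algebra F E] [Algebra R E]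
  [IsScalarTower R F E] [IsScalarTower R S E]

/-- The prime of `R` below a prime of `S`. -/
def primeBelow [Algebra.IsIntegral R S] (w : HeightOneSpectrum S) : HeightOneSpectrum R :=
  ⟨w.asIdeal.comap (algebraMap R S), inferInstance, by
    obtain ⟨y, hy, hy0⟩ := Submodule.exists_mem_ne_zero_of_ne_bot w.ne_bot
    exact Ideal.comap_ne_bot_of_integral_mem hy0 hy (Algebra.IsIntegral.isIntegral y)⟩

instance [Algebra.IsIntegral R S] (w : HeightOneSpectrum S) :
    w.asIdeal.LiesOver (primeBelow (R := R) w).asIdeal := ⟨rfl⟩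

variable (R S) in
lemma IsIdealCube.extend [Algebra.IsIntegral R S] {x : F} (h : IsIdealCube R x) :
    IsIdealCube S (algebraMap F E x) := fun w => by
  obtain ⟨m, hm⟩ := h (primeBelow w)
  refine ⟨m ^ (primeBelow (R := R) w).asIdeal.ramificationIdx' w.asIdeal, ?_⟩
  rw [← valuation_liesOver (A := R) (K := F) E (primeBelow w) w x, hm,
    ← pow_mul, ← pow_mul, mul_comm]

lemma exists_prime_above [Algebra.IsIntegral R S] (v : HeightOneSpectrum R) :
    ∃ w : HeightOneSpectrum S, w.asIdeal.LiesOver v.asIdeal := by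
  have := v.isPrime
  obtain ⟨Q, hQ, hQ'⟩ := Ideal.exists_maximal_ideal_liesOver_of_isIntegral (S := S) v.asIdeal
  exact ⟨⟨Q, inferInstance, Ideal.ne_bot_of_liesOver_of_ne_bot v.ne_bot Q⟩, hQ'⟩

lemma exists_cube_of_coprime_pow {a m : ℤᵐ⁰} (ha : a ≠ 0) {e : ℕ} (he : e = 1 ∨ e = 2)
    (h : a ^ e = m ^ 3) : ∃ n : ℤᵐ⁰, a = n ^ 3 := by
  rcases he with rfl | rfl
  · exact ⟨m, by simpa using h⟩
  · refine ⟨a / m, ?_⟩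
    rw [div_pow, ← h, eq_div_iff (pow_ne_zero 2 ha), ← pow_succ']

variable (R S E) in
lemma IsIdealCube.descend [Algebra.IsIntegral R S] [FiniteDimensional F E] [Module.Finite R S]
    (h2 : Module.finrank F E = 2)
    {x : F} (hx : x ≠ 0) (h : IsIdealCube S (algebraMap F E x)) : IsIdealCube R x := fun v => by
  obtain ⟨w, hw⟩ := exists_prime_above (S := S) v
  obtain ⟨m, hm⟩ := h w
  rw [← valuation_liesOver (A := R) (K := F) E v w x] at hm
  have : v.asIdeal.IsMaximal := v.isMaximal
  have : NoZeroSMulDivisors R S := ⟨fun h => smul_eq_zero.1 h⟩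
  have hle : v.asIdeal.ramificationIdx' w.asIdeal ≤ Module.finrank F E :=
    Ideal.ramificationIdx_le_finrank (R := R) (S := S) F E w.asIdeal
  have h0 := Ideal.IsDedekindDomain.ramificationIdx'_ne_zero_of_liesOver w.asIdeal v.ne_bot
  exact exists_cube_of_coprime_pow ((Valuation.ne_zero_iff _).2 hx) (by omega) hm

variable (S E) in
attribute [local instance] FractionRing.liftAlgebra FractionRing.isScalarTower_liftAlgebra in
lemma exists_valuation_eq_cube_of_unramified [Algebra.IsIntegral R S] [FiniteDimensional F E]
    [Module.Finite R S] [CharZero F] {x : F} (h : IsIdealCube S (algebraMap F E x)) {θ : S} {d : R}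
    (hθ : θ ^ 3 = algebraMap R S d) (hθ' : Algebra.adjoin F {algebraMap S E θ} = ⊤)
    (v : HeightOneSpectrum R) (h3 : (3 : R) * d ∉ v.asIdeal) :
    ∃ m : ℤᵐ⁰, v.valuation F x = m ^ 3 := by
  obtain ⟨w, hw⟩ := exists_prime_above (S := S) v
  obtain ⟨m, hm⟩ := h w
  rw [← valuation_liesOver (A := R) (K := F) E v w x] at hm
  have hr : v.asIdeal.ramificationIdx' w.asIdeal = 1 := by
    have h3w : ¬ w.asIdeal ∣ differentIdeal R S := by
      rw [Ideal.dvd_iff_le]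
      intro hle
      have h1 := hle (aeval_derivative_mem_differentIdeal R F E θ hθ')
      have hdvd : minpoly R θ ∣ (Polynomial.X ^ 3 - Polynomial.C d) :=
        minpoly.isIntegrallyClosed_dvd (Algebra.IsIntegral.isIntegral θ) (by simp [hθ])
      obtain ⟨g, hg⟩ := hdvd
      have h2 := congrArg (fun p => Polynomial.aeval θ (Polynomial.derivative p)) hg
      simp only [Polynomial.derivative_sub, Polynomial.derivative_X_pow, Polynomial.derivative_C,
        sub_zero, Polynomial.derivative_mul, map_add, map_mul, minpoly.aeval, zero_mul, add_zero,
        map_pow, Polynomial.aeval_X, Polynomial.aeval_C] at h2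
      apply h3
      have hov : v.asIdeal = w.asIdeal.comap (algebraMap R S) := hw.over
      rw [hov, Ideal.mem_comap, map_mul, ← hθ]
      have h4 := w.asIdeal.mul_mem_right (θ * Polynomial.aeval θ g) h1
      convert h4 using 1
      rw [mul_left_comm, ← h2]
      simp; ring
    have : Algebra.IsSeparable (FractionRing R) (FractionRing S) := by
      have : CharZero R := (algebraMap R F).charZero
      infer_instance
    have := w.isPrime
    rw [not_dvd_differentIdeal_iff] at h3w
    have := v.isPrime
    refine (Ideal.ramificationIdx'_eq_ramificationIdx v.asIdeal w.asIdeal v.ne_bot).trans ?_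
    exact Ideal.ramificationIdx_eq_one w.asIdeal R
  rw [hr, pow_one] at hm
  exact ⟨m, hm⟩

end Extension

end IdealCube

/-- The tower `K = ℚ(∛d, ζ₃)` over `L = ℚ(∛d)` and `k = ℚ(ζ₃)`, with generators `σ` of
`Gal(K/k)` and `τ` of `Gal(K/L)`. -/
structure KummerTower {L k K : Type} [Field L] [Field k] [Field K] [NumberField L]
    [NumberField k] [NumberField K] [Algebra L K] [Algebra k K] (d : ℕ) (θ : L) (ζ : k)
    (σ : K ≃ₐ[k] K) (τ : K ≃ₐ[L] K) : Prop where
  d_ne : d ≠ 0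
  cube : θ ^ 3 = d
  root : ζ ^ 2 + ζ + 1 = 0
  sigma : σ (algebraMap L K θ) = algebraMap k K ζ * algebraMap L K θ
  tau : τ (algebraMap k K ζ) = algebraMap k K ζ ^ 2
  repL : ∀ x : L, ∃ a b c : ℚ, x = a + b * θ + c * θ ^ 2
  repKL : ∀ x : K, ∃ a b : L, x = algebraMap L K a + algebraMap L K b * algebraMap k K ζ
  repk : ∀ x : k, ∃ a b : ℚ, x = a + b * ζ
  finrankL : Module.finrank ℚ L = 3
  finrankKL : Module.finrank L K = 2
  finrankKk : Module.finrank k K = 3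
  galois : IsGalois k K
  cyclotomic : IsCyclotomicExtension {3} ℚ k

namespace KummerTower

variable {L k K : Type} [Field L] [Field k] [Field K] [NumberField L]
    [NumberField k] [NumberField K] [Algebra L K] [Algebra k K] {d : ℕ} {θ : L} {ζ : k}
    {σ : K ≃ₐ[k] K} {τ : K ≃ₐ[L] K} (h : KummerTower d θ ζ σ τ)
include h

local notation "ι" => algebraMap L K
local notation "κ" => algebraMap k K

lemma theta_ne : θ ≠ 0 := by
  intro h0
  have := h.cube
  rw [h0] at this
  exact h.d_ne (by simpa using this.symm)

lemma zeta_cube : ζ ^ 3 = 1 := by linear_combination (ζ - 1) * h.root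

lemma zeta_ne : ζ ≠ 0 := by
  intro h0
  have := h.root
  simp [h0] at this

lemma zeta_ne_one : ζ ≠ 1 := by
  intro h0
  have := h.root
  norm_num [h0] at this

lemma root' : κ ζ ^ 2 + κ ζ + 1 = 0 := by
  simpa using congrArg κ h.root

lemma zeta_cube' : κ ζ ^ 3 = 1 := by simpa using congrArg κ h.zeta_cube

lemma cube' : ι θ ^ 3 = d := by simpa using congrArg ι h.cube

lemma theta_ne' : ι θ ≠ 0 := by simpa using h.theta_ne

lemma zeta_ne' : κ ζ ≠ 0 := by simpa using h.zeta_ne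

lemma repKk (x : K) : ∃ a b c : k, x = κ a + κ b * ι θ + κ c * ι θ ^ 2 := by
  obtain ⟨u, v, rfl⟩ := h.repKL x
  obtain ⟨a, b, c, rfl⟩ := h.repL u
  obtain ⟨a', b', c', rfl⟩ := h.repL v
  refine ⟨a + a' * ζ, b + b' * ζ, c + c' * ζ, ?_⟩
  simp only [map_add, map_mul, map_ratCast, map_pow]
  ring

lemma indepKk {a b c : k} (h0 : κ a + κ b * ι θ + κ c * ι θ ^ 2 = 0) : a = 0 ∧ b = 0 ∧ c = 0 := by
  have hli : LinearIndependent k ![(1 : K), ι θ, ι θ ^ 2] := by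
    apply linearIndependent_of_top_le_span_of_card_eq_finrank
    · intro x _
      obtain ⟨a, b, c, rfl⟩ := h.repKk x
      simp only [← Algebra.smul_def]
      refine Submodule.add_mem _ (Submodule.add_mem _ ?_ ?_) ?_
      · rw [← mul_one (κ a), ← Algebra.smul_def]
        exact Submodule.smul_mem _ _ (Submodule.subset_span ⟨0, rfl⟩)
      · exact Submodule.smul_mem _ _ (Submodule.subset_span ⟨1, rfl⟩)
      · exact Submodule.smul_mem _ _ (Submodule.subset_span ⟨2, rfl⟩)
    · simp [h.finrankKk]
  have := Fintype.linearIndependent_iff.1 hli ![a, b, c] (by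
    simpa [Fin.sum_univ_three, Algebra.smul_def] using h0)
  exact ⟨this 0, this 1, this 2⟩

lemma tau_sq (x : K) : τ (τ x) = x := by
  obtain ⟨a, b, rfl⟩ := h.repKL x
  simp only [map_add, map_mul, AlgEquiv.commutes, h.tau, map_pow]
  linear_combination ι b * κ ζ * h.zeta_cube'

lemma sigma_cube (x : K) : σ (σ (σ x)) = x := by
  obtain ⟨a, b, c, rfl⟩ := h.repKk x
  simp only [map_add, map_mul, AlgEquiv.commutes, h.sigma, map_pow]
  linear_combination (κ b * ι θ + κ c * ι θ ^ 2 * (κ ζ ^ 3 + 1)) * h.zeta_cube'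

lemma tau_k (y : k) : ∃ z : k, τ (κ y) = κ z := by
  obtain ⟨a, b, rfl⟩ := h.repk y
  exact ⟨a + b * ζ ^ 2, by simp [h.tau]⟩

lemma sigma_tau (x : K) : τ (σ x) = σ (σ (τ x)) := by
  obtain ⟨a, b, c, rfl⟩ := h.repKk x
  obtain ⟨a', ha⟩ := h.tau_k a
  obtain ⟨b', hb⟩ := h.tau_k b
  obtain ⟨c', hc⟩ := h.tau_k c
  simp only [map_add, map_mul, AlgEquiv.commutes, h.sigma, map_pow, ha, hb, hc, h.tau]
  ring

lemma mem_k {x : K} (hx : σ x = x) : ∃ y : k, x = κ y := by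
  obtain ⟨a, b, c, rfl⟩ := h.repKk x
  simp only [map_add, map_mul, AlgEquiv.commutes, h.sigma, map_pow] at hx
  have h1 : κ 0 + κ (b * (ζ - 1)) * ι θ + κ (c * (ζ ^ 2 - 1)) * ι θ ^ 2 = 0 := by
    simp only [map_mul, map_sub, map_one, map_pow, map_zero]
    linear_combination hx
  obtain ⟨-, hb, hc⟩ := h.indepKk h1
  have hz2 : ζ ^ 2 - 1 ≠ 0 := fun h2 => h.zeta_ne_one (by
    linear_combination (-ζ) * h2 + h.zeta_cube)
  have hb' : b = 0 := by simpa [sub_ne_zero.2 h.zeta_ne_one] using hb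
  have hc' : c = 0 := by simpa [hz2] using hc
  exact ⟨a, by simp [hb', hc']⟩

lemma mem_L {x : K} (hx : τ x = x) : ∃ y : L, x = ι y := by
  obtain ⟨a, b, rfl⟩ := h.repKL x
  refine ⟨a - b / 2, ?_⟩
  simp only [map_add, map_mul, AlgEquiv.commutes, h.tau] at hx
  simp only [map_sub, map_div₀, map_ofNat]
  linear_combination (-1/2) * hx + (1/2) * ι b * h.root'

lemma zeta_ne_zeta_sq : κ ζ ^ 2 - κ ζ ≠ 0 := by
  have := sub_ne_zero.2 h.zeta_ne_one
  have h2 : κ (ζ * (ζ - 1)) ≠ 0 := (map_ne_zero _).2 (mul_ne_zero h.zeta_ne this)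
  convert h2 using 1
  simp; ring

lemma mem_rat {y : k} (hy : τ (κ y) = κ y) : ∃ q : ℚ, y = q := by
  obtain ⟨a, b, rfl⟩ := h.repk y
  simp only [map_add, map_mul, map_ratCast, h.tau] at hy
  have hb : (b : K) * (κ ζ ^ 2 - κ ζ) = 0 := by linear_combination hy
  have : (b : K) = 0 := by simpa [h.zeta_ne_zeta_sq] using hb
  exact ⟨a, by simp [Rat.cast_eq_zero.1 this]⟩

lemma mem_rat' {x : K} (hs : σ x = x) (ht : τ x = x) : ∃ q : ℚ, x = q := by
  obtain ⟨y, rfl⟩ := h.mem_k hs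
  obtain ⟨q, rfl⟩ := h.mem_rat ht
  exact ⟨q, by simp⟩

lemma eq_zeta_pow {c : K} (hc : c ^ 3 = 1) : ∃ j : ℕ, j < 3 ∧ c = κ ζ ^ j := by
  have : (c - 1) * ((c - κ ζ) * (c - κ ζ ^ 2)) = 0 := by
    linear_combination hc + (c ^ 2 - c - c ^ 2 * 0) * (-1) * h.root' + (c - 1) * h.zeta_cube'
  rcases mul_eq_zero.1 this with h1 | h1
  · exact ⟨0, by norm_num, by simpa using sub_eq_zero.1 h1⟩
  rcases mul_eq_zero.1 h1 with h1 | h1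
  · exact ⟨1, by norm_num, by simpa using sub_eq_zero.1 h1⟩
  · exact ⟨2, by norm_num, sub_eq_zero.1 h1⟩

/-- Kummer theory: a rational number that is a cube in `L` is a power of `d` up to a rational
cube. -/
lemma kummer {r : ℚ} {l : L} (hr : r ≠ 0) (hl : (r : L) = l ^ 3) :
    ∃ (j : ℕ) (s : ℚ), j < 3 ∧ r = d ^ j * s ^ 3 := by
  have hl0 : l ≠ 0 := by
    rintro rfl
    simp [hr] at hl
  have hl0' : ι l ≠ 0 := by simpa using hl0
  have hlK : (r : K) = ι l ^ 3 := by simpa using congrArg ι hl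
  obtain ⟨j, hj, hc⟩ := h.eq_zeta_pow (c := σ (ι l) / ι l) (by
    rw [div_pow, ← map_pow, ← hlK, map_ratCast, div_self (by simpa using hr)])
  rw [div_eq_iff hl0'] at hc
  obtain ⟨s, hs⟩ := h.mem_rat' (x := ι (l / θ ^ j)) (by
    simp only [map_div₀, map_pow, h.sigma, hc]
    have h1 := h.theta_ne'
    have h2 := h.zeta_ne'
    field_simp
    ring) (by simp)
  refine ⟨j, s, hj, ?_⟩
  have hs' : l = s * θ ^ j := by
    have h1 : l / θ ^ j = s := (algebraMap L K).injective (by simpa using hs)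
    rw [← h1, div_mul_cancel₀ _ (pow_ne_zero _ h.theta_ne)]
  have : (r : L) = ((d ^ j * s ^ 3 : ℚ) : L) := by
    rw [hl, hs']
    push_cast
    rw [← h.cube]; ring
  exact_mod_cast this

end KummerTower

lemma dvd_of_dvd_sq_sub_mul_add_sq {q : ℕ} (hq : q.Prime) (hq3 : q % 3 = 2) {a b : ℤ}
    (h : (q : ℤ) ∣ a ^ 2 - a * b + b ^ 2) : (q : ℤ) ∣ a ∧ (q : ℤ) ∣ b := by
  have := Fact.mk hq
  have hz : (a : ZMod q) ^ 2 - a * b + b ^ 2 = 0 := by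
    have := (ZMod.intCast_zmod_eq_zero_iff_dvd _ q).2 h
    exact_mod_cast this
  suffices hb : (b : ZMod q) = 0 by
    rw [hb] at hz
    have ha : (a : ZMod q) = 0 := by simpa using hz
    exact ⟨(ZMod.intCast_zmod_eq_zero_iff_dvd _ q).1 ha,
      (ZMod.intCast_zmod_eq_zero_iff_dvd _ q).1 hb⟩
  by_contra hb
  set t : ZMod q := a / b with ht
  have h1 : t ^ 2 - t + 1 = 0 := by
    rw [ht]; field_simp; linear_combination hz
  have ht3 : t ^ 3 = -1 := by linear_combination (t + 1) * h1
  have ht0 : t ≠ 0 := by intro h0; simp [h0] at h1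
  have hq1 : t ^ (q - 1) = 1 := ZMod.pow_card_sub_one_eq_one ht0
  obtain ⟨m, hm⟩ : ∃ m, q - 1 = 3 * m + 1 := ⟨(q - 1) / 3, by have := hq.two_le; omega⟩
  rw [hm, pow_succ, pow_mul, ht3] at hq1
  have h3 : (3 : ZMod q) ≠ 0 := by
    intro h3
    have : q ∣ 3 := (ZMod.natCast_eq_zero_iff 3 q).1 (by exact_mod_cast h3)
    rw [(Nat.prime_dvd_prime_iff_eq hq Nat.prime_three).1 this] at hq3
    omega
  rcases neg_one_pow_eq_or (ZMod q) m with hm' | hm' <;> rw [hm'] at hq1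
  · have : t = 1 := by simpa using hq1
    rw [this] at h1
    have h2 : (1 : ZMod q) = 0 := by linear_combination h1
    exact one_ne_zero h2
  · have : t = -1 := by linear_combination -hq1
    rw [this] at h1
    exact h3 (by linear_combination h1)

lemma dvd_of_intCast_mem {R : Type*} [CommRing R] {I : Ideal R} (hI : I ≠ ⊤)
    {q : ℕ} (hq : q.Prime) (hqI : (q : R) ∈ I) {n : ℤ} (hn : (n : R) ∈ I) : (q : ℤ) ∣ n := by
  by_contra h
  have hc : IsCoprime (q : ℤ) n :=
    ((Nat.prime_iff_prime_int.1 hq).irreducible.coprime_iff_not_dvd).2 h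
  obtain ⟨u, v, huv⟩ := hc
  apply hI
  rw [Ideal.eq_top_iff_one]
  have h1 : (1 : R) = u * (q : R) + v * n := by exact_mod_cast congrArg (Int.cast (R := R)) huv.symm
  rw [h1]
  exact I.add_mem (I.mul_mem_left _ hqI) (I.mul_mem_left _ hn)

lemma natCast_not_isUnit {R : Type*} [CommRing R] [IsDomain R] [CharZero R] [Algebra.IsIntegral ℤ R]
    {q : ℕ} (hq : q.Prime) : ¬ IsUnit (q : R) := by
  intro hu
  have hp : (Ideal.span {(q : ℤ)}).IsPrime :=
    (Ideal.span_singleton_prime (by exact_mod_cast hq.ne_zero)).2 (Nat.prime_iff_prime_int.1 hq)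
  have hm : (Ideal.span {(q : ℤ)}).IsMaximal := hp.isMaximal (by simpa using hq.ne_zero)
  obtain ⟨Q, hQ, hQ'⟩ := Ideal.exists_maximal_ideal_liesOver_of_isIntegral (S := R)
    (Ideal.span {(q : ℤ)})
  have h1 : (q : ℤ) ∈ Q.under ℤ := by
    rw [← hQ'.over]; exact Ideal.mem_span_singleton_self _
  have h2 : (q : R) ∈ Q := by simpa [Ideal.under] using h1
  exact hQ.ne_top (Ideal.eq_top_of_isUnit_mem _ h2 hu)

section Eisenstein

open IsDedekindDomain

variable {k : Type*} [Field k] {ζ : k}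

lemma sq_add_self_add_one_of_isPrimitiveRoot (hζ : IsPrimitiveRoot ζ 3) : ζ ^ 2 + ζ + 1 = 0 := by
  have h1 : ζ - 1 ≠ 0 := sub_ne_zero.2 (hζ.ne_one (by norm_num))
  refine mul_left_cancel₀ h1 ?_
  linear_combination hζ.pow_eq_one

lemma isPrimitiveRoot_three [CharZero k] (hζ : ζ ^ 2 + ζ + 1 = 0) : IsPrimitiveRoot ζ 3 := by
  have h := IsPrimitiveRoot.orderOf ζ
  rwa [orderOf_eq_prime (p := 3) (by linear_combination (ζ - 1) * hζ)
    (by rintro rfl; norm_num at hζ)] at h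

variable (hζ : IsPrimitiveRoot ζ 3)
include hζ

lemma algebraMap_toInteger : algebraMap (𝓞 k) k hζ.toInteger = ζ := rfl

lemma toInteger_sq : hζ.toInteger ^ 2 = - hζ.toInteger - 1 := by
  ext
  simp only [map_pow, map_sub, map_neg, map_one, algebraMap_toInteger]
  linear_combination sq_add_self_add_one_of_isPrimitiveRoot hζ

variable [NumberField k] [IsCyclotomicExtension {3} ℚ k]

lemma exists_int_rep (x : 𝓞 k) : ∃ a b : ℤ, x = a + b * hζ.toInteger := by
  have hx : x ∈ Algebra.adjoin ℤ {hζ.toInteger} := by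
    rw [IsCyclotomicExtension.Rat.adjoin_singleton_eq_top hζ]; trivial
  induction hx using Algebra.adjoin_induction with
  | mem x hx => exact ⟨0, 1, by simpa using hx⟩
  | algebraMap r => exact ⟨r, 0, by simp⟩
  | add x y _ _ hx hy =>
    obtain ⟨a, b, rfl⟩ := hx
    obtain ⟨a', b', rfl⟩ := hy
    exact ⟨a + a', b + b', by push_cast; ring⟩
  | mul x y _ _ hx hy =>
    obtain ⟨a, b, rfl⟩ := hx
    obtain ⟨a', b', rfl⟩ := hy
    refine ⟨a * a' - b * b', a * b' + a' * b - b * b', ?_⟩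
    push_cast
    linear_combination (b * b' : 𝓞 k) * toInteger_sq hζ

lemma unit_eq_pow_mul_pow_three (u : (𝓞 k)ˣ) :
    ∃ (i : ℕ) (y : k), (u : k) = ζ ^ i * y ^ 3 := by
  have := IsCyclotomicExtension.Rat.Three.Units.mem hζ u
  simp only [List.mem_cons, List.not_mem_nil, or_false] at this
  rcases this with rfl | rfl | rfl | rfl | rfl | rfl
  · exact ⟨0, 1, by simp⟩
  · exact ⟨0, -1, by simp; norm_num⟩
  · exact ⟨1, 1, by simp [algebraMap_toInteger]⟩
  · exact ⟨1, -1, by simp [algebraMap_toInteger]; ring⟩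
  · exact ⟨2, 1, by simp [algebraMap_toInteger]⟩
  · exact ⟨2, -1, by simp [algebraMap_toInteger]; norm_num⟩

lemma IsIdealCube.exists_eq_zeta_pow_mul {x : k} (hx : x ≠ 0) (h : IsIdealCube (𝓞 k) x) :
    ∃ (i : ℕ) (y : k), x = ζ ^ i * y ^ 3 := by
  have := IsCyclotomicExtension.Rat.three_pid k
  obtain ⟨u, y, rfl⟩ := h.exists_eq_unit_mul_pow hx
  obtain ⟨i, z, hz⟩ := unit_eq_pow_mul_pow_three hζ u
  exact ⟨i, z * y, by rw [hz]; ring⟩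

omit [NumberField k] [IsCyclotomicExtension {3} ℚ k] in
lemma dvd_of_mem_prime {q : ℕ} (hq : q.Prime) (hq3 : q % 3 = 2) {I : Ideal (𝓞 k)} (hI : I ≠ ⊤)
    (hqI : (q : 𝓞 k) ∈ I) {a b : ℤ} (hab : (a + b * hζ.toInteger : 𝓞 k) ∈ I) :
    (q : ℤ) ∣ a ∧ (q : ℤ) ∣ b := by
  apply dvd_of_dvd_sq_sub_mul_add_sq hq hq3
  apply dvd_of_intCast_mem hI hq hqI
  have := I.mul_mem_left (a - b - b * hζ.toInteger : 𝓞 k) hab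
  convert this using 1
  push_cast
  linear_combination (b ^ 2 : 𝓞 k) * toInteger_sq hζ

lemma natCast_dvd_of_mem {q : ℕ} (hq : q.Prime) (hq3 : q % 3 = 2) {I : Ideal (𝓞 k)} (hI : I ≠ ⊤)
    (hqI : (q : 𝓞 k) ∈ I) {x : 𝓞 k} (hx : x ∈ I) : (q : 𝓞 k) ∣ x := by
  obtain ⟨a, b, rfl⟩ := exists_int_rep hζ x
  obtain ⟨⟨a, rfl⟩, ⟨b, rfl⟩⟩ := dvd_of_mem_prime hζ hq hq3 hI hqI hx
  exact ⟨a + b * hζ.toInteger, by push_cast; ring⟩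

lemma natCast_prime {q : ℕ} (hq : q.Prime) (hq3 : q % 3 = 2) : Prime (q : 𝓞 k) := by
  have hu : ¬ IsUnit (q : 𝓞 k) := natCast_not_isUnit hq
  obtain ⟨I, hI, hI'⟩ := Ideal.exists_le_maximal (Ideal.span {(q : 𝓞 k)}) (by
    rwa [Ne, Ideal.span_singleton_eq_top])
  have hqI : (q : 𝓞 k) ∈ I := hI' (Ideal.mem_span_singleton_self _)
  have : I = Ideal.span {(q : 𝓞 k)} := by
    refine le_antisymm (fun x hx => ?_) hI'
    exact Ideal.mem_span_singleton.2 (natCast_dvd_of_mem hζ hq hq3 hI.ne_top hqI hx)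
  rw [← Ideal.span_singleton_prime (by exact_mod_cast hq.ne_zero), ← this]
  exact hI.isPrime

end Eisenstein

section NumberFieldCube

variable {F : Type*} [Field F] [NumberField F]

lemma IsIdealCube.map {x : F} (h : IsIdealCube (𝓞 F) x) (f : F ≃+* F) : IsIdealCube (𝓞 F) (f x) :=
  h.map_ringEquiv (NumberField.RingOfIntegers.mapRingEquiv f) f fun _ => rfl

lemma IsIdealCube.exists_norm_eq_pow {x : F} (hx : x ≠ 0) (h : IsIdealCube (𝓞 F) x) :
    ∃ n : ℚ, Algebra.norm ℚ x = n ^ 3 := by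
  obtain ⟨a, b, hb, rfl⟩ := IsFractionRing.div_surjective (A := 𝓞 F) x
  have hb0 : algebraMap (𝓞 F) F b ≠ 0 := by simpa using nonZeroDivisors.ne_zero hb
  have ha0 : a ≠ 0 := by rintro rfl; simp at hx
  have h1 : IsIdealCube (𝓞 F) (algebraMap (𝓞 F) F (a * b ^ 2)) := by
    have := h.mul (isIdealCube_pow_three (R := 𝓞 F) (algebraMap (𝓞 F) F b))
    convert this using 1
    rw [map_mul, map_pow]; field_simp
  obtain ⟨I, hI⟩ := h1.exists_span_eq_pow (mul_ne_zero ha0 (pow_ne_zero 2 (by simpa using hb0)))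
  have h2 : (Algebra.norm ℤ (a * b ^ 2)).natAbs = (Ideal.absNorm I) ^ 3 := by
    rw [← Ideal.absNorm_span_singleton, hI, map_pow]
  have h3 : ∃ m : ℤ, Algebra.norm ℤ (a * b ^ 2) = m ^ 3 := by
    rcases Int.natAbs_eq (Algebra.norm ℤ (a * b ^ 2)) with h | h
    · exact ⟨Ideal.absNorm I, by rw [h, h2]; push_cast; rfl⟩
    · exact ⟨-Ideal.absNorm I, by rw [h, h2]; push_cast; ring⟩
  obtain ⟨m, hm⟩ := h3
  have h4 : Algebra.norm ℚ (algebraMap (𝓞 F) F (a * b ^ 2)) = (m : ℚ) ^ 3 := by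
    have := Algebra.coe_norm_int (a * b ^ 2)
    rw [hm] at this
    exact_mod_cast this.symm
  have hnb : Algebra.norm ℚ (algebraMap (𝓞 F) F b) ≠ 0 := by
    rwa [Ne, Algebra.norm_eq_zero_iff]
  refine ⟨m / Algebra.norm ℚ (algebraMap (𝓞 F) F b), ?_⟩
  have h5 : Algebra.norm ℚ (algebraMap (𝓞 F) F a / algebraMap (𝓞 F) F b) *
      Algebra.norm ℚ (algebraMap (𝓞 F) F b) = Algebra.norm ℚ (algebraMap (𝓞 F) F a) := by
    rw [← map_mul, div_mul_cancel₀ _ hb0]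
  rw [map_mul, map_pow, map_mul, map_pow, ← h5] at h4
  rw [div_pow, ← h4]
  field_simp

end NumberFieldCube

namespace KummerTower

open IsDedekindDomain

variable {L k K : Type} [Field L] [Field k] [Field K] [NumberField L]
    [NumberField k] [NumberField K] [Algebra L K] [Algebra k K] {d : ℕ} {θ : L} {ζ : k}
    {σ : K ≃ₐ[k] K} {τ : K ≃ₐ[L] K} (h : KummerTower d θ ζ σ τ)
include h

local notation "ι" => algebraMap L K
local notation "κ" => algebraMap k K

lemma prim : IsPrimitiveRoot ζ 3 := isPrimitiveRoot_three h.root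

lemma exists_conj : ∃ ρ : k ≃ₐ[ℚ] k, ∀ y, τ (κ y) = κ (ρ y) := by
  have := h.cyclotomic
  have : IsGalois ℚ k := IsCyclotomicExtension.isGalois {3} ℚ k
  exact ⟨(τ.restrictScalars ℚ).restrictNormal k, fun y =>
    (AlgEquiv.restrictNormal_commutes (τ.restrictScalars ℚ) k y).symm⟩

lemma hilbert90 {c : K} (hc : c * σ c * σ (σ c) = 1) : ∃ δ : K, δ ≠ 0 ∧ σ δ = c * δ := by
  have hc0 : c ≠ 0 := by rintro rfl; simp at hc
  have key : ∀ t : K, σ (t + c⁻¹ * σ t + c⁻¹ * σ c⁻¹ * σ (σ t)) =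
      c * (t + c⁻¹ * σ t + c⁻¹ * σ c⁻¹ * σ (σ t)) := fun t => by
    have h1 : σ c ≠ 0 := by simpa using hc0
    have h2 : σ (σ c) ≠ 0 := by simpa using hc0
    simp only [map_add, map_mul, map_inv₀, h.sigma_cube]
    field_simp
    linear_combination (-t) * hc
  by_contra! hne
  have h0 : ∀ t : K, t + c⁻¹ * σ t + c⁻¹ * σ c⁻¹ * σ (σ t) = 0 := fun t => by
    by_contra ht
    exact hne _ ht (key t)
  have e0 := h0 1
  have e1 := h0 (ι θ)
  have e2 := h0 (ι θ ^ 2)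
  simp only [map_mul, map_one, map_pow, h.sigma, AlgEquiv.commutes] at e0 e1 e2
  have f1 : 1 + c⁻¹ * κ ζ + c⁻¹ * σ c⁻¹ * κ ζ ^ 2 = 0 := by
    refine mul_left_cancel₀ h.theta_ne' ?_
    linear_combination e1
  have f2 : 1 + c⁻¹ * κ ζ ^ 2 + c⁻¹ * σ c⁻¹ * κ ζ ^ 4 = 0 := by
    refine mul_left_cancel₀ (pow_ne_zero 2 h.theta_ne') ?_
    linear_combination e2
  have : (3 : K) = 0 := by
    linear_combination e0 + f1 + f2 - (c⁻¹ + c⁻¹ * σ c⁻¹) * h.root' -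
      c⁻¹ * σ c⁻¹ * κ ζ * h.zeta_cube'
  norm_num at this

lemma norm_eq {x : L} : ∃ q : ℚ, ι x * σ (ι x) * σ (σ (ι x)) = q ∧
    (q = Algebra.norm ℚ x ∨ q = -Algebra.norm ℚ x) := by
  obtain ⟨q, hq⟩ := h.mem_rat' (x := ι x * σ (ι x) * σ (σ (ι x))) (by
    simp only [map_mul, h.sigma_cube]; ring) (by
    simp only [map_mul, h.sigma_tau, AlgEquiv.commutes, h.sigma_cube]; ring)
  refine ⟨q, hq, ?_⟩
  have hs : ∀ y : K, Algebra.norm ℚ (σ y) = Algebra.norm ℚ y := fun y =>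
    Algebra.norm_eq_of_algEquiv (σ.restrictScalars ℚ) y
  have hdeg : Module.finrank ℚ K = 6 := by
    rw [← Module.finrank_mul_finrank ℚ L K, h.finrankL, h.finrankKL]
  have h1 : Algebra.norm ℚ (ι x) = Algebra.norm ℚ x ^ 2 := by
    rw [← Algebra.norm_norm (R := ℚ) (S := L), Algebra.norm_algebraMap, h.finrankKL, map_pow]
  have h2 : Algebra.norm ℚ (q : K) = q ^ 6 := by
    rw [← hdeg, ← Algebra.norm_algebraMap]; simp
  have h3 : q ^ 6 = (Algebra.norm ℚ x) ^ 6 := by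
    rw [← h2, ← hq]; simp only [map_mul, hs, h1]; ring
  have h4 := (pow_eq_pow_iff_of_ne_zero (by norm_num : 6 ≠ 0)).1 h3
  simpa [(by decide : Even 6)] using h4

lemma exists_zeta_pow_of_mul_conj (hd : ∀ p : ℕ, p.Prime → p ∣ d → p = 3 ∨ p % 3 = 2)
    {x e : k} (hx : x ≠ 0) (hK : IsIdealCube (𝓞 K) (κ x)) (he : κ x * τ (κ x) = κ e ^ 3) :
    ∃ (i : ℕ) (y : k), x = ζ ^ i * y ^ 3 := by
  have := h.cyclotomic
  refine IsIdealCube.exists_eq_zeta_pow_mul h.prim hx fun v => ?_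
  obtain ⟨ρ, hρ⟩ := h.exists_conj
  have he' : x * ρ x = e ^ 3 := by
    apply (algebraMap k K).injective
    rw [map_mul, ← hρ, he, map_pow]
  have hstab : (∀ r ∈ v.asIdeal,
        NumberField.RingOfIntegers.mapRingEquiv ρ.toRingEquiv r ∈ v.asIdeal)
      → ∃ m, v.valuation k x = m ^ 3 := fun hv => by
    have h1 := valuation_eq_of_stable (F := k)
      (NumberField.RingOfIntegers.mapRingEquiv ρ.toRingEquiv)
      ρ.toRingEquiv (fun _ => rfl) v hv x
    refine exists_cube_of_coprime_pow (e := 2) (m := v.valuation k e) ?_ (Or.inr rfl) ?_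
    · simpa using hx
    · rw [← map_pow (v.valuation k) e, ← he', map_mul, sq]
      congr 1
      exact h1.symm
  have hρζ : ρ ζ = ζ ^ 2 := (algebraMap k K).injective (by rw [← hρ, h.tau, map_pow])
  have hρη : NumberField.RingOfIntegers.mapRingEquiv ρ.toRingEquiv h.prim.toInteger =
      h.prim.toInteger ^ 2 := by
    apply FaithfulSMul.algebraMap_injective (𝓞 k) k
    rw [map_pow]
    exact hρζ
  by_cases h3 : (3 : 𝓞 k) ∈ v.asIdeal
  · apply hstab
    intro r hr
    obtain ⟨a, b, rfl⟩ := exists_int_rep h.prim r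
    have hlam : (1 - h.prim.toInteger : 𝓞 k) ∈ v.asIdeal := by
      refine v.isPrime.mem_of_pow_mem 2 ?_
      have : (1 - h.prim.toInteger) ^ 2 = (- h.prim.toInteger) * 3 := by
        linear_combination toInteger_sq h.prim
      rw [this]
      exact v.asIdeal.mul_mem_left _ h3
    simp only [map_add, map_mul, map_intCast, hρη]
    have h2 := v.asIdeal.sub_mem hr (v.asIdeal.mul_mem_left (b * h.prim.toInteger : 𝓞 k) hlam)
    convert h2 using 1
    ring
  by_cases hdv : (d : 𝓞 k) ∈ v.asIdeal
  · have hex : ∃ p : ℕ, p.Prime ∧ p ∣ d ∧ (p : 𝓞 k) ∈ v.asIdeal := by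
      have hd0 := h.d_ne
      clear * - hdv hd0 
      induction d using Nat.recOnMul with
      | zero => exact absurd rfl hd0
      | one => exact absurd (v.asIdeal.eq_top_iff_one.2 (by simpa using hdv)) v.isPrime.ne_top
      | prime p hp => exact ⟨p, hp, dvd_rfl, hdv⟩
      | mul a b ha hb =>
        rw [Nat.cast_mul] at hdv
        rcases v.isPrime.mem_or_mem hdv with h1 | h1
        · obtain ⟨p, hp, hpa, hpv⟩ := ha h1 (left_ne_zero_of_mul hd0)
          exact ⟨p, hp, hpa.mul_right _, hpv⟩
        · obtain ⟨p, hp, hpa, hpv⟩ := hb h1 (right_ne_zero_of_mul hd0)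
          exact ⟨p, hp, hpa.mul_left _, hpv⟩
    obtain ⟨p, hp, hpd, hpv⟩ := hex
    rcases hd p hp hpd with rfl | hp3
    · exact absurd (by exact_mod_cast hpv) h3
    apply hstab
    intro r hr
    obtain ⟨s, rfl⟩ := natCast_dvd_of_mem h.prim hp hp3 v.isPrime.ne_top hpv hr
    rw [map_mul, map_natCast]
    exact v.asIdeal.mul_mem_right _ hpv
  · have hθint : IsIntegral ℤ (ι θ) := by
      refine IsIntegral.of_pow (n := 3) (by norm_num) ?_
      rw [h.cube']; exact_mod_cast isIntegral_algebraMap (R := ℤ) (A := K) (x := (d : ℤ))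
    obtain ⟨t, ht⟩ : ∃ t : 𝓞 K, algebraMap (𝓞 K) K t = ι θ := ⟨⟨ι θ, hθint⟩, rfl⟩
    refine exists_valuation_eq_cube_of_unramified (S := 𝓞 K) (E := K) hK (θ := t)
      (d := (d : 𝓞 k)) ?_ ?_ v ?_
    · apply FaithfulSMul.algebraMap_injective (𝓞 K) K
      rw [map_pow, ht, h.cube']
      simp
    · rw [eq_top_iff]
      intro y _
      obtain ⟨a, b, c, rfl⟩ := h.repKk y
      have hm : ι θ ∈ Algebra.adjoin k {algebraMap (𝓞 K) K t} :=
        Algebra.subset_adjoin ht.symm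
      exact add_mem (add_mem (Subalgebra.algebraMap_mem _ _)
        (mul_mem (Subalgebra.algebraMap_mem _ _) hm))
        (mul_mem (Subalgebra.algebraMap_mem _ _) (pow_mem hm 2))
    · intro hmem
      rcases v.isPrime.mem_or_mem hmem with h1 | h1
      exacts [h3 h1, hdv h1]

end KummerTower

namespace KummerTower

open IsDedekindDomain

variable {L k K : Type} [Field L] [Field k] [Field K] [NumberField L]
    [NumberField k] [NumberField K] [Algebra L K] [Algebra k K] {d : ℕ} {θ : L} {ζ : k}
    {σ : K ≃ₐ[k] K} {τ : K ≃ₐ[L] K}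

local notation "ι" => algebraMap L K
local notation "κ" => algebraMap k K

/-- Up to a rational factor, `γ` is `σ δ / δ` for some `δ` of norm `x` over `k`. -/
def IsTwist (σ : K ≃ₐ[k] K) (γ : L) (x : k) : Prop :=
  ∃ (n : ℚ) (δ : K), n ≠ 0 ∧ δ ≠ 0 ∧ ι γ * δ = n * σ δ ∧ δ * σ δ * σ (σ δ) = κ x

omit [NumberField L] [NumberField k] in
lemma IsTwist.mul {γ γ' : L} {x x' : k} (h : IsTwist σ γ x) (h' : IsTwist σ γ' x') :
    IsTwist σ (γ * γ') (x * x') := by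
  obtain ⟨n, δ, hn, hδ, h1, h2⟩ := h
  obtain ⟨n', δ', hn', hδ', h1', h2'⟩ := h'
  refine ⟨n * n', δ * δ', mul_ne_zero hn hn', mul_ne_zero hδ hδ', ?_, ?_⟩
  · simp only [map_mul, Rat.cast_mul]
    linear_combination ι γ' * δ' * h1 + n * σ δ * h1'
  · simp only [map_mul]
    rw [← h2, ← h2']; ring

omit [NumberField L] [NumberField k] in
lemma isTwist_one : IsTwist σ (1 : L) 1 := ⟨1, 1, by simp⟩

omit [NumberField L] [NumberField k] in
lemma IsTwist.pow {γ : L} {x : k} (h : IsTwist σ γ x) (m : ℕ) : IsTwist σ (γ ^ m) (x ^ m) := by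
  induction m with
  | zero => simpa using isTwist_one
  | succ m ih => rw [pow_succ, pow_succ]; exact ih.mul h

omit [NumberField L] [NumberField k] [NumberField K] in
lemma IsTwist.of_mul_pow {γ : L} {x y : k} (hy : y ≠ 0) (h : IsTwist σ γ (x * y ^ 3)) :
    IsTwist σ γ x := by
  obtain ⟨n, δ, hn, hδ, h1, h2⟩ := h
  have hy' : κ y ≠ 0 := by simpa using hy
  refine ⟨n, δ / κ y, hn, div_ne_zero hδ hy', ?_, ?_⟩
  · rw [map_div₀, AlgEquiv.commutes, ← mul_div_assoc, h1, mul_div_assoc]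
  · simp only [map_div₀, AlgEquiv.commutes]
    rw [map_mul, map_pow] at h2
    field_simp
    rw [h2]; ring

variable (h : KummerTower d θ ζ σ τ)
include h

lemma exists_isTwist (hd : ∀ p : ℕ, p.Prime → p ∣ d → p = 3 ∨ p % 3 = 2)
    {γ : L} (hγ : γ ≠ 0) (hL : IsIdealCube (𝓞 L) γ) : ∃ i : ℕ, IsTwist σ γ (ζ ^ i) := by
  have hγ' : ι γ ≠ 0 := by simpa using hγ
  obtain ⟨n, hn⟩ : ∃ n : ℚ, ι γ * σ (ι γ) * σ (σ (ι γ)) = (n : K) ^ 3 := by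
    obtain ⟨q, hq, hq'⟩ := h.norm_eq (x := γ)
    obtain ⟨n, hn⟩ := hL.exists_norm_eq_pow hγ
    rcases hq' with rfl | rfl
    · exact ⟨n, by rw [hq, hn]; push_cast; rfl⟩
    · exact ⟨-n, by rw [hq, hn]; push_cast; ring⟩
  have hn0 : (n : K) ≠ 0 := by
    intro h0
    rw [h0] at hn
    simp [hγ] at hn
  set c : K := ι γ / n with hc
  have hc0 : c ≠ 0 := div_ne_zero hγ' hn0
  have hτc : τ c = c := by simp [hc]
  have hNc : c * σ c * σ (σ c) = 1 := by
    simp only [hc, map_div₀, map_ratCast]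
    field_simp
    exact hn
  obtain ⟨δ, hδ, hσδ⟩ := h.hilbert90 hNc
  obtain ⟨x, hx⟩ := h.mem_k (x := δ * σ δ * σ (σ δ)) (by
    simp only [map_mul, h.sigma_cube]; ring)
  have hστ : σ (τ δ) = τ (σ (σ δ)) := by
    rw [h.sigma_tau, h.sigma_tau, h.sigma_cube]
  have hτσc : τ (σ c) = σ (σ c) := by rw [h.sigma_tau, hτc]
  obtain ⟨e, he⟩ := h.mem_k (x := δ * c * τ δ) (by
    simp only [map_mul, hστ, hσδ, hτσc, hτc]
    linear_combination δ * c * τ δ * hNc)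
  have hx' : κ x = δ ^ 3 * c ^ 2 * σ c := by
    rw [← hx]; simp only [hσδ, map_mul]; ring
  have hx0 : x ≠ 0 := by
    rintro rfl
    rw [map_zero] at hx
    simp [hδ] at hx
  have hIK : IsIdealCube (𝓞 K) (ι γ) := hL.extend (𝓞 L) (𝓞 K)
  obtain ⟨i, y, hy⟩ := h.exists_zeta_pow_of_mul_conj hd (x := x) (e := e) hx0 (by
    have h1 := ((hIK.pow 2).mul (hIK.map σ.toRingEquiv)).mul
      (isIdealCube_pow_three (R := 𝓞 K) (δ / n))
    convert h1 using 1
    rw [hx', hc]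
    simp only [map_div₀, map_ratCast]
    change _ = ι γ ^ 2 * σ (ι γ) * _
    field_simp) (by
    rw [hx', ← he]
    simp only [map_mul, map_pow, hτc, hτσc]
    linear_combination δ ^ 3 * c ^ 3 * τ δ ^ 3 * hNc)
  refine ⟨i, IsTwist.of_mul_pow (y := y) ?_ ⟨n, δ, by exact_mod_cast hn0, hδ, ?_, by rw [hx, hy]⟩⟩
  · rintro rfl
    simp [hy] at hx0
  · rw [hσδ, hc]; field_simp

lemma eq_rat_mul_pow_of_isTwist {γ : L} (hγ : IsTwist σ γ 1) :
    ∃ (r : ℚ) (l : L), r ≠ 0 ∧ γ = r * l ^ 3 := by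
  obtain ⟨n, δ, hn, hδ, h1, h2⟩ := hγ
  obtain ⟨ε, hε, hσε⟩ := h.hilbert90 (by simpa using h2)
  have hσε' : σ ε ≠ 0 := by simpa using hε
  have hn' : (n : K) ≠ 0 := by simpa using hn
  obtain ⟨x, hx⟩ := h.mem_k (x := n * (ε * σ ε * σ (σ ε))) (by
    simp only [map_mul, h.sigma_cube, map_ratCast]; ring)
  have hγx : ι γ = κ x / (σ ε) ^ 3 := by
    have hδ' : δ = σ ε / ε := by rw [hσε]; field_simp
    rw [hδ', map_div₀] at h1
    rw [← hx]
    field_simp at h1 ⊢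
    linear_combination h1
  have hγ0 : γ ≠ 0 := by
    rintro rfl
    have : (n : K) * σ δ ≠ 0 := mul_ne_zero hn' (by simpa using hδ)
    exact this (by simpa using h1.symm)
  obtain ⟨z, hz⟩ := h.tau_k x
  obtain ⟨r, hr⟩ := h.mem_rat (y := x * z) (by
    rw [map_mul, ← hz, map_mul, h.tau_sq]; ring)
  obtain ⟨l, hl⟩ := h.mem_L (x := σ ε * τ (σ ε)) (by rw [map_mul, h.tau_sq]; ring)
  have hτε : τ (σ ε) ≠ 0 := by simpa using hε
  have hl0 : ι l ≠ 0 := by rw [← hl]; exact mul_ne_zero hσε' hτε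
  have hsq : γ ^ 2 = r / l ^ 3 := by
    apply (algebraMap L K).injective
    have h3 : ι γ = τ (ι γ) := by simp
    have h4 : κ x * κ z = (r : K) := by rw [← map_mul, hr]; simp
    rw [map_pow, sq]
    nth_rw 2 [h3]
    rw [hγx, map_div₀ τ, hz, map_pow τ, map_div₀, map_pow, map_ratCast, ← hl, ← h4]
    field_simp
  have hl0' : l ≠ 0 := by simpa using hl0
  have hr0 : r ≠ 0 := by
    rintro rfl
    have : γ ^ 2 = 0 := by rw [hsq]; simp
    exact hγ0 (by simpa using this)
  refine ⟨r⁻¹, γ * l, inv_ne_zero hr0, ?_⟩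
  have hr0' : (r : L) ≠ 0 := by simpa using hr0
  rw [eq_div_iff (pow_ne_zero 3 hl0')] at hsq
  push_cast
  field_simp
  linear_combination -hsq

end KummerTower

section RationalCubes

open IsDedekindDomain IsDedekindDomain.HeightOneSpectrum WithZero

lemma valuation_eq_one_of_notMem {R F : Type*} [CommRing R] [IsDedekindDomain R] [Field F]
    [Algebra R F] [IsFractionRing R F] {v : HeightOneSpectrum R} {x : R} (hx : x ∉ v.asIdeal) :
    v.valuation F (algebraMap R F x) = 1 := by
  rw [valuation_of_algebraMap, intValuation_eq_one_iff_mem_primeCompl]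
  exact hx

lemma natCast_mem_unique {p q : ℕ} (hp : p.Prime) (hq : q.Prime) {R : Type*} [CommRing R]
    {I : Ideal R} (hI : I ≠ ⊤) (hpI : (p : R) ∈ I) (hqI : (q : R) ∈ I) : p = q := by
  have := dvd_of_intCast_mem hI hp hpI (n := q) (by simpa using hqI)
  exact (Nat.prime_dvd_prime_iff_eq hp hq).1 (by exact_mod_cast this)

lemma exists_valuation_mul_pow_eq_cube {p : ℕ} (hp : p.Prime) {r : ℚ} (hr : r ≠ 0)
    {T : Set (HeightOneSpectrum ℤ)}
    (hT : ∀ v ∈ T, (p : ℤ) ∉ v.asIdeal → ∃ m : ℤᵐ⁰, v.valuation ℚ r = m ^ 3) :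
    ∃ a : ℕ, a < 3 ∧ ∀ v ∈ T, ∃ m : ℤᵐ⁰, v.valuation ℚ (r * p ^ a) = m ^ 3 := by
  have hp0 : (p : ℤ) ≠ 0 := by exact_mod_cast hp.ne_zero
  have hpp : (Ideal.span {(p : ℤ)}).IsPrime :=
    (Ideal.span_singleton_prime hp0).2 (Nat.prime_iff_prime_int.1 hp)
  let v₀ : HeightOneSpectrum ℤ := ⟨Ideal.span {(p : ℤ)}, hpp, by simpa using hp0⟩
  have hv₀ : v₀.valuation ℚ (p : ℚ) = exp (-1 : ℤ) := by
    have h1 : (p : ℚ) = algebraMap ℤ ℚ p := by simp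
    rw [h1, valuation_of_algebraMap, intValuation_singleton v₀ hp0 rfl]
  have hr' : v₀.valuation ℚ r ≠ 0 := by simpa using hr
  refine ⟨(log (v₀.valuation ℚ r) % 3).toNat, by omega, fun v hv => ?_⟩
  by_cases hpv : (p : ℤ) ∈ v.asIdeal
  · have : v = v₀ := by
      ext1
      exact ((hpp.isMaximal (by simpa using hp0)).eq_of_le v.isPrime.ne_top
        ((Ideal.span_singleton_le_iff_mem _).2 hpv)).symm
    subst this
    refine ⟨exp (log (v₀.valuation ℚ r) / 3), ?_⟩
    rw [map_mul, map_pow, hv₀]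
    nth_rw 1 [← exp_log hr']
    rw [← exp_nsmul, ← exp_nsmul, ← exp_add]
    congr 1
    simp only [nsmul_eq_mul]
    push_cast
    omega
  · obtain ⟨m, hm⟩ := hT v hv hpv
    refine ⟨m, ?_⟩
    have h1 : (p : ℚ) = algebraMap ℤ ℚ p := by simp
    rw [map_mul, map_pow, h1, valuation_eq_one_of_notMem hpv, one_pow, mul_one, hm]

lemma exists_eq_prod_pow_mul_cube {p₁ p₂ p₃ : ℕ} (hp₁ : p₁.Prime) (hp₂ : p₂.Prime)
    (hp₃ : p₃.Prime) {r : ℚ} (hr : r ≠ 0)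
    (h : ∀ v : HeightOneSpectrum ℤ, (p₁ : ℤ) ∉ v.asIdeal → (p₂ : ℤ) ∉ v.asIdeal →
      (p₃ : ℤ) ∉ v.asIdeal → ∃ m : ℤᵐ⁰, v.valuation ℚ r = m ^ 3) :
    ∃ (a b c : ℕ) (s : ℚ), r = p₁ ^ a * p₂ ^ b * p₃ ^ c * s ^ 3 := by
  have h₁ : (p₁ : ℚ) ≠ 0 := by exact_mod_cast hp₁.ne_zero
  have h₂ : (p₂ : ℚ) ≠ 0 := by exact_mod_cast hp₂.ne_zero
  have h₃ : (p₃ : ℚ) ≠ 0 := by exact_mod_cast hp₃.ne_zero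
  obtain ⟨a, -, ha⟩ := exists_valuation_mul_pow_eq_cube hp₁ hr
    (T := {v | (p₂ : ℤ) ∉ v.asIdeal ∧ (p₃ : ℤ) ∉ v.asIdeal}) fun v hv h1 => h v h1 hv.1 hv.2
  obtain ⟨b, -, hb⟩ := exists_valuation_mul_pow_eq_cube hp₂ (r := r * p₁ ^ a) (by positivity)
    (T := {v | (p₃ : ℤ) ∉ v.asIdeal}) fun v hv h1 => ha v ⟨h1, hv⟩
  obtain ⟨c, -, hc⟩ := exists_valuation_mul_pow_eq_cube hp₃ (r := r * p₁ ^ a * p₂ ^ b)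
    (by positivity) (T := Set.univ) fun v _ h1 => hb v h1
  obtain ⟨u, s, hs⟩ := IsIdealCube.exists_eq_unit_mul_pow (R := ℤ)
    (x := r * p₁ ^ a * p₂ ^ b * p₃ ^ c) (by positivity) fun v => hc v trivial
  obtain ⟨t, ht⟩ : ∃ t : ℚ, r * p₁ ^ a * p₂ ^ b * p₃ ^ c = t ^ 3 := by
    rcases Int.units_eq_one_or u with rfl | rfl
    · exact ⟨s, by rw [hs]; simp⟩
    · exact ⟨-s, by rw [hs]; simp; ring⟩
  refine ⟨2 * a, 2 * b, 2 * c, t / (p₁ ^ a * p₂ ^ b * p₃ ^ c), ?_⟩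
  rw [div_pow, ← ht]
  field_simp
  ring

variable {F : Type*} [Field F] [NumberField F]

lemma isIdealCube_natCast {p : ℕ}
    (h : ∀ w : HeightOneSpectrum (𝓞 F), (p : 𝓞 F) ∈ w.asIdeal →
      ∃ m : ℤᵐ⁰, w.valuation F (p : F) = m ^ 3) : IsIdealCube (𝓞 F) (p : F) := fun w => by
  by_cases hpw : (p : 𝓞 F) ∈ w.asIdeal
  · exact h w hpw
  · exact ⟨1, by simpa using valuation_eq_one_of_notMem (F := F) hpw⟩

/-- A prime dividing the radicand is totally ramified. -/
lemma isIdealCube_of_dvd_radicand {p m f : ℕ} (hp : p.Prime) (hf : f = 1 ∨ f = 2) (hpm : ¬ p ∣ m)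
    {θ : F} (hθ : θ ^ 3 = (p ^ f * m : ℕ)) : IsIdealCube (𝓞 F) (p : F) := by
  refine isIdealCube_natCast fun w hw => ?_
  refine exists_cube_of_coprime_pow (m := w.valuation F θ) ?_ hf ?_
  · simpa using hp.ne_zero
  · have hm : (m : 𝓞 F) ∉ w.asIdeal := fun hm => hpm (by
      exact_mod_cast dvd_of_intCast_mem w.isPrime.ne_top hp hw (n := m) (by simpa using hm))
    have hm' : w.valuation F (m : F) = 1 := by
      simpa using valuation_eq_one_of_notMem (F := F) hm
    rw [← map_pow, ← map_pow, hθ]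
    push_cast
    rw [map_mul, hm', mul_one]

/-- `3` is totally ramified when the radicand is not `±1` modulo `9`. -/
lemma isIdealCube_three {d : ℕ} (h3 : ¬ 3 ∣ d) (h9 : ¬ (d % 9 = 1 ∨ d % 9 = 8)) {θ : F}
    (hθ : θ ^ 3 = d) : IsIdealCube (𝓞 F) (3 : F) := by
  have hint : IsIntegral ℤ θ := by
    refine IsIntegral.of_pow (n := 3) (by norm_num) ?_
    rw [hθ]; exact_mod_cast isIntegral_algebraMap (R := ℤ) (A := F) (x := (d : ℤ))
  obtain ⟨t, ht⟩ : ∃ t : 𝓞 F, algebraMap (𝓞 F) F t = θ := ⟨⟨θ, hint⟩, rfl⟩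
  have ht3 : t ^ 3 = d := by
    apply FaithfulSMul.algebraMap_injective (𝓞 F) F
    rw [map_pow, ht, hθ]; simp
  obtain ⟨u, hu, hu3⟩ : ∃ u : ℤ, (d : ℤ) - d ^ 3 = 3 * u ∧ ¬ (3 : ℤ) ∣ u := by
    have h6 : ((d : ℤ) - d ^ 3) % 9 = 3 ∨ ((d : ℤ) - d ^ 3) % 9 = 6 := by
      have h8 : (d : ℤ) % 9 = 2 ∨ (d : ℤ) % 9 = 4 ∨ (d : ℤ) % 9 = 5 ∨ (d : ℤ) % 9 = 7 := by omega
      rcases h8 with h | h | h | h <;> simp [Int.sub_emod, pow_succ, Int.mul_emod, h]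
    exact ⟨((d : ℤ) - d ^ 3) / 3, by omega, by omega⟩
  have := isIdealCube_natCast (F := F) (p := 3) fun w hw => ?_
  · exact_mod_cast this
  have hw' : (3 : 𝓞 F) ∈ w.asIdeal := by exact_mod_cast hw
  set β : 𝓞 F := t - d with hβ
  have hβ3 : β ^ 3 = 3 * (u - d * β ^ 2 - d ^ 2 * β) := by
    have hu' : (d : 𝓞 F) - d ^ 3 = 3 * u := by exact_mod_cast congrArg (Int.cast (R := 𝓞 F)) hu
    rw [hβ]
    linear_combination ht3 + hu'
  have hβw : β ∈ w.asIdeal := by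
    refine w.isPrime.mem_of_pow_mem 3 ?_
    rw [hβ3]
    exact w.asIdeal.mul_mem_right _ hw'
  have hunit : (u - d * β ^ 2 - d ^ 2 * β : 𝓞 F) ∉ w.asIdeal := fun hmem => by
    apply hu3
    refine dvd_of_intCast_mem w.isPrime.ne_top Nat.prime_three hw (n := u) ?_
    have := w.asIdeal.add_mem hmem (w.asIdeal.mul_mem_left (d * β + d ^ 2) hβw)
    convert this using 1
    ring
  refine ⟨w.valuation F (algebraMap (𝓞 F) F β), ?_⟩
  rw [← map_pow, ← map_pow, hβ3, map_mul, map_mul, valuation_eq_one_of_notMem hunit, mul_one]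
  simp [map_ofNat (algebraMap (𝓞 F) F)]

end RationalCubes

namespace KummerTower

open IsDedekindDomain IsDedekindDomain.HeightOneSpectrum

variable {L k K : Type} [Field L] [Field k] [Field K] [NumberField L]
    [NumberField k] [NumberField K] [Algebra L K] [Algebra k K] {d : ℕ} {θ : L} {ζ : k}
    {σ : K ≃ₐ[k] K} {τ : K ≃ₐ[L] K} (h : KummerTower d θ ζ σ τ)
include h

local notation "ι" => algebraMap L K
local notation "κ" => algebraMap k K

omit h [NumberField L] [NumberField k] in
/-- Traces of algebraic integers of `L` are rational integers. -/
lemma trace_isIntegral {x : L} (hx : IsIntegral ℤ x) {q : ℚ}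
    (hq : ι x + σ (ι x) + σ (σ (ι x)) = q) : ∃ n : ℤ, q = n := by
  have hx' : IsIntegral ℤ (ι x) := hx.map (algebraMap L K).toIntAlgHom
  have hs : ∀ {y : K}, IsIntegral ℤ y → IsIntegral ℤ (σ y) := fun hy =>
    hy.map (σ : K →+* K).toIntAlgHom
  have h1 : IsIntegral ℤ (algebraMap ℚ K q) := by
    have := (hx'.add (hs hx')).add (hs (hs hx'))
    rw [hq] at this
    simpa using this
  have h2 : IsIntegral ℤ q := (isIntegral_algebraMap_iff (algebraMap ℚ K).injective).1 h1
  obtain ⟨n, hn⟩ := IsIntegrallyClosed.isIntegral_iff.1 h2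
  exact ⟨n, by simpa using hn.symm⟩

/-- `3` is not totally ramified when the radicand is `1` modulo `9`. -/
lemma not_isIdealCube_three_of_radicand {D m : ℤ} (hD : D = 1 + 9 * m) {t : L} (ht : t ^ 3 = D)
    (hσ : σ (ι t) = κ ζ * ι t) : ¬ IsIdealCube (𝓞 L) (3 : L) := fun hc => by
  have hω : IsIntegral ℤ ((1 + t + t ^ 2) / 3) := by
    refine ⟨Polynomial.X ^ 3 + (Polynomial.C (-1) * Polynomial.X ^ 2 +
      Polynomial.C (-3 * m) * Polynomial.X + Polynomial.C (-3 * m ^ 2)), ?_, ?_⟩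
    · refine Polynomial.monic_X_pow_add ?_
      refine lt_of_le_of_lt Polynomial.degree_quadratic_le ?_
      norm_num
    · have hm : (m : L) = (t ^ 3 - 1) / 9 := by
        rw [ht, hD]; push_cast; ring
      simp only [Polynomial.eval₂_add, Polynomial.eval₂_mul, Polynomial.eval₂_pow,
        Polynomial.eval₂_X, Polynomial.eval₂_C]
      simp only [algebraMap_int_eq, eq_intCast]
      push_cast
      rw [hm]
      ring
  obtain ⟨ω, hω'⟩ : ∃ w : 𝓞 L, algebraMap (𝓞 L) L w = (1 + t + t ^ 2) / 3 := ⟨⟨_, hω⟩, rfl⟩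
  have hDL : (D : L) = 1 + 9 * m := by rw [hD]; push_cast; ring
  have hωeq : ω ^ 3 - ω ^ 2 - 3 * m * ω - 3 * m ^ 2 = 0 := by
    apply FaithfulSMul.algebraMap_injective (𝓞 L) L
    simp only [map_sub, map_mul, map_pow, map_intCast, map_ofNat (algebraMap (𝓞 L) L),
      map_zero, hω']
    have hm : (m : L) = (t ^ 3 - 1) / 9 := by
      rw [ht, hDL]; ring
    rw [hm]
    ring
  have hζ := h.root'
  have hD3 : ι t ^ 3 = 1 + 9 * (m : K) := by
    rw [← map_pow, ht, hDL]
    simp only [map_add, map_one, map_mul, map_intCast, map_ofNat ι]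
  have hιω : ι (algebraMap (𝓞 L) L ω) = (1 + ι t + ι t ^ 2) / 3 := by
    rw [hω']; simp only [map_div₀, map_add, map_one, map_pow, map_ofNat ι]
  have hσω : σ (ι (algebraMap (𝓞 L) L ω)) = (1 + κ ζ * ι t + κ ζ ^ 2 * ι t ^ 2) / 3 := by
    rw [hιω]; simp only [map_div₀, map_add, map_one, map_pow, map_ofNat σ, hσ]; ring
  have hσσω : σ (σ (ι (algebraMap (𝓞 L) L ω))) = (1 + κ ζ ^ 2 * ι t + κ ζ * ι t ^ 2) / 3 := by
    rw [hσω]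
    simp only [map_div₀, map_add, map_one, map_pow, map_mul, map_ofNat σ, hσ, AlgEquiv.commutes]
    linear_combination (1/3) * κ ζ * ι t ^ 2 * h.zeta_cube'
  -- no element congruent to `ω ^ 2` or `ω - 1` is divisible by `3`
  have hno1 : ¬ (3 : 𝓞 L) ∣ ω ^ 2 := by
    rintro ⟨y, hy⟩
    have hyL : (algebraMap (𝓞 L) L ω) ^ 2 = 3 * algebraMap (𝓞 L) L y := by
      rw [← map_pow, hy, map_mul, map_ofNat (algebraMap (𝓞 L) L)]
    have hyK : ι (algebraMap (𝓞 L) L y) = ι (algebraMap (𝓞 L) L ω) ^ 2 / 3 := by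
      rw [← map_pow, hyL, map_mul, map_ofNat ι]; ring
    obtain ⟨n, hn⟩ := trace_isIntegral (σ := σ) (RingOfIntegers.isIntegral_coe y)
      (q := (1 + 6 * m : ℚ) / 3) (by
      rw [hyK]
      simp only [map_div₀, map_pow, map_ofNat σ]
      rw [hσσω, hσω, hιω]
      push_cast
      linear_combination (1/27 : K) * ((2 * ι t + ι t ^ 2 * (κ ζ ^ 2 - κ ζ + 1) + 2 * ι t ^ 2 +
        4 * ι t ^ 3 * (κ ζ - 1) + ι t ^ 4 * (κ ζ ^ 2 - κ ζ + 1)) * hζ) + (6/27 : K) * hD3)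
    have : (1 + 6 * m : ℚ) = 3 * n := by rw [← hn]; ring
    have : (1 + 6 * m : ℤ) = 3 * n := by exact_mod_cast this
    omega
  have hno2 : ¬ (3 : 𝓞 L) ∣ ω - 1 := by
    rintro ⟨y, hy⟩
    have hyL : algebraMap (𝓞 L) L ω - 1 = 3 * algebraMap (𝓞 L) L y := by
      rw [← map_one (algebraMap (𝓞 L) L), ← map_sub, hy, map_mul, map_ofNat (algebraMap (𝓞 L) L)]
    have hyK : ι (algebraMap (𝓞 L) L y) = (ι (algebraMap (𝓞 L) L ω) - 1) / 3 := by
      rw [← map_one ι, ← map_sub, hyL, map_mul, map_ofNat ι]; ring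
    obtain ⟨n, hn⟩ := trace_isIntegral (σ := σ) (RingOfIntegers.isIntegral_coe y)
      (q := (-2 : ℚ) / 3) (by
      rw [hyK]
      simp only [map_div₀, map_sub, map_one, map_ofNat σ]
      rw [hσσω, hσω, hιω]
      push_cast
      linear_combination (1/9 : K) * (ι t + ι t ^ 2) * hζ)
    have : (-2 : ℚ) = 3 * n := by rw [← hn]; ring
    have : (-2 : ℤ) = 3 * n := by exact_mod_cast this
    omega
  obtain ⟨I, hI⟩ := IsIdealCube.exists_span_eq_pow (R := 𝓞 L) (F := L) (g := 3)
    (by norm_num) (by simpa [map_ofNat (algebraMap (𝓞 L) L)] using hc)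
  have hnorm : Ideal.absNorm I = 3 := by
    have h1 : Ideal.absNorm (Ideal.span {(3 : 𝓞 L)}) = 27 := by
      rw [Ideal.absNorm_span_singleton]
      have := Algebra.norm_algebraMap (S := 𝓞 L) (3 : ℤ)
      rw [RingOfIntegers.rank, h.finrankL] at this
      rw [show (3 : 𝓞 L) = algebraMap ℤ (𝓞 L) 3 by simp, this]
      norm_num
    rw [hI, map_pow] at h1
    exact Nat.pow_left_injective (n := 3) (by norm_num) (by simpa using h1)
  have hprime : I.IsPrime := Ideal.isPrime_of_irreducible_absNorm (by
    rw [hnorm]; exact Nat.prime_three)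
  have h3I : ∀ {x : 𝓞 L}, x ∈ I ^ 3 ↔ (3 : 𝓞 L) ∣ x := fun {x} => by
    rw [← hI, Ideal.mem_span_singleton]
  have h3mem : (3 : 𝓞 L) ∈ I := Ideal.pow_le_self (by norm_num) (h3I.2 dvd_rfl)
  have hprod : ω ^ 2 * (ω - 1) = 3 * (m * (ω + m)) := by linear_combination hωeq
  rcases hprime.mem_or_mem (show ω ^ 2 * (ω - 1) ∈ I by
    rw [hprod]; exact I.mul_mem_right _ h3mem) with h1 | h1
  · have hωI := hprime.mem_of_pow_mem 2 h1
    have hω3 : ω ^ 3 ∈ I ^ 3 := Ideal.pow_mem_pow hωI 3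
    apply hno1
    rw [h3I] at hω3
    have : ω ^ 2 = 3 * (m - m * (m + 1) * (1 + ω + ω ^ 2)) + ω ^ 3 * (ω ^ 2 - 3 * m) := by
      linear_combination (-(1 + ω + ω ^ 2)) * hωeq
    rw [this]
    exact dvd_add (dvd_mul_right _ _) (hω3.mul_right _)
  · have hω3 : (ω - 1) ^ 3 ∈ I ^ 3 := Ideal.pow_mem_pow h1 3
    apply hno2
    rw [h3I] at hω3
    obtain ⟨c, hc⟩ := hω3
    have hinv : ω * (1 - (ω - 1) + (ω - 1) ^ 2) = 1 + 3 * c := by rw [← hc]; ring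
    have : ω - 1 = 3 * (m * (ω + m) * (1 - (ω - 1) + (ω - 1) ^ 2) ^ 2 -
        c * (2 + 3 * c) * (ω - 1)) := by
      have e1 : (ω - 1) * (ω * (1 - (ω - 1) + (ω - 1) ^ 2)) ^ 2 = (ω - 1) * (1 + 3 * c) ^ 2 := by
        rw [hinv]
      linear_combination e1 * (-1) + (1 - (ω - 1) + (ω - 1) ^ 2) ^ 2 * hprod
    rw [this]
    exact dvd_mul_right _ _

lemma not_isIdealCube_three (h9 : d % 9 = 1 ∨ d % 9 = 8) : ¬ IsIdealCube (𝓞 L) (3 : L) := by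
  rcases h9 with h9 | h9
  · refine h.not_isIdealCube_three_of_radicand (D := d) (m := (d : ℤ) / 9) (by omega) (t := θ) ?_
      h.sigma
    rw [h.cube]; simp
  · refine h.not_isIdealCube_three_of_radicand (D := -d) (m := (-d : ℤ) / 9) (by omega) (t := -θ) ?_
      (by rw [map_neg, map_neg, h.sigma]; ring)
    push_cast
    linear_combination -h.cube

end KummerTower

open IsDedekindDomain IsDedekindDomain.HeightOneSpectrum

/-- A prime ideal containing a positive integer contains one of its prime factors. -/
lemma exists_prime_dvd_mem {R : Type*} [CommRing R] {I : Ideal R} [hI : I.IsPrime] {n : ℕ}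
    (hn : n ≠ 0) (h : (n : R) ∈ I) : ∃ p : ℕ, p.Prime ∧ p ∣ n ∧ (p : R) ∈ I := by
  induction n using Nat.recOnMul with
  | zero => exact absurd rfl hn
  | one => exact absurd (I.eq_top_iff_one.2 (by simpa using h)) hI.ne_top
  | prime p hp => exact ⟨p, hp, dvd_rfl, h⟩
  | mul a b iha ihb =>
    rw [Nat.cast_mul] at h
    rcases hI.mem_or_mem h with h | h
    · obtain ⟨p, hp, hpa, hpI⟩ := iha (left_ne_zero_of_mul hn) h
      exact ⟨p, hp, hpa.mul_right b, hpI⟩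
    · obtain ⟨p, hp, hpb, hpI⟩ := ihb (right_ne_zero_of_mul hn) h
      exact ⟨p, hp, hpb.mul_left a, hpI⟩

/-- Up to cubes, the nonzero elements of `L` generating cubes of ideals form a group freely
generated over `ℤ/3` by `g₁` and `g₂`. -/
structure CubeGens {L : Type} [Field L] [NumberField L] (g₁ g₂ : L) : Prop where
  ne₁ : g₁ ≠ 0
  ne₂ : g₂ ≠ 0
  isIdealCube₁ : IsIdealCube (𝓞 L) g₁
  isIdealCube₂ : IsIdealCube (𝓞 L) g₂
  gen : ∀ γ : L, γ ≠ 0 → IsIdealCube (𝓞 L) γ → ∃ (a b : ℕ) (l : L), γ = g₁ ^ a * g₂ ^ b * l ^ 3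
  indep : ∀ (a b : ℕ) (l : L), g₁ ^ a * g₂ ^ b = l ^ 3 → 3 ∣ a ∧ 3 ∣ b

namespace KummerTower

variable {L k K : Type} [Field L] [Field k] [Field K] [NumberField L]
    [NumberField k] [NumberField K] [Algebra L K] [Algebra k K] {d : ℕ} {θ : L} {ζ : k}
    {σ : K ≃ₐ[k] K} {τ : K ≃ₐ[L] K} (h : KummerTower d θ ζ σ τ)
include h

lemma adjoin_theta : Algebra.adjoin ℚ {θ} = (⊤ : Subalgebra ℚ L) := by
  refine eq_top_iff.2 fun x _ => ?_
  obtain ⟨a, b, c, rfl⟩ := h.repL x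
  have hθ : θ ∈ Algebra.adjoin ℚ {θ} := Algebra.self_mem_adjoin_singleton ℚ θ
  have hq : ∀ q : ℚ, (q : L) ∈ Algebra.adjoin ℚ {θ} := fun q => by
    simpa using (Algebra.adjoin ℚ {θ}).algebraMap_mem q
  exact add_mem (add_mem (hq a) (mul_mem (hq b) hθ)) (mul_mem (hq c) (pow_mem hθ 2))

/-- A rational number generating the cube of an ideal of `L` is a product of ramified primes, up to
rational cubes. -/
lemma exists_rat_eq {p₁ p₂ p₃ : ℕ} (hp₁ : p₁.Prime) (hp₂ : p₂.Prime) (hp₃ : p₃.Prime)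
    (hS : ∀ p : ℕ, p.Prime → p ∣ 3 * d → p = p₁ ∨ p = p₂ ∨ p = p₃ ∨
      (p = 3 ∧ (d % 9 = 1 ∨ d % 9 = 8)))
    {r : ℚ} (hr : r ≠ 0) (hrL : IsIdealCube (𝓞 L) (r : L)) :
    ∃ (a b c : ℕ) (s : ℚ), r = p₁ ^ a * p₂ ^ b * p₃ ^ c * s ^ 3 := by
  refine exists_eq_prod_pow_mul_cube hp₁ hp₂ hp₃ hr ?_
  have hrL' : IsIdealCube (𝓞 L) (algebraMap ℚ L r) := by simpa using hrL
  have hint : IsIntegral ℤ θ := by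
    refine IsIntegral.of_pow (n := 3) (by norm_num) ?_
    rw [h.cube]; exact_mod_cast isIntegral_algebraMap (R := ℤ) (A := L) (x := (d : ℤ))
  obtain ⟨t, ht⟩ : ∃ t : 𝓞 L, algebraMap (𝓞 L) L t = θ := ⟨⟨θ, hint⟩, rfl⟩
  have ht3 : t ^ 3 = algebraMap ℤ (𝓞 L) d := by
    apply FaithfulSMul.algebraMap_injective (𝓞 L) L
    rw [map_pow, ht, h.cube]; simp
  let T : Set (HeightOneSpectrum ℤ) :=
    {v | (p₁ : ℤ) ∉ v.asIdeal ∧ (p₂ : ℤ) ∉ v.asIdeal ∧ (p₃ : ℤ) ∉ v.asIdeal}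
  have hT : ∀ v ∈ T, ((3 : ℕ) : ℤ) ∉ v.asIdeal → ∃ m, v.valuation ℚ r = m ^ 3 := by
    rintro v ⟨h₁, h₂, h₃⟩ h0
    refine exists_valuation_eq_cube_of_unramified (𝓞 L) L hrL' ht3 ?_ v ?_
    · rw [ht]; exact h.adjoin_theta
    · intro hmem
      have := v.isPrime
      obtain ⟨p, hp, hpd, hpv⟩ := exists_prime_dvd_mem (I := v.asIdeal) (n := 3 * d)
        (mul_ne_zero (by norm_num) h.d_ne) (by push_cast; exact hmem)
      rcases hS p hp hpd with rfl | rfl | rfl | ⟨rfl, -⟩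
      exacts [h₁ hpv, h₂ hpv, h₃ hpv, h0 hpv]
  suffices h3 : ∀ v ∈ T, ∃ m, v.valuation ℚ r = m ^ 3 from
    fun v h₁ h₂ h₃ => h3 v ⟨h₁, h₂, h₃⟩
  by_cases hmem : p₁ = 3 ∨ p₂ = 3 ∨ p₃ = 3
  · rintro v hv
    refine hT v hv ?_
    obtain ⟨h₁, h₂, h₃⟩ := hv
    rcases hmem with rfl | rfl | rfl
    exacts [h₁, h₂, h₃]
  have h9 : d % 9 = 1 ∨ d % 9 = 8 := by
    rcases hS 3 Nat.prime_three (dvd_mul_right 3 d) with h1 | h1 | h1 | h1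
    · exact absurd (Or.inl h1.symm) hmem
    · exact absurd (Or.inr (Or.inl h1.symm)) hmem
    · exact absurd (Or.inr (Or.inr h1.symm)) hmem
    · exact h1.2
  obtain ⟨a, ha, haT⟩ := exists_valuation_mul_pow_eq_cube Nat.prime_three hr hT
  rcases Nat.eq_zero_or_pos a with rfl | ha0
  · simpa using haT
  refine absurd ?_ (h.not_isIdealCube_three h9)
  have := isIdealCube_natCast (F := L) (p := 3) fun w hw => ?_
  · simpa using this
  suffices hex : ∃ m, (w.valuation L ((3 : ℕ) : L)) ^ a = m ^ 3 by
    obtain ⟨m, hm⟩ := hex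
    exact exists_cube_of_coprime_pow (by simp) (show a = 1 ∨ a = 2 by omega) hm
  · have hv : ∀ p : ℕ, p.Prime → p ≠ 3 → (p : ℤ) ∉ (primeBelow (R := ℤ) w).asIdeal := by
      intro p hp hp3 hpv
      refine hp3 (natCast_mem_unique hp Nat.prime_three w.isPrime.ne_top ?_ hw)
      have : algebraMap ℤ (𝓞 L) p ∈ w.asIdeal := hpv
      simpa using this
    obtain ⟨m, hm⟩ := haT (primeBelow w) ⟨hv p₁ hp₁ fun e => hmem (Or.inl e),
      hv p₂ hp₂ fun e => hmem (Or.inr (Or.inl e)), hv p₃ hp₃ fun e => hmem (Or.inr (Or.inr e))⟩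
    obtain ⟨n, hn⟩ := hrL' w
    have h1 := valuation_liesOver (A := ℤ) (K := ℚ) L (primeBelow w) w (r * (3 : ℕ) ^ a)
    rw [hm, map_mul, map_mul, hn, map_pow, map_natCast, map_pow, ← pow_mul,
      mul_comm 3, pow_mul] at h1
    have hn0 : n ≠ 0 := by
      rintro rfl
      simp [hr] at hn
    refine ⟨m ^ (primeBelow (R := ℤ) w).asIdeal.ramificationIdx' w.asIdeal / n, ?_⟩
    rw [div_pow, eq_div_iff (pow_ne_zero 3 hn0), h1, mul_comm]

/-- A rational number that is a cube in `L` and a unit at a prime ramified in `L` is a rational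
cube. -/
lemma exists_eq_cube {p e m : ℕ} (hp : p.Prime) (he : e = 1 ∨ e = 2) (hm : ¬ p ∣ m)
    (hd : d = p ^ e * m) {r : ℚ} {l : L} (hr : r ≠ 0) (hpr : padicValRat p r = 0)
    (hl : (r : L) = l ^ 3) : ∃ s : ℚ, r = s ^ 3 := by
  obtain ⟨j, s, hj, hs⟩ := h.kummer hr hl
  have := Fact.mk hp
  have hd0 : (d : ℚ) ≠ 0 := by exact_mod_cast h.d_ne
  have hs0 : s ≠ 0 := by
    rintro rfl
    simp [hs] at hr
  have hm0 : m ≠ 0 := by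
    rintro rfl
    exact hm (dvd_zero p)
  have hpd : padicValRat p (d : ℚ) = e := by
    rw [hd, padicValRat.of_nat, padicValNat.mul (pow_ne_zero e hp.ne_zero) hm0,
      padicValNat.prime_pow, padicValNat.eq_zero_of_not_dvd hm, add_zero]
  rw [hs, padicValRat.mul (pow_ne_zero j hd0) (pow_ne_zero 3 hs0), padicValRat.pow,
    padicValRat.pow, hpd] at hpr
  have hj0 : j = 0 := by
    interval_cases j
    · rfl
    all_goals rcases he with rfl | rfl <;> push_cast at hpr <;> omega
  exact ⟨s, by simpa [hj0] using hs⟩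

end KummerTower

lemma padicValRat_mul_pow {p q : ℕ} (hp : p.Prime) (hq : q.Prime) (hpq : p ≠ q) (a b : ℕ) :
    padicValRat p ((p : ℚ) ^ a * (q : ℚ) ^ b) = a := by
  have := Fact.mk hp
  have hp0 : (p : ℚ) ≠ 0 := by exact_mod_cast hp.ne_zero
  have hq0 : (q : ℚ) ≠ 0 := by exact_mod_cast hq.ne_zero
  rw [padicValRat.mul (pow_ne_zero a hp0) (pow_ne_zero b hq0), padicValRat.pow,
    padicValRat.pow, padicValRat.of_nat, padicValRat.of_nat, padicValNat_self,
    padicValNat.eq_zero_of_not_dvd (fun hdvd => hpq ((Nat.prime_dvd_prime_iff_eq hp hq).1 hdvd))]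
  simp

lemma padicValRat_mul_pow_eq_zero {p q r : ℕ} (hp : p.Prime) (hq : q.Prime) (hr : r.Prime)
    (hpq : p ≠ q) (hpr : p ≠ r) (a b : ℕ) :
    padicValRat p ((q : ℚ) ^ a * (r : ℚ) ^ b) = 0 := by
  have := Fact.mk hp
  have hq0 : (q : ℚ) ≠ 0 := by exact_mod_cast hq.ne_zero
  have hr0 : (r : ℚ) ≠ 0 := by exact_mod_cast hr.ne_zero
  rw [padicValRat.mul (pow_ne_zero a hq0) (pow_ne_zero b hr0), padicValRat.pow,
    padicValRat.pow, padicValRat.of_nat, padicValRat.of_nat,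
    padicValNat.eq_zero_of_not_dvd (fun hdvd => hpq ((Nat.prime_dvd_prime_iff_eq hp hq).1 hdvd)),
    padicValNat.eq_zero_of_not_dvd (fun hdvd => hpr ((Nat.prime_dvd_prime_iff_eq hp hr).1 hdvd))]
  simp

lemma three_dvd_of_mul_pow_eq_cube {p q : ℕ} (hp : p.Prime) (hq : q.Prime) (hpq : p ≠ q) {a b : ℕ}
    {s : ℚ} (hs : (p : ℚ) ^ a * (q : ℚ) ^ b = s ^ 3) : 3 ∣ a ∧ 3 ∣ b := by
  have hp0 : (p : ℚ) ≠ 0 := by exact_mod_cast hp.ne_zero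
  have hq0 : (q : ℚ) ≠ 0 := by exact_mod_cast hq.ne_zero
  have hs0 : s ≠ 0 := by
    rintro rfl
    simp [hp0, hq0] at hs
  have h1 := padicValRat_mul_pow hp hq hpq a b
  have h2 := padicValRat_mul_pow hq hp hpq.symm b a
  have := Fact.mk hp
  have := Fact.mk hq
  rw [hs, padicValRat.pow] at h1
  rw [mul_comm, hs, padicValRat.pow] at h2
  push_cast at h1 h2
  omega

/-- In characteristic `q ≡ 2, 5` modulo `9`, a primitive third root of unity is not a cube in a
quotient of the Eisenstein integers. -/
lemma eq_zero_of_pow_three_eq {F : Type*} [Field F] {q : ℕ} [Fact q.Prime] [CharP F q]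
    (hq9 : q % 9 = 2 ∨ q % 9 = 5) {z : F} (hz : z ^ 2 + z + 1 = 0)
    (hF : ∀ x : F, ∃ a b : ℤ, x = a + b * z) {i : ℕ} (hi : ¬ 3 ∣ i) {x y : F}
    (hxy : x ^ 3 = z ^ i * y ^ 3) : y = 0 := by
  by_contra hy
  have hz3 : z ^ 3 = 1 := by linear_combination (z - 1) * hz
  have hz0 : z ≠ 0 := by rintro rfl; simp at hz
  have hx : x ≠ 0 := by
    rintro rfl
    simp [hy, hz0] at hxy
  have hzmod : ∀ n, z ^ n = z ^ (n % 3) := fun n => by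
    conv_lhs => rw [← Nat.div_add_mod n 3, pow_add, pow_mul, hz3, one_pow, one_mul]
  have hfrob : ∀ w : F, w ^ (q ^ 2) = w := fun w => by
    obtain ⟨a, b, rfl⟩ := hF w
    have hint : ∀ a : ℤ, (a : F) ^ q = a := fun a => by
      rw [← frobenius_def q (a : F), map_intCast]
    have hq2 : q ^ 2 % 3 = 1 := by
      rw [Nat.pow_mod]
      have : q % 3 = 2 := by omega
      rw [this]
    have hint2 : ∀ a : ℤ, (a : F) ^ q ^ 2 = a := fun a => by rw [pow_two, pow_mul, hint, hint]
    rw [add_pow_char_pow, mul_pow, hint2, hint2, hzmod, hq2, pow_one]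
  obtain ⟨n, hn, hn3⟩ : ∃ n, q ^ 2 = 3 * n + 1 ∧ ¬ 3 ∣ n := by
    obtain ⟨t, ht | ht⟩ : ∃ t, q = 9 * t + 2 ∨ q = 9 * t + 5 := ⟨q / 9, by omega⟩
    · exact ⟨27 * t ^ 2 + 12 * t + 1, by rw [ht]; ring, by omega⟩
    · exact ⟨27 * t ^ 2 + 30 * t + 8, by rw [ht]; ring, by omega⟩
  have hone : ∀ w : F, w ≠ 0 → w ^ (3 * n) = 1 := fun w hw => by
    have := hfrob w
    rw [hn, pow_succ] at this
    exact mul_right_cancel₀ hw (by rw [this, one_mul])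
  have h1 : z ^ (i * n) = 1 := by
    have := congrArg (· ^ n) hxy
    simp only [mul_pow, ← pow_mul] at this
    rwa [hone x hx, hone y hy, mul_one, eq_comm] at this
  have hz1 : z = 1 := by
    have hne : ¬ 3 ∣ i * n := fun hdvd => (Nat.prime_three.dvd_mul.1 hdvd).elim hi hn3
    rw [hzmod] at h1
    rcases (show i * n % 3 = 1 ∨ i * n % 3 = 2 by omega) with h2 | h2
    · simpa [h2] using h1
    · rw [h2] at h1
      calc z = z ^ 3 * z := by rw [hz3, one_mul]
        _ = (z ^ 2) ^ 2 := by ring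
        _ = 1 := by rw [h1, one_pow]
  have h3 : ((3 : ℕ) : F) = 0 := by
    rw [hz1] at hz
    push_cast
    linear_combination hz
  have := (Nat.prime_dvd_prime_iff_eq Fact.out Nat.prime_three).1
    ((CharP.cast_eq_zero_iff F q 3).1 h3)
  omega

/-- Infinite descent for a norm form equation ramified at the prime `p`. -/
lemma pow_dvd_of_norm_form_eq {R : Type*} [CommRing R] [IsDomain R] {p u : R} (hp : Prime p)
    (hu : ∀ x y, p ∣ x ^ 3 - u * y ^ 3 → p ∣ y) {a b c : R} (ha : ¬ p ∣ a) (hb : ¬ p ∣ b) (n : ℕ) :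
    ∀ {x₀ x₁ x₂ y : R}, x₀ ^ 3 + p * a * x₁ ^ 3 + p ^ 2 * b * x₂ ^ 3 =
      u * y ^ 3 + p * c * (x₀ * x₁ * x₂) → p ^ n ∣ y := by
  induction n with
  | zero => intros; simp
  | succ n ih =>
    intro x₀ x₁ x₂ y he
    obtain ⟨y, rfl⟩ := hu x₀ y ⟨c * (x₀ * x₁ * x₂) - a * x₁ ^ 3 - p * b * x₂ ^ 3, by
      linear_combination he⟩
    obtain ⟨x₀, rfl⟩ : p ∣ x₀ := hp.dvd_of_dvd_pow (n := 3)
      ⟨c * (x₀ * x₁ * x₂) - a * x₁ ^ 3 - p * b * x₂ ^ 3 + u * p ^ 2 * y ^ 3, by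
        linear_combination he⟩
    have he1 : a * x₁ ^ 3 = p * (u * p * y ^ 3 + c * x₀ * x₁ * x₂ - p * x₀ ^ 3 - b * x₂ ^ 3) := by
      apply mul_left_cancel₀ hp.ne_zero
      linear_combination he
    obtain ⟨x₁, rfl⟩ : p ∣ x₁ :=
      hp.dvd_of_dvd_pow ((hp.dvd_or_dvd ⟨_, he1⟩).resolve_left ha)
    have he2 : b * x₂ ^ 3 = p * (u * y ^ 3 + c * x₀ * x₁ * x₂ - x₀ ^ 3 - p * a * x₁ ^ 3) := by
      apply mul_left_cancel₀ hp.ne_zero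
      linear_combination he1
    obtain ⟨x₂, rfl⟩ : p ∣ x₂ :=
      hp.dvd_of_dvd_pow ((hp.dvd_or_dvd ⟨_, he2⟩).resolve_left hb)
    rw [pow_succ']
    refine mul_dvd_mul_left p (ih (x₀ := x₀) (x₁ := x₁) (x₂ := x₂) ?_)
    apply mul_left_cancel₀ hp.ne_zero
    linear_combination he2

lemma eq_zero_of_norm_form_eq {R : Type*} [CommRing R] [IsDomain R] [WfDvdMonoid R] {p u : R}
    (hp : Prime p) (hu : ∀ x y, p ∣ x ^ 3 - u * y ^ 3 → p ∣ y) {a b c : R} (ha : ¬ p ∣ a)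
    (hb : ¬ p ∣ b) {x₀ x₁ x₂ y : R} (he : x₀ ^ 3 + p * a * x₁ ^ 3 + p ^ 2 * b * x₂ ^ 3 =
      u * y ^ 3 + p * c * (x₀ * x₁ * x₂)) : y = 0 := by
  by_contra hy
  obtain ⟨n, hn⟩ := FiniteMultiplicity.of_not_isUnit hp.not_isUnit hy
  exact hn (pow_dvd_of_norm_form_eq hp hu ha hb (n + 1) he)

namespace KummerTower

variable {L k K : Type} [Field L] [Field k] [Field K] [NumberField L]
    [NumberField k] [NumberField K] [Algebra L K] [Algebra k K] {d : ℕ} {θ : L} {ζ : k}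
    {σ : K ≃ₐ[k] K} {τ : K ≃ₐ[L] K} (h : KummerTower d θ ζ σ τ)
include h

local notation "ι" => algebraMap L K
local notation "κ" => algebraMap k K

/-- `ζ` is not a norm from `K` to `k` when some prime `q ≡ 2, 5` modulo `9` ramifies. -/
lemma three_dvd_of_norm_eq {q f m : ℕ} (hq : q.Prime) (hq9 : q % 9 = 2 ∨ q % 9 = 5)
    (hf : f = 1 ∨ f = 2) (hqm : ¬ q ∣ m) (hd : d = q ^ f * m) {i : ℕ} {δ : K}
    (hδ : δ * σ δ * σ (σ δ) = κ (ζ ^ i)) : 3 ∣ i := by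
  by_contra hi
  have := h.cyclotomic
  have := Fact.mk hq
  have hprime := natCast_prime h.prim hq (by omega)
  set z := h.prim.toInteger with hz
  have hzk : algebraMap (𝓞 k) k z = ζ := algebraMap_toInteger h.prim
  have hz2 : z ^ 2 + z + 1 = 0 := by rw [toInteger_sq h.prim]; ring
  have hu : ∀ x y : 𝓞 k, (q : 𝓞 k) ∣ x ^ 3 - z ^ i * y ^ 3 → (q : 𝓞 k) ∣ y := by
    intro x y hxy
    have hp : (Ideal.span {(q : 𝓞 k)}).IsPrime :=
      (Ideal.span_singleton_prime hprime.ne_zero).2 hprime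
    have hmax := hp.isMaximal (by simpa using hprime.ne_zero)
    let _ := Ideal.Quotient.field (Ideal.span {(q : 𝓞 k)})
    let π := Ideal.Quotient.mk (Ideal.span {(q : 𝓞 k)})
    have hπ : ∀ x, π x = 0 ↔ (q : 𝓞 k) ∣ x := fun x => by
      rw [Ideal.Quotient.eq_zero_iff_mem, Ideal.mem_span_singleton]
    have : CharP (𝓞 k ⧸ Ideal.span {(q : 𝓞 k)}) q := by
      have h0 : π q = 0 := (hπ _).2 dvd_rfl
      exact (CharP.charP_iff_prime_eq_zero hq).2 (by simpa using h0)
    rw [← hπ]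
    refine eq_zero_of_pow_three_eq hq9 (z := π z) (by simpa using congrArg π hz2) (fun w => ?_) hi
      (x := π x) ?_
    · obtain ⟨w, rfl⟩ := Ideal.Quotient.mk_surjective w
      obtain ⟨a, b, rfl⟩ := exists_int_rep h.prim w
      exact ⟨a, b, by simp [π, hz]⟩
    · rw [← hπ, map_sub, sub_eq_zero] at hxy
      simpa using hxy
  have hqm' : ¬ (q : 𝓞 k) ∣ (m : 𝓞 k) := fun hdvd => hqm (by
    have := dvd_of_intCast_mem (R := 𝓞 k) (I := Ideal.span {(q : 𝓞 k)}) (n := m) (by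
      rw [Ne, Ideal.span_singleton_eq_top]; exact hprime.not_isUnit) hq
      (Ideal.mem_span_singleton_self _) (by simpa [Ideal.mem_span_singleton] using hdvd)
    exact_mod_cast this)
  have hqm2 : ¬ (q : 𝓞 k) ∣ (m : 𝓞 k) ^ 2 := fun hdvd => hqm' (hprime.dvd_of_dvd_pow hdvd)
  obtain ⟨a, b, c, rfl⟩ := h.repKk δ
  have hform : a ^ 3 + d * b ^ 3 + d ^ 2 * c ^ 3 - 3 * d * (a * b * c) = ζ ^ i := by
    apply (algebraMap k K).injective
    rw [← hδ]
    simp only [map_add, map_sub, map_mul, map_pow, map_natCast, AlgEquiv.commutes, h.sigma,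
      map_ofNat κ, ← h.cube']
    linear_combination (-(κ a + κ b * ι θ + κ c * ι θ ^ 2) *
      ((κ ζ - 1) * (κ b ^ 2 * ι θ ^ 2 + κ c ^ 2 * ι θ ^ 4) + κ a * (κ b * ι θ + κ c * ι θ ^ 2) +
        κ b * κ c * ι θ ^ 3 * (κ ζ ^ 2 - κ ζ + 1) +
        (κ a + κ ζ * κ b * ι θ + κ ζ ^ 2 * κ c * ι θ ^ 2) * κ ζ * (κ ζ - 1) * κ c * ι θ ^ 2)) *
      h.root'
  classical
  obtain ⟨⟨y, hy⟩, hint⟩ := IsLocalization.exist_integer_multiples_of_finset (𝓞 k)⁰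
    (insert a (insert b {c} : Finset k))
  obtain ⟨x₀, hx₀⟩ := hint a (by simp)
  obtain ⟨x₁, hx₁⟩ := hint b (by simp)
  obtain ⟨x₂, hx₂⟩ := hint c (by simp)
  simp only [Algebra.smul_def] at hx₀ hx₁ hx₂
  have hfin : x₀ ^ 3 + d * x₁ ^ 3 + d ^ 2 * x₂ ^ 3 - 3 * d * (x₀ * x₁ * x₂) = z ^ i * y ^ 3 := by
    apply FaithfulSMul.algebraMap_injective (𝓞 k) k
    simp only [map_add, map_sub, map_mul, map_pow, map_natCast, map_ofNat (algebraMap (𝓞 k) k),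
      hx₀, hx₁, hx₂, hzk]
    linear_combination (algebraMap (𝓞 k) k y) ^ 3 * hform
  refine nonZeroDivisors.ne_zero hy ?_
  rcases hf with rfl | rfl
  · refine eq_zero_of_norm_form_eq hprime hu hqm' hqm2 (c := 3 * m) (x₀ := x₀) (x₁ := x₁)
      (x₂ := x₂) ?_
    rw [← hfin, hd]; push_cast; ring
  · refine eq_zero_of_norm_form_eq hprime hu hqm2 hqm' (c := 3 * m) (x₀ := x₀) (x₁ := q * x₂)
      (x₂ := x₁) ?_
    rw [← hfin, hd]; push_cast; ring

/-- The genus group when `ζ` is not a norm. -/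
theorem cubeGens_of_not_norm {p₁ p₂ p₃ e₁ e₂ e₃ q f m : ℕ} (hp₁ : p₁.Prime) (hp₂ : p₂.Prime)
    (hp₃ : p₃.Prime) (h12 : p₁ ≠ p₂) (h13 : p₁ ≠ p₃) (h23 : p₂ ≠ p₃) (he₁ : e₁ = 1 ∨ e₁ = 2)
    (hd : d = p₁ ^ e₁ * (p₂ ^ e₂ * p₃ ^ e₃))
    (hS : ∀ p : ℕ, p.Prime → p ∣ 3 * d → p = p₁ ∨ p = p₂ ∨ p = p₃ ∨
      (p = 3 ∧ (d % 9 = 1 ∨ d % 9 = 8)))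
    (hd3 : ∀ p : ℕ, p.Prime → p ∣ d → p = 3 ∨ p % 3 = 2)
    (hc₂ : IsIdealCube (𝓞 L) (p₂ : L)) (hc₃ : IsIdealCube (𝓞 L) (p₃ : L))
    (hq : q.Prime) (hq9 : q % 9 = 2 ∨ q % 9 = 5) (hf : f = 1 ∨ f = 2) (hqm : ¬ q ∣ m)
    (hdq : d = q ^ f * m) : CubeGens (p₂ : L) (p₃ : L) where
  ne₁ := by exact_mod_cast hp₂.ne_zero
  ne₂ := by exact_mod_cast hp₃.ne_zero
  isIdealCube₁ := hc₂
  isIdealCube₂ := hc₃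
  gen γ hγ hγc := by
    obtain ⟨i, hi⟩ := h.exists_isTwist hd3 hγ hγc
    obtain ⟨i, rfl⟩ : 3 ∣ i := by
      obtain ⟨n, δ, -, -, -, hδ⟩ := hi
      exact h.three_dvd_of_norm_eq hq hq9 hf hqm hdq hδ
    rw [pow_mul, h.zeta_cube, one_pow] at hi
    obtain ⟨r, l, hr, rfl⟩ := h.eq_rat_mul_pow_of_isTwist hi
    have hl : l ≠ 0 := by
      rintro rfl
      simp at hγ
    have hrc : IsIdealCube (𝓞 L) (r : L) := by
      have := hγc.div (isIdealCube_pow_three (R := 𝓞 L) l)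
      rwa [mul_div_cancel_right₀ _ (pow_ne_zero 3 hl)] at this
    obtain ⟨a, b, c, s, rfl⟩ := h.exists_rat_eq hp₁ hp₂ hp₃ hS hr hrc
    have h2 : (p₂ : L) ≠ 0 := by exact_mod_cast hp₂.ne_zero
    have h3 : (p₃ : L) ≠ 0 := by exact_mod_cast hp₃.ne_zero
    obtain ⟨x, y, t, hxy⟩ : ∃ (x y : ℕ) (t : L), (p₁ : L) = p₂ ^ x * p₃ ^ y * t ^ 3 := by
      have hθ : θ ^ 3 = p₁ ^ e₁ * (p₂ ^ e₂ * p₃ ^ e₃) := by rw [h.cube, hd]; push_cast; ring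
      have hθ0 := h.theta_ne
      rcases he₁ with rfl | rfl
      · refine ⟨2 * e₂, 2 * e₃, θ / (p₂ ^ e₂ * p₃ ^ e₃), ?_⟩
        rw [div_pow, hθ]; field_simp; ring
      · refine ⟨e₂, e₃, p₁ / θ, ?_⟩
        rw [div_pow, hθ]
        have h1 : (p₁ : L) ≠ 0 := by exact_mod_cast hp₁.ne_zero
        field_simp
    refine ⟨x * a + b, y * a + c, t ^ a * s * l, ?_⟩
    push_cast
    rw [hxy]
    ring
  indep a b l hl := by
    have h2 : (p₂ : ℚ) ≠ 0 := by exact_mod_cast hp₂.ne_zero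
    have h3 : (p₃ : ℚ) ≠ 0 := by exact_mod_cast hp₃.ne_zero
    obtain ⟨s, hs⟩ := h.exists_eq_cube hp₁ he₁ (m := p₂ ^ e₂ * p₃ ^ e₃) (fun hdvd => by
      rcases hp₁.dvd_mul.1 hdvd with h' | h'
      · exact h12 ((Nat.prime_dvd_prime_iff_eq hp₁ hp₂).1 (hp₁.dvd_of_dvd_pow h'))
      · exact h13 ((Nat.prime_dvd_prime_iff_eq hp₁ hp₃).1 (hp₁.dvd_of_dvd_pow h'))) hd
      (r := p₂ ^ a * p₃ ^ b) (l := l) (by simp [h2, h3])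
      (padicValRat_mul_pow_eq_zero hp₁ hp₂ hp₃ h12 h13 a b) (by push_cast; exact hl)
    exact three_dvd_of_mul_pow_eq_cube hp₂ hp₃ h23 hs

end KummerTower

/-- The norm form of the cubic ring `R[c]/(c³ - 3 * c + 1)` in the basis `1, c, c² - 2`. -/
def nonagonNorm {R : Type*} [CommRing R] (x : R × R × R) : R :=
  x.1 ^ 3 - 3 * x.1 * (x.2.1 ^ 2 - x.2.1 * x.2.2 + x.2.2 ^ 2) - x.2.1 ^ 3 + 6 * x.2.1 ^ 2 * x.2.2
    - 3 * x.2.1 * x.2.2 ^ 2 - x.2.2 ^ 3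

/-- Multiplication in the cubic ring `R[c]/(c³ - 3 * c + 1)` in the basis `1, c, c² - 2`. -/
def nonagonMul {R : Type*} [CommRing R] (x y : R × R × R) : R × R × R :=
  (x.1 * y.1 + 2 * x.2.1 * y.2.1 - (x.2.1 * y.2.2 + x.2.2 * y.2.1) + 2 * x.2.2 * y.2.2,
    x.1 * y.2.1 + x.2.1 * y.1 + x.2.1 * y.2.2 + x.2.2 * y.2.1 - x.2.2 * y.2.2,
    x.1 * y.2.2 + x.2.2 * y.1 + x.2.1 * y.2.1 - x.2.2 * y.2.2)

/-- The product of the two other conjugates, so that `x * nonagonCofactor x = nonagonNorm x`. -/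
def nonagonCofactor {R : Type*} [CommRing R] (x : R × R × R) : R × R × R :=
  (x.1 ^ 2 - x.2.1 ^ 2 + x.2.1 * x.2.2 - x.2.2 ^ 2,
    -(x.1 * x.2.1) + 2 * x.2.1 * x.2.2 - x.2.2 ^ 2,
    -(x.1 * x.2.2) + x.2.1 ^ 2 - x.2.2 ^ 2)

lemma nonagonNorm_mul {R : Type*} [CommRing R] (x y : R × R × R) :
    nonagonNorm (nonagonMul x y) = nonagonNorm x * nonagonNorm y := by
  simp only [nonagonNorm, nonagonMul]; ring

lemma nonagonMul_cofactor {R : Type*} [CommRing R] (x : R × R × R) :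
    nonagonMul x (nonagonCofactor x) = (nonagonNorm x, 0, 0) := by
  simp only [nonagonNorm, nonagonMul, nonagonCofactor, Prod.mk.injEq]
  refine ⟨?_, ?_, ?_⟩ <;> ring

lemma nonagonNorm_sq_le (x : ℝ × ℝ × ℝ) :
    nonagonNorm x ^ 2 ≤ (x.1 ^ 2 + 2 * (x.2.1 ^ 2 - x.2.1 * x.2.2 + x.2.2 ^ 2)) ^ 3 := by
  obtain ⟨c, hc⟩ : ∃ c : ℝ, c ^ 3 = 3 * c - 1 := by
    refine ⟨2 * Real.cos (2 * Real.pi / 9), ?_⟩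
    have h := Real.cos_three_mul (2 * Real.pi / 9)
    have h2 : Real.cos (3 * (2 * Real.pi / 9)) = -(1 / 2) := by
      rw [← Real.cos_pi_div_three, ← Real.cos_pi_sub]
      congr 1; ring
    rw [h2] at h
    linear_combination (-2) * h
  obtain ⟨a, b, e⟩ := x
  set u := a + b * c + e * (c ^ 2 - 2) with hu
  set v := a + b * (c ^ 2 - 2) + e * (2 - c - c ^ 2) with hv
  set w := a + b * (2 - c - c ^ 2) + e * c with hw
  have amgm : ∀ x y z : ℝ, 0 ≤ x → 0 ≤ y → 0 ≤ z → 27 * (x * y * z) ≤ (x + y + z) ^ 3 := by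
    intro x y z hx hy hz
    nlinarith [mul_nonneg hx (sq_nonneg (y - z)), mul_nonneg hy (sq_nonneg (x - z)),
      mul_nonneg hz (sq_nonneg (x - y)), mul_nonneg hx (sq_nonneg (x - z)),
      mul_nonneg hx (sq_nonneg (x - y)), mul_nonneg hy (sq_nonneg (x - y)),
      mul_nonneg hy (sq_nonneg (y - z)), mul_nonneg hz (sq_nonneg (x - z)),
      mul_nonneg hz (sq_nonneg (y - z))]
  have h1 : c ^ 4 = 3 * c ^ 2 - c := by linear_combination c * hc
  have h5 : c ^ 5 = -c ^ 2 + 9 * c - 3 := by linear_combination (c ^ 2 + 3) * hc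
  have h6 : c ^ 6 = 9 * c ^ 2 - 6 * c + 1 := by linear_combination (c ^ 3 + 3 * c - 1) * hc
  have hN : nonagonNorm (a, b, e) = u * v * w := by
    simp only [nonagonNorm, hu, hv, hw]
    ring_nf
    simp only [hc, h1, h5, h6]
    ring
  have hS : u ^ 2 + v ^ 2 + w ^ 2 = 3 * (a ^ 2 + 2 * (b ^ 2 - b * e + e ^ 2)) := by
    simp only [hu, hv, hw]
    ring_nf
    simp only [hc, h1]
    ring
  have := amgm (u ^ 2) (v ^ 2) (w ^ 2) (sq_nonneg _) (sq_nonneg _) (sq_nonneg _)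
  rw [hS] at this
  rw [hN]
  simp only
  linarith

lemma exists_int_eisenstein_le (b e : ℝ) : ∃ m n : ℤ,
    (b - m) ^ 2 - (b - m) * (e - n) + (e - n) ^ 2 ≤ 1 / 3 := by
  wlog h : Int.fract e ≤ Int.fract b generalizing b e
  · obtain ⟨m, n, hmn⟩ := this e b (not_le.mp h).le
    exact ⟨n, m, by linarith⟩
  have hx0 := Int.fract_nonneg e
  have hx1 := (Int.fract_lt_one b).le
  set x := Int.fract b with hx
  set y := Int.fract e with hy
  have hb : b = ⌊b⌋ + x := (Int.floor_add_fract b).symm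
  have he : e = ⌊e⌋ + y := (Int.floor_add_fract e).symm
  by_contra! H
  have h0 := H ⌊b⌋ ⌊e⌋
  have h1 := H (⌊b⌋ + 1) ⌊e⌋
  have h2 := H (⌊b⌋ + 1) (⌊e⌋ + 1)
  push_cast at h0 h1 h2
  have e0 : b - ⌊b⌋ = x := by linarith
  have e1 : b - (⌊b⌋ + 1) = x - 1 := by linarith
  have e2 : e - ⌊e⌋ = y := by linarith
  have e3 : e - (⌊e⌋ + 1) = y - 1 := by linarith
  rw [e0, e2] at h0
  rw [e1, e2] at h1
  rw [e1, e3] at h2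
  nlinarith [mul_nonneg (sub_nonneg.mpr hx1) (sub_nonneg.mpr h0.le),
    mul_nonneg (sub_nonneg.mpr h) (sub_nonneg.mpr h1.le), mul_nonneg hx0 (sub_nonneg.mpr h2.le),
    sq_nonneg (3 * x - 2), sq_nonneg (3 * y - 1), sq_nonneg (3 * x - 3 * y - 1)]

lemma exists_nonagonNorm_sub_lt (x y : ℤ × ℤ × ℤ) (hy : nonagonNorm y ≠ 0) :
    ∃ g : ℤ × ℤ × ℤ, |nonagonNorm (x - nonagonMul y g)| < |nonagonNorm y| := by
  set n := nonagonNorm y with hn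
  have hn' : (n : ℝ) ≠ 0 := by exact_mod_cast hy
  set z : ℤ × ℤ × ℤ := nonagonMul x (nonagonCofactor y) with hz
  obtain ⟨m₁, m₂, hm⟩ := exists_int_eisenstein_le (z.2.1 / n) (z.2.2 / n)
  set m₀ : ℤ := round ((z.1 : ℝ) / n) with hm₀
  have h0 : |(z.1 : ℝ) / n - m₀| ≤ 1 / 2 := abs_sub_round _
  refine ⟨(m₀, m₁, m₂), ?_⟩
  set t : ℝ × ℝ × ℝ := ((z.1 : ℝ) / n - m₀, (z.2.1 : ℝ) / n - m₁, (z.2.2 : ℝ) / n - m₂) with ht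
  have hlt : |nonagonNorm t| < 1 := by
    rw [← sq_lt_one_iff_abs_lt_one]
    refine (nonagonNorm_sq_le t).trans_lt ?_
    have h1 : t.1 ^ 2 ≤ 1 / 4 := by
      have := sq_le_sq' (by linarith [abs_le.mp h0]) (abs_le.mp h0).2
      simp only [ht]; linarith
    have h2 : t.1 ^ 2 + 2 * (t.2.1 ^ 2 - t.2.1 * t.2.2 + t.2.2 ^ 2) ≤ 11 / 12 := by
      simp only [ht] at h1 ⊢; linarith
    have h3 : 0 ≤ t.1 ^ 2 + 2 * (t.2.1 ^ 2 - t.2.1 * t.2.2 + t.2.2 ^ 2) := by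
      nlinarith [sq_nonneg t.1, sq_nonneg (t.2.1 - t.2.2), sq_nonneg t.2.1, sq_nonneg t.2.2]
    exact (pow_le_pow_left₀ h3 h2 3).trans_lt (by norm_num)
  have key : ((nonagonNorm (x - nonagonMul y (m₀, m₁, m₂)) : ℤ) : ℝ) = n * nonagonNorm t := by
    have hprod : nonagonMul ((y.1 : ℝ), (y.2.1 : ℝ), (y.2.2 : ℝ)) t =
        (((x - nonagonMul y (m₀, m₁, m₂)).1 : ℝ), ((x - nonagonMul y (m₀, m₁, m₂)).2.1 : ℝ),
          ((x - nonagonMul y (m₀, m₁, m₂)).2.2 : ℝ)) := by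
      have e : (n : ℝ) = nonagonNorm ((y.1 : ℝ), (y.2.1 : ℝ), (y.2.2 : ℝ)) := by
        simp [hn, nonagonNorm]
      simp only [nonagonMul, ht, hz, nonagonCofactor, Prod.mk.injEq, Prod.fst_sub, Prod.snd_sub]
      push_cast
      refine ⟨?_, ?_, ?_⟩ <;>
      · field_simp
        rw [e]
        simp only [nonagonNorm]
        ring
    have := nonagonNorm_mul ((y.1 : ℝ), (y.2.1 : ℝ), (y.2.2 : ℝ)) t
    rw [hprod] at this
    simpa [nonagonNorm, hn] using this
  have : ((|nonagonNorm (x - nonagonMul y (m₀, m₁, m₂))| : ℤ) : ℝ) < ((|n| : ℤ) : ℝ) := by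
    push_cast
    rw [key, abs_mul]
    exact mul_lt_of_lt_one_right (abs_pos.mpr hn') hlt
  exact_mod_cast this

lemma eq_zero_of_nonagonNorm_eq_zero (x : ℤ × ℤ × ℤ) (hx : nonagonNorm x = 0) : x = 0 := by
  have main : ∀ n : ℕ, ∀ a b e : ℤ, a.natAbs + b.natAbs + e.natAbs ≤ n →
      nonagonNorm (a, b, e) = 0 → a = 0 ∧ b = 0 ∧ e = 0 := by
    intro n
    induction n with
    | zero => intro a b e h _; omega
    | succ n ih =>
      intro a b e h h0
      have h2 : ∀ a b e : ZMod 2, nonagonNorm (a, b, e) = 0 → a = 0 ∧ b = 0 ∧ e = 0 := by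
        unfold nonagonNorm; decide
      obtain ⟨ha, hb, he⟩ := h2 a b e (by
        have := congrArg (Int.cast : ℤ → ZMod 2) h0
        simpa [nonagonNorm] using this)
      rw [← Int.cast_zero, eq_comm, ZMod.intCast_eq_intCast_iff_dvd_sub, sub_zero] at ha hb he
      obtain ⟨a, rfl⟩ := ha
      obtain ⟨b, rfl⟩ := hb
      obtain ⟨e, rfl⟩ := he
      by_cases hz : a = 0 ∧ b = 0 ∧ e = 0
      · obtain ⟨rfl, rfl, rfl⟩ := hz; simp
      obtain ⟨rfl, rfl, rfl⟩ := ih a b e (by push_cast at h; omega) (by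
        simp only [nonagonNorm] at h0 ⊢; push_cast at h0; linarith)
      simp
  obtain ⟨a, b, e⟩ := x
  obtain ⟨rfl, rfl, rfl⟩ := main _ a b e le_rfl hx
  rfl

lemma exists_zmod_root {q : ℕ} (hq : q.Prime) (hq9 : q % 9 = 8) :
    ∃ r : ZMod q, r ^ 3 = 3 * r - 1 := by
  have : Fact q.Prime := ⟨hq⟩
  let E := GaloisField q 2
  have : Fintype E := Fintype.ofFinite E
  obtain ⟨η, hη⟩ : ∃ η : Eˣ, orderOf η = 9 := by
    have hcard : Nat.card Eˣ = q ^ 2 - 1 := by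
      rw [Nat.card_units, GaloisField.card q 2 (by norm_num)]
    obtain ⟨g, hg⟩ := IsCyclic.exists_ofOrder_eq_natCard (α := Eˣ)
    rw [hcard] at hg
    have h9 : 9 ∣ q ^ 2 - 1 := by
      refine (Nat.modEq_iff_dvd' (Nat.one_le_pow _ _ hq.pos)).mp ?_
      simp [Nat.ModEq, Nat.pow_mod, hq9]
    obtain ⟨m, hm⟩ := h9
    have hq2 : 1 < q ^ 2 := Nat.one_lt_pow (by norm_num) hq.one_lt
    refine ⟨g ^ m, ?_⟩
    rw [orderOf_pow_of_dvd (by rintro rfl; omega) (by rw [hg, hm]; exact dvd_mul_left _ _), hg, hm]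
    exact Nat.mul_div_cancel _ (Nat.pos_of_ne_zero (by rintro rfl; omega))
  have h9 : (η : E) ^ 9 = 1 := by
    rw [← Units.val_pow_eq_pow_val, ← hη, pow_orderOf_eq_one, Units.val_one]
  have h3 : (η : E) ^ 3 ≠ 1 := by
    intro h
    have : η ^ 3 = 1 := Units.ext (by simpa using h)
    have := orderOf_dvd_of_pow_eq_one this
    rw [hη] at this
    norm_num at this
  have h63 : (η : E) ^ 6 + η ^ 3 + 1 = 0 := by
    refine (mul_eq_zero.mp (?_ : ((η : E) ^ 3 - 1) * _ = 0)).resolve_left (sub_ne_zero.mpr h3)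
    linear_combination h9
  have hfix : ((η : E) + η ^ 8) ^ q = η + η ^ 8 := by
    rw [add_pow_char, ← pow_mul]
    obtain ⟨m, rfl⟩ : ∃ m, q = 9 * m + 8 := ⟨q / 9, by omega⟩
    have e1 : (η : E) ^ (9 * m + 8) = η ^ 8 := by rw [pow_add, pow_mul, h9]; simp
    have e2 : (η : E) ^ (8 * (9 * m + 8)) = η := by
      rw [show 8 * (9 * m + 8) = 9 * (8 * m + 7) + 1 by ring, pow_add, pow_mul, h9]; simp
    rw [e1, e2, add_comm]
  obtain ⟨r, hr⟩ := (mem_bot_iff_intCast q E).mp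
    ((Subfield.mem_bot_iff_pow_eq_self E q).mpr hfix)
  refine ⟨r, ?_⟩
  apply (algebraMap (ZMod q) E).injective
  have hr' : algebraMap (ZMod q) E (r : ZMod q) = η + η ^ 8 := by rw [← hr]; simp
  simp only [map_pow, map_sub, map_mul, map_one, map_ofNat (algebraMap (ZMod q) E), hr']
  linear_combination ((η : E) ^ 15 + η ^ 6 + 3 * η ^ 8 + 3 * η) * h9 + h63

lemma nonagonMul_assoc {R : Type*} [CommRing R] (x y z : R × R × R) :
    nonagonMul (nonagonMul x y) z = nonagonMul x (nonagonMul y z) := by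
  simp only [nonagonMul, Prod.mk.injEq]
  refine ⟨?_, ?_, ?_⟩ <;> ring

lemma nonagonNorm_neg {R : Type*} [CommRing R] (x : R × R × R) :
    nonagonNorm (-x) = -nonagonNorm x := by
  simp only [nonagonNorm, Prod.fst_neg, Prod.snd_neg]; ring

lemma exists_nonagonNorm_eq {q : ℕ} (hq : q.Prime) (hq9 : q % 9 = 8) :
    ∃ x : ℤ × ℤ × ℤ, nonagonNorm x = q := by
  have : Fact q.Prime := ⟨hq⟩
  obtain ⟨r, hr⟩ := exists_zmod_root hq hq9
  suffices h : ∃ x : ℤ × ℤ × ℤ, (nonagonNorm x).natAbs = q by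
    obtain ⟨x, hx⟩ := h
    rcases Int.natAbs_eq (nonagonNorm x) with h | h
    · exact ⟨x, by rw [h, hx]⟩
    · exact ⟨-x, by rw [nonagonNorm_neg, h, hx, neg_neg]⟩
  let ev : ℤ × ℤ × ℤ → ZMod q := fun x ↦ x.1 + x.2.1 * r + x.2.2 * (r ^ 2 - 2)
  have ev_mul : ∀ x y, ev (nonagonMul x y) = ev x * ev y := by
    intro x y
    simp only [ev, nonagonMul]
    push_cast
    linear_combination (-(x.2.2 * y.2.1 : ZMod q) - x.2.1 * y.2.2 - r * x.2.2 * y.2.2) * hr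
  have ev_sub : ∀ x y, ev (x - y) = ev x - ev y := by
    intro x y
    simp only [ev, Prod.fst_sub, Prod.snd_sub]
    push_cast
    ring
  have hq0 : (q : ℤ) ≠ 0 := by exact_mod_cast hq.ne_zero
  have hex : ∃ n : ℕ, ∃ x, ev x = 0 ∧ nonagonNorm x ≠ 0 ∧ (nonagonNorm x).natAbs = n := by
    refine ⟨_, ((q : ℤ), 0, 0), ?_, ?_, rfl⟩
    · simp [ev]
    · simpa [nonagonNorm] using hq.ne_zero
  classical
  obtain ⟨α, hα, hα0, hαn⟩ := Nat.find_spec hex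
  have hdiv : ∀ x, ev x = 0 → ∃ g, x = nonagonMul α g := by
    intro x hx
    obtain ⟨g, hg⟩ := exists_nonagonNorm_sub_lt x α hα0
    refine ⟨g, sub_eq_zero.mp (eq_zero_of_nonagonNorm_eq_zero _ ?_)⟩
    by_contra h
    have h1 := Nat.find_le (h := hex) (n := (nonagonNorm (x - nonagonMul α g)).natAbs)
      ⟨_, by rw [ev_sub, ev_mul, hx, hα]; ring, h, rfl⟩
    rw [← hαn] at h1
    exact absurd (Int.natAbs_lt_iff_sq_lt.mpr (sq_lt_sq.mpr hg)) (not_lt.mpr h1)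
  obtain ⟨β, hβ⟩ := hdiv ((q : ℤ), 0, 0) (by simp [ev])
  have hN : nonagonNorm α * nonagonNorm β = (q : ℤ) ^ 3 := by
    rw [← nonagonNorm_mul, ← hβ]; simp [nonagonNorm]
  have hqα : (q : ℤ) ∣ nonagonNorm α := by
    have := congrArg ev (nonagonMul_cofactor α)
    rw [ev_mul, hα, zero_mul] at this
    rw [← ZMod.intCast_zmod_eq_zero_iff_dvd]
    simpa [ev] using this.symm
  have hN' : (nonagonNorm α).natAbs * (nonagonNorm β).natAbs = q ^ 3 := by
    rw [← Int.natAbs_mul, hN, Int.natAbs_pow, Int.natAbs_natCast]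
  obtain ⟨j, hj, hj'⟩ := (Nat.dvd_prime_pow hq).mp (Dvd.intro _ hN')
  interval_cases j
  · exfalso
    have := Int.natAbs_dvd_natAbs.mpr hqα
    rw [hj'] at this
    simp only [Int.natAbs_natCast, pow_zero, Nat.dvd_one] at this
    exact hq.one_lt.ne' this
  · exact ⟨α, by simpa using hj'⟩
  · refine ⟨β, ?_⟩
    rw [hj', pow_succ q 2] at hN'
    exact Nat.eq_of_mul_eq_mul_left (pow_pos hq.pos 2) hN'
  · exfalso
    rw [hj'] at hN'
    have hβ1 : (nonagonNorm β).natAbs = 1 :=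
      Nat.eq_of_mul_eq_mul_left (pow_pos hq.pos 3) (by rw [hN', mul_one])
    obtain ⟨γ, hγ⟩ := hdiv (-(r.val : ℤ), 1, 0) (by simp [ev])
    have h1 : nonagonMul ((q : ℤ), 0, 0) (nonagonCofactor β) =
        nonagonMul α (nonagonNorm β, 0, 0) := by
      rw [hβ, nonagonMul_assoc, nonagonMul_cofactor]
    have h2 := congrArg (fun x ↦ (nonagonMul x γ).2.1) h1
    have h3 : nonagonMul (nonagonMul α (nonagonNorm β, 0, 0)) γ =
        nonagonMul (-(r.val : ℤ), 1, 0) (nonagonNorm β, 0, 0) := by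
      rw [hγ]
      simp only [nonagonMul, Prod.mk.injEq]
      refine ⟨?_, ?_, ?_⟩ <;> ring
    simp only [h3] at h2
    have h4 : (q : ℤ) ∣ nonagonNorm β := by
      refine ⟨(nonagonMul (nonagonCofactor β) γ).2.1, ?_⟩
      simp only [nonagonMul] at h2 ⊢
      linear_combination -h2
    have := Int.natAbs_dvd_natAbs.mpr h4
    rw [hβ1, Int.natAbs_natCast, Nat.dvd_one] at this
    exact hq.one_lt.ne' this

/-- The norm form of the pure cubic ring `R[y]/(y³ - c)` in the basis `1, y, y²`. -/
def pureCubicNorm {R : Type*} [CommRing R] (c : R) (x : R × R × R) : R :=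
  x.1 ^ 3 + c * x.2.1 ^ 3 + c ^ 2 * x.2.2 ^ 3 - 3 * c * x.1 * x.2.1 * x.2.2

lemma exists_pureCubicNorm_mul {R : Type*} [CommRing R] {c a b : R}
    (ha : ∃ x, pureCubicNorm c x = a) (hb : ∃ x, pureCubicNorm c x = b) :
    ∃ x, pureCubicNorm c x = a * b := by
  obtain ⟨x, rfl⟩ := ha
  obtain ⟨y, rfl⟩ := hb
  refine ⟨(x.1 * y.1 + c * (x.2.1 * y.2.2 + x.2.2 * y.2.1),
    x.1 * y.2.1 + x.2.1 * y.1 + c * x.2.2 * y.2.2,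
    x.1 * y.2.2 + x.2.2 * y.1 + x.2.1 * y.2.1), ?_⟩
  simp only [pureCubicNorm]
  ring

lemma exists_pureCubicNorm_pow {R : Type*} [CommRing R] {c a : R}
    (ha : ∃ x, pureCubicNorm c x = a) (n : ℕ) : ∃ x, pureCubicNorm c x = a ^ n := by
  induction n with
  | zero => exact ⟨(1, 0, 0), by simp [pureCubicNorm]⟩
  | succ n ih => rw [pow_succ]; exact exists_pureCubicNorm_mul ih ha

lemma exists_pureCubicNorm_eq_natCast {R : Type*} [CommRing R] {z : R} (hz : z ^ 2 + z + 1 = 0)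
    {q : ℕ} (hq : q.Prime) (hq9 : q % 9 = 8) : ∃ x, pureCubicNorm z x = (q : R) := by
  obtain ⟨⟨a, b, e⟩, h⟩ := exists_nonagonNorm_eq hq hq9
  refine ⟨((a : R), b + e * z ^ 2, b * z ^ 2 + e), ?_⟩
  have h' : (nonagonNorm ((a : R), (b : R), (e : R))) = q := by
    have := congrArg (Int.cast : ℤ → R) h
    simpa [nonagonNorm] using this
  rw [← h']
  simp only [pureCubicNorm, nonagonNorm]
  have hz3 : z ^ 3 = 1 := by linear_combination (z - 1) * hz
  have hz2 : z ^ 2 = -z - 1 := by linear_combination hz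
  have hz4 : z ^ 4 = z := by linear_combination z * hz3
  have hz5 : z ^ 5 = -z - 1 := by linear_combination z ^ 2 * hz3 + hz2
  have hz6 : z ^ 6 = 1 := by linear_combination (z ^ 3 + 1) * hz3
  have hz7 : z ^ 7 = z := by linear_combination z * hz6
  have hz8 : z ^ 8 = -z - 1 := by linear_combination z ^ 2 * hz6 + hz2
  ring_nf
  simp only [hz2, hz3, hz4, hz5, hz6, hz7, hz8]
  ring

lemma exists_pureCubicNorm_eq_three {R : Type*} [CommRing R] {z : R} (hz : z ^ 2 + z + 1 = 0) :
    ∃ x, pureCubicNorm z x = (3 : R) := by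
  have h1 : ∃ x, pureCubicNorm z x = 1 - z := ⟨(1, -1, 0), by simp [pureCubicNorm]; ring⟩
  have h2 : ∃ x, pureCubicNorm z x = z := ⟨(0, 1, 0), by simp [pureCubicNorm]⟩
  have h3 : ∃ x, pureCubicNorm z x = -1 := ⟨(-1, 0, 0), by simp [pureCubicNorm]; ring⟩
  have := exists_pureCubicNorm_mul (exists_pureCubicNorm_mul h3 (exists_pureCubicNorm_pow h2 2))
    (exists_pureCubicNorm_pow h1 2)
  rwa [show -1 * z ^ 2 * (1 - z) ^ 2 = 3 by linear_combination (-z ^ 2 + 3 * z - 3) * hz] at this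

section RelNorm

variable {R S : Type*} [CommRing R] [CommRing S] [IsDedekindDomain R] [IsDedekindDomain S]
  [Algebra R S] [Module.Finite R S] [Module.IsTorsionFree R S] {s : S ≃ₐ[R] S}

lemma eq_top_of_relNorm_eq (hs : ∀ x, algebraMap R S (Algebra.intNorm R S x) = x * s x * s (s x))
    {A B : Ideal S} (hAB : A ⊔ B = ⊤) (hA : A.map s = A)
    (hN : Ideal.relNorm R A = Ideal.relNorm R B) : A = ⊤ := by
  obtain ⟨a, ha, b, hb, hab⟩ := Submodule.mem_sup.mp (hAB ▸ Submodule.mem_top : (1 : S) ∈ A ⊔ B)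
  have hsA : ∀ x ∈ A, s x ∈ A := fun x hx ↦ hA ▸ Ideal.mem_map_of_mem s hx
  have h1 : b * s b * s (s b) ∈ A := by
    rw [← hs]
    refine Ideal.relNorm_le_comap R A ?_
    rw [hN]
    exact Ideal.intNorm_mem_spanNorm R hb
  obtain rfl : b = 1 - a := by rw [← hab]; ring
  rw [Ideal.eq_top_iff_one]
  have ha1 := hsA a ha
  have ha2 := hsA _ ha1
  have : (1 : S) = (1 - a) * s (1 - a) * s (s (1 - a)) + a * (s (1 - a) * s (s (1 - a))) +
      s a * s (s (1 - a)) + s (s a) := by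
    simp only [map_sub, map_one]; ring
  rw [this]
  exact A.add_mem (A.add_mem (A.add_mem h1 (A.mul_mem_right _ ha)) (A.mul_mem_right _ ha1)) ha2

lemma eq_of_relNorm_eq (hs : ∀ x, algebraMap R S (Algebra.intNorm R S x) = x * s x * s (s x))
    {A B : Ideal S} (hA0 : A ≠ ⊥) (hA : A.map s = A) (hB : B.map s = B)
    (hN : Ideal.relNorm R A = Ideal.relNorm R B) : A = B := by
  obtain ⟨A', hA'⟩ := Ideal.dvd_iff_le.mpr (le_sup_left : A ≤ A ⊔ B)
  obtain ⟨B', hB'⟩ := Ideal.dvd_iff_le.mpr (le_sup_right : B ≤ A ⊔ B)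
  set D := A ⊔ B with hD
  have hD0 : D ≠ ⊥ := ne_bot_of_le_ne_bot hA0 le_sup_left
  have hDs : D.map s = D := by rw [hD, Ideal.map_sup, hA, hB]
  have hsup : A' ⊔ B' = ⊤ := by
    refine mul_left_cancel₀ hD0 ?_
    rw [← Ideal.one_eq_top, mul_one, Ideal.mul_sup, ← hA', ← hB']
  have stable : ∀ C C' : Ideal S, C = D * C' → C.map s = C → C'.map s = C' := by
    intro C C' h h'
    rw [h, Ideal.map_mul, hDs] at h'
    exact mul_left_cancel₀ hD0 h'
  have hN' : Ideal.relNorm R A' = Ideal.relNorm R B' := by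
    rw [hA', hB', map_mul, map_mul] at hN
    exact mul_left_cancel₀ (by simpa using hD0) hN
  rw [hA', hB', eq_top_of_relNorm_eq hs hsup (stable A A' hA' hA) hN',
    eq_top_of_relNorm_eq hs (sup_comm A' B' ▸ hsup) (stable B B' hB' hB) hN'.symm]

omit [IsDedekindDomain R] [IsDedekindDomain S] [Module.Finite R S] [Module.IsTorsionFree R S] in
lemma map_map_map_eq (hs3 : ∀ x, s (s (s x)) = x) (I : Ideal S) :
    ((I.map s).map s).map s = I := by
  refine le_antisymm ?_ fun x hx ↦ ?_
  · simp only [Ideal.map_le_iff_le_comap]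
    intro x hx
    simpa [hs3] using hx
  · rw [← hs3 x]
    exact Ideal.mem_map_of_mem s (Ideal.mem_map_of_mem s (Ideal.mem_map_of_mem s hx))

lemma map_relNorm_eq_mul (hs : ∀ x, algebraMap R S (Algebra.intNorm R S x) = x * s x * s (s x))
    (hs3 : ∀ x, s (s (s x)) = x) (h3 : Module.finrank R S = 3) {I : Ideal S} (hI : I ≠ ⊥) :
    (Ideal.relNorm R I).map (algebraMap R S) = I * I.map s * (I.map s).map s := by
  have hs3' := map_map_map_eq hs3 I
  refine eq_of_relNorm_eq hs ?_ ?_ ?_ ?_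
  · rw [Ne, Ideal.map_eq_bot_iff_of_injective (FaithfulSMul.algebraMap_injective R S)]
    simpa using hI
  · have h1 := Ideal.map_map (I := Ideal.relNorm R I) (algebraMap R S) (s : S →+* S)
    rwa [show (s : S →+* S).comp (algebraMap R S) = algebraMap R S from
      RingHom.ext fun x ↦ s.commutes x] at h1
  · rw [Ideal.map_mul, Ideal.map_mul, hs3']
    ring
  · rw [Ideal.relNorm_algebraMap, h3, map_mul, map_mul]
    simp only [Ideal.relNorm_map_algEquiv]
    ring

end RelNorm

namespace KummerTower

variable {L k K : Type} [Field L] [Field k] [Field K] [NumberField L]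
    [NumberField k] [NumberField K] [Algebra L K] [Algebra k K] {d : ℕ} {θ : L} {ζ : k}
    {σ : K ≃ₐ[k] K} {τ : K ≃ₐ[L] K} (h : KummerTower d θ ζ σ τ)
include h

local notation "ι" => algebraMap L K
local notation "κ" => algebraMap k K

lemma algebraMap_norm (x : K) : κ (Algebra.norm k x) = x * σ x * σ (σ x) := by
  have := h.galois
  classical
  have h1 : σ ≠ 1 := fun h0 ↦ by
    have := h.sigma
    rw [h0, AlgEquiv.one_apply, eq_comm] at this
    exact h.zeta_ne_one ((algebraMap k K).injective
      (by rw [map_one]; exact (mul_eq_right₀ h.theta_ne').mp this))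
  have h3 : σ * (σ * σ) = 1 := AlgEquiv.ext h.sigma_cube
  have h2 : σ * σ ≠ 1 := fun h0 ↦ h1 (by rwa [h0, mul_one] at h3)
  have huniv : (Finset.univ : Finset (K ≃ₐ[k] K)) = {1, σ, σ * σ} := by
    refine (Finset.eq_univ_of_card _ ?_).symm
    rw [← Nat.card_eq_fintype_card, IsGalois.card_aut_eq_finrank, h.finrankKk,
      Finset.card_eq_three]
    exact ⟨1, σ, σ * σ, h1.symm, h2.symm, fun h0 ↦ h1 (mul_eq_left.mp h0.symm), rfl⟩
  rw [Algebra.norm_eq_prod_automorphisms, huniv, Finset.prod_insert, Finset.prod_pair]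
  · simp [mul_assoc]
  · exact fun h0 ↦ h1 (mul_eq_left.mp h0.symm)
  · simp only [Finset.mem_insert, Finset.mem_singleton, not_or]
    exact ⟨h1.symm, h2.symm⟩

lemma exists_integral_ideal {β : K} (hβ : β * σ β * σ (σ β) = κ ζ) :
    ∃ r : k, r ≠ 0 ∧ IsIdealCube (𝓞 K) (σ β / σ (σ β) / κ r) := by
  have := h.cyclotomic
  have := h.galois
  have hβ0 : β ≠ 0 := by
    rintro rfl
    exact h.zeta_ne' (by simpa using hβ.symm)
  set s : 𝓞 K ≃ₐ[𝓞 k] 𝓞 K := RingOfIntegers.mapAlgEquiv σ with hs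
  have hsc : ∀ x : 𝓞 K, algebraMap (𝓞 K) K (s x) = σ (algebraMap (𝓞 K) K x) := fun x ↦ rfl
  have hinj := FaithfulSMul.algebraMap_injective (𝓞 K) K
  have hs3 : ∀ x, s (s (s x)) = x := fun x ↦ hinj (h.sigma_cube x)
  have hnorm : ∀ x, algebraMap (𝓞 k) (𝓞 K) (Algebra.intNorm (𝓞 k) (𝓞 K) x) =
      x * s x * s (s x) := by
    intro x
    apply hinj
    have h1 := Algebra.algebraMap_intNorm (A := 𝓞 k) (K := k) (L := K) (B := 𝓞 K) x
    have h2 := h.algebraMap_norm x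
    rw [← h1] at h2
    rw [map_mul, map_mul, hsc, hsc, hsc, ← h2]
    rfl
  have h3 : Module.finrank (𝓞 k) (𝓞 K) = 3 := by
    rw [← h.finrankKk]
    exact (IsFractionRing.finrank_eq (𝓞 k) k (𝓞 K) K).symm
  obtain ⟨n, hn0, x₁, x₂, hx₁, hx₂⟩ : ∃ n : ℤ, n ≠ 0 ∧ ∃ x₁ x₂ : 𝓞 K,
      algebraMap (𝓞 K) K x₁ = n * β ∧ algebraMap (𝓞 K) K x₂ = n * (β * σ β) := by
    classical
    obtain ⟨n, hn0, hn⟩ := exists_integral_multiples ℤ ℚ ({β, β * σ β} : Finset K)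
    refine ⟨n, hn0, ⟨_, hn β (by simp)⟩, ⟨_, hn (β * σ β) (by simp)⟩, ?_, ?_⟩ <;>
    · exact zsmul_eq_mul _ _
  set x₀ : 𝓞 K := (n : 𝓞 K) with hx₀
  obtain ⟨z, hz⟩ : ∃ z : 𝓞 K, algebraMap (𝓞 K) K z = κ ζ :=
    ⟨algebraMap (𝓞 k) (𝓞 K) h.prim.toInteger, rfl⟩
  have hzu : IsUnit z := by
    refine IsUnit.of_mul_eq_one (z ^ 2) (hinj ?_)
    rw [map_mul, map_pow, hz, map_one]
    linear_combination h.zeta_cube'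
  have hx₀0 : x₀ ≠ 0 := by simpa [hx₀] using hn0
  have hnK : (n : K) ≠ 0 := by exact_mod_cast hn0
  have hx₁0 : x₁ ≠ 0 := by
    rintro rfl
    exact mul_ne_zero hnK hβ0 (by simpa using hx₁.symm)
  have e0 : s x₀ = x₀ := by simp [hx₀]
  have e1 : x₁ * s x₁ = x₀ * x₂ := by
    apply hinj
    rw [map_mul, map_mul, hsc, hx₁, hx₂, hx₀, map_mul, map_intCast, map_intCast]
    ring
  have e2 : x₁ * s x₂ = x₀ * x₀ * z := by
    apply hinj
    rw [map_mul, map_mul, map_mul, hsc, hx₁, hx₂, hx₀, hz, map_mul, map_mul, map_intCast,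
      map_intCast]
    linear_combination (n : K) ^ 2 * hβ
  set I : Ideal (𝓞 K) := Ideal.span {x₀, x₁, x₂} with hI
  have hI0 : I ≠ ⊥ := ne_bot_of_le_ne_bot (b := Ideal.span {x₀}) (by simpa using hx₀0)
    (Ideal.span_mono (by simp))
  have hrel : Ideal.span {x₁} * I.map s = Ideal.span {x₀} * I := by
    rw [hI, Ideal.map_span, Set.image_insert_eq, Set.image_insert_eq, Set.image_singleton, e0]
    simp only [Ideal.span_insert, Ideal.mul_sup, Ideal.span_singleton_mul_span_singleton, e1, e2,
      Ideal.span_singleton_mul_right_unit hzu]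
    rw [mul_comm x₁ x₀, ← sup_assoc, sup_comm]
  have map_span : ∀ x, (Ideal.span {x}).map s = Ideal.span {s x} := by
    intro x; rw [Ideal.map_span, Set.image_singleton]
  have hrel1 : Ideal.span {s x₁} * (I.map s).map s = Ideal.span {x₀} * I.map s := by
    have := congrArg (Ideal.map s) hrel
    rwa [Ideal.map_mul, Ideal.map_mul, map_span, map_span, e0] at this
  have hI3 : ((I.map s).map s).map s = I := map_map_map_eq hs3 I
  have hrel2 : Ideal.span {s (s x₁)} * I = Ideal.span {x₀} * (I.map s).map s := by
    have := congrArg (Ideal.map s) hrel1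
    rwa [Ideal.map_mul, Ideal.map_mul, map_span, map_span, e0, hI3] at this
  have : IsPrincipalIdealRing (𝓞 k) := IsCyclotomicExtension.Rat.three_pid k
  obtain ⟨r, hr⟩ := (IsPrincipalIdealRing.principal (Ideal.relNorm (𝓞 k) I)).principal
  rw [Ideal.submodule_span_eq] at hr
  have hr0 : r ≠ 0 := by
    rintro rfl
    rw [Ideal.span_singleton_eq_bot.mpr rfl, Ideal.relNorm_eq_bot_iff] at hr
    exact hI0 hr
  have hmap := map_relNorm_eq_mul hnorm hs3 h3 hI0
  rw [hr, Ideal.map_span, Set.image_singleton] at hmap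
  refine ⟨r, by simpa using hr0, ?_⟩
  have hx : s x₁ ≠ 0 := by simpa using hx₁0
  have hy : algebraMap (𝓞 k) (𝓞 K) r * s (s x₁) ≠ 0 := by simpa using ⟨hr0, hx₁0⟩
  have hI2 : (I.map s).map s ≠ ⊥ := by
    intro h0
    rw [h0, Ideal.map_bot] at hI3
    exact hI0 hI3.symm
  have := isIdealCube_div_of_span_mul (R := 𝓞 K) (F := K) hx hy hI2 (B := ⊤) top_ne_bot (by
    rw [← Ideal.span_singleton_mul_span_singleton, hmap]
    calc _ = Ideal.span {s x₁} * (I.map s).map s * ((I.map s).map s) ^ 2 := by ring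
      _ = I.map s * (I.map s).map s * (Ideal.span {x₀} * (I.map s).map s) := by rw [hrel1]; ring
      _ = _ := by rw [← hrel2, ← Ideal.one_eq_top]; ring)
  convert this using 1
  rw [map_mul, hsc, hsc, hsc, hx₁, map_mul, map_mul, map_intCast, map_intCast,
    show algebraMap (𝓞 K) K (algebraMap (𝓞 k) (𝓞 K) r) = κ (algebraMap (𝓞 k) k r) from rfl]
  field_simp

end KummerTower

namespace KummerTower

variable {L k K : Type} [Field L] [Field k] [Field K] [NumberField L]
    [NumberField k] [NumberField K] [Algebra L K] [Algebra k K] {d : ℕ} {θ : L} {ζ : k}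
    {σ : K ≃ₐ[k] K} {τ : K ≃ₐ[L] K} (h : KummerTower d θ ζ σ τ)
include h

local notation "ι" => algebraMap L K
local notation "κ" => algebraMap k K

lemma ne_pow_three (y : k) : (d : k) ≠ y ^ 3 := by
  intro hy
  have hy0 : κ y ≠ 0 := by
    intro h0
    rw [map_eq_zero] at h0
    subst h0
    exact h.d_ne (by exact_mod_cast hy.trans (zero_pow three_ne_zero))
  obtain ⟨j, -, hj⟩ := h.eq_zeta_pow (c := ι θ / κ y) (by
    rw [div_pow, h.cube', ← map_pow, ← hy, map_natCast]
    exact div_self (by exact_mod_cast h.d_ne))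
  rw [div_eq_iff hy0] at hj
  obtain ⟨-, h1, -⟩ := h.indepKk (a := -(ζ ^ j * y)) (b := 1) (c := 0) (by
    rw [hj]; simp)
  exact one_ne_zero h1

lemma exists_norm_zeta (hx : ∃ x, pureCubicNorm ζ x = (d : k)) :
    ∃ β : K, β * σ β * σ (σ β) = κ ζ := by
  obtain ⟨⟨a, b, c⟩, hx⟩ := hx
  simp only [pureCubicNorm] at hx
  have hT : (ι θ) ^ 3 = κ a ^ 3 + κ ζ * κ b ^ 3 + κ ζ ^ 2 * κ c ^ 3
      - 3 * κ ζ * κ a * κ b * κ c := by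
    rw [h.cube', ← map_natCast κ, ← hx]; simp [map_ofNat κ]
  have hZ := h.root'
  have hσ := h.sigma
  have hB1 : κ c ^ 2 - κ ζ ^ 2 * κ a * κ b + κ ζ * ι θ * κ b ≠ 0 := by
    intro h0
    obtain ⟨h1, h2, -⟩ := h.indepKk (a := c ^ 2 - ζ ^ 2 * a * b) (b := ζ * b) (c := 0) (by
      rw [← h0]; simp only [map_sub, map_mul, map_pow, map_zero]; ring)
    obtain rfl : b = 0 := by simpa [h.zeta_ne] using h2
    obtain rfl : c = 0 := by simpa using h1
    exact h.ne_pow_three a (by rw [← hx]; simp)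
  set B₀ : K := κ a ^ 2 - κ ζ * κ b * κ c + ι θ * κ a + ι θ ^ 2 with hB₀
  set B₁ : K := κ c ^ 2 - κ ζ ^ 2 * κ a * κ b + κ ζ * ι θ * κ b with hB₁
  set B₂ : K := κ ζ * (κ b ^ 2 - κ a * κ c) + κ ζ ^ 2 * ι θ * κ c with hB₂
  have s₀ : σ B₀ = κ a ^ 2 - κ ζ * κ b * κ c + κ ζ * ι θ * κ a + (κ ζ * ι θ) ^ 2 := by
    simp [hB₀, hσ]
  have s₁ : σ B₁ = κ c ^ 2 - κ ζ ^ 2 * κ a * κ b + κ ζ * (κ ζ * ι θ) * κ b := by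
    simp [hB₁, hσ]
  have s₂ : σ B₂ = κ ζ * (κ b ^ 2 - κ a * κ c) + κ ζ ^ 2 * (κ ζ * ι θ) * κ c := by
    simp [hB₂, hσ]
  have r₁ : σ B₀ * B₂ = σ B₁ * B₁ := by
    rw [s₀, s₁, hB₁, hB₂]
    generalize κ ζ = Z at *
    generalize ι θ = T at *
    generalize κ a = a at *
    generalize κ b = b at *
    generalize κ c = c at *
    linear_combination (Z ^ 4 * c) * hT + (-1 * T * Z * b * c ^ 2 - Z ^ 2 * a ^ 2 * b ^ 2 +
      T * Z ^ 2 * a * b ^ 2 + Z ^ 2 * a ^ 3 * c + Z ^ 3 * b ^ 3 * c + Z ^ 4 * c ^ 4 -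
      3 * Z ^ 3 * a * b * c ^ 2 + Z * a ^ 2 * b ^ 2 - Z * a ^ 3 * c - Z ^ 2 * b ^ 3 * c -
      Z ^ 3 * c ^ 4 + 3 * Z ^ 2 * a * b * c ^ 2 + Z * c ^ 4 - c ^ 4) * hZ
  have r₂ : σ B₀ * B₀ = κ ζ * (σ B₂ * B₁) := by
    rw [s₀, s₂, hB₁, hB₀]
    generalize κ ζ = Z at *
    generalize ι θ = T at *
    generalize κ a = a at *
    generalize κ b = b at *
    generalize κ c = c at *
    linear_combination (Z * a + Z ^ 2 * a + T * Z ^ 2) * hT + (T ^ 2 * a ^ 2 +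
      Z ^ 2 * a * b ^ 3 - Z ^ 2 * a ^ 2 * b * c + T * Z ^ 4 * a * b * c - T ^ 2 * Z ^ 3 * b * c +
      a ^ 4 + Z ^ 2 * a * c ^ 3 - 2 * Z * a ^ 2 * b * c + T * a ^ 3 - T * Z ^ 3 * a * b * c +
      T ^ 2 * Z ^ 2 * b * c - T ^ 2 * Z * b * c - T * Z * a * b * c) * hZ
  have r₃ := congrArg σ r₁
  rw [map_mul, map_mul] at r₃
  have hB1' : σ B₁ ≠ 0 := by simpa using hB1
  have hB1'' : σ (σ B₁) ≠ 0 := by simpa using hB1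
  refine ⟨B₀ / B₁, ?_⟩
  rw [map_div₀, map_div₀]
  field_simp
  linear_combination σ (σ B₀) * r₂ + κ ζ * B₁ * r₃

/-- The part of the argument which uses that `ζ` is a norm from `K`. -/
lemma exists_isTwist_zeta {β : K} (hβ : β * σ β * σ (σ β) = κ ζ) :
    ∃ g : L, g ≠ 0 ∧ IsIdealCube (𝓞 L) g ∧ IsTwist σ g ζ ∧
      ∀ (r : ℚ) (l : L), g ≠ r * l ^ 3 := by
  have hβ0 : β ≠ 0 := by
    rintro rfl
    exact h.zeta_ne' (by simpa using hβ.symm)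
  have hβ1 : σ β ≠ 0 := by simpa using hβ0
  have hβ2 : σ (σ β) ≠ 0 := by simpa using hβ0
  have hs := h.sigma_cube β
  have hτβ0 : τ β ≠ 0 := by simpa using hβ0
  have hτβ1 : τ (σ β) ≠ 0 := by simpa using hβ0
  have hτβ2 : τ (σ (σ β)) ≠ 0 := by simpa using hβ0
  have t₁ : σ (τ β) = τ (σ (σ β)) := by rw [h.sigma_tau, h.sigma_tau, h.sigma_cube]
  have t₂ : σ (τ (σ (σ β))) = τ (σ β) := by
    rw [← t₁, ← h.sigma_tau]
  have hτβ : τ β * τ (σ β) * τ (σ (σ β)) = κ ζ ^ 2 := by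
    rw [← map_mul, ← map_mul, hβ, h.tau]
  obtain ⟨r, hr0, hr⟩ := h.exists_integral_ideal hβ
  obtain ⟨z, hz⟩ := h.tau_k r
  have hz0 : z ≠ 0 := by
    rintro rfl
    simp [hr0] at hz
  obtain ⟨R, hR⟩ := h.mem_rat (y := r * z) (by
    rw [map_mul, ← hz, map_mul, h.tau_sq]; ring)
  have hR0 : R ≠ 0 := by
    rintro rfl
    rw [Rat.cast_zero] at hR
    exact mul_ne_zero hr0 hz0 hR
  obtain ⟨v, hv⟩ := h.mem_L (x := σ β / σ (σ β) * τ (σ β / σ (σ β))) (by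
    rw [map_mul, h.tau_sq]; ring)
  have hv0 : ι v ≠ 0 := by
    rw [← hv, map_div₀]
    exact mul_ne_zero (div_ne_zero hβ1 hβ2) (div_ne_zero hτβ1 hτβ2)
  rw [map_div₀] at hv
  have hv' : v ≠ 0 := by simpa using hv0
  have hRL : (R : L) ≠ 0 := by exact_mod_cast hR0
  have hRK : (R : K) ≠ 0 := by exact_mod_cast hR0
  have hvR : v / R ≠ 0 := div_ne_zero hv' hRL
  have hσv : ι v = σ (β / τ β) / σ (σ (β / τ β)) := by
    simp only [map_div₀, t₁, t₂]
    rw [← hv]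
    field_simp
  set δ : K := β / τ β with hδ
  have hδ0 : δ ≠ 0 := div_ne_zero hβ0 hτβ0
  have hδ1 : σ δ ≠ 0 := by simpa using hδ0
  have hδ2 : σ (σ δ) ≠ 0 := by simpa using hδ0
  have hδN : δ * σ δ * σ (σ δ) * κ ζ ^ 2 = κ ζ := by
    rw [← hτβ, ← hβ, hδ]
    simp only [map_div₀, t₁, t₂]
    field_simp
  have hδN' : δ * σ δ * σ (σ δ) = κ ζ ^ 2 := by
    linear_combination κ ζ * hδN - δ * σ δ * σ (σ δ) * h.zeta_cube'
  clear_value δ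
  refine ⟨v / R, hvR, ?_, ⟨R⁻¹, (σ δ)⁻¹, inv_ne_zero hR0, inv_ne_zero hδ1, ?_, ?_⟩, ?_⟩
  · refine IsIdealCube.descend (𝓞 L) (𝓞 K) K h.finrankKL hvR ?_
    convert hr.mul (hr.map τ.toRingEquiv) using 1
    change _ = _ * τ _
    rw [map_div₀, map_div₀, map_div₀, ← hv, hz, map_ratCast]
    have : (R : K) = κ r * κ z := by rw [← map_mul, hR, map_ratCast]
    rw [this]
    have hr0' : κ r ≠ 0 := by simpa using hr0
    have hz0' : κ z ≠ 0 := by simpa using hz0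
    field_simp
  · rw [map_div₀, map_ratCast, hσv, map_inv₀, Rat.cast_inv]
    field_simp
  · rw [map_inv₀, map_inv₀, h.sigma_cube]
    have hζ := h.zeta_ne'
    field_simp
    linear_combination -h.zeta_cube' - κ ζ * hδN'
  · intro q l hql
    have hv1 : ι v * σ (ι v) * σ (σ (ι v)) = 1 := by
      rw [hσv]
      simp only [map_div₀, h.sigma_cube]
      field_simp
    have hvl : v = (q * R : ℚ) * l ^ 3 := by
      rw [div_eq_iff hRL] at hql
      rw [hql]; push_cast; ring
    have hl0 : ι l ≠ 0 := by
      intro h0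
      rw [hvl, map_mul, map_pow, h0] at hv0
      simp at hv0
    have hl1 : σ (ι l) ≠ 0 := by simpa using hl0
    have hl2 : σ (σ (ι l)) ≠ 0 := by simpa using hl0
    obtain ⟨n, hn, -⟩ := h.norm_eq (x := l)
    rw [hvl] at hv1
    simp only [map_mul, map_pow, map_ratCast] at hv1
    have hqn : ((q * R * n) ^ 3 : ℚ) = 1 := by
      have : (((q * R * n) ^ 3 : ℚ) : K) = 1 := by
        push_cast
        rw [← hn, ← hv1]; push_cast; ring
      exact_mod_cast this
    have hqn1 : q * R * n = 1 := (pow_eq_one_iff_of_ne_zero three_ne_zero).mp hqn |>.resolve_right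
      (by rintro ⟨-, h3⟩; exact absurd h3 (by decide))
    have hvl' : ι v * (σ (ι l) * σ (σ (ι l))) = ι l ^ 2 := by
      have : ((q * R * n : ℚ) : K) = 1 := by rw [hqn1]; simp
      rw [Rat.cast_mul, ← hn] at this
      rw [hvl, map_mul, map_ratCast, map_pow]
      linear_combination ι l ^ 2 * this
    set m : K := σ (σ (ι l)) / σ (ι l) with hm
    have hσm : σ m = ι l / σ (σ (ι l)) := by rw [hm, map_div₀, h.sigma_cube]
    have hσσm : σ (σ m) = σ (ι l) / ι l := by rw [hσm, map_div₀, h.sigma_cube]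
    obtain ⟨y, hy⟩ := h.mem_k (x := σ (δ / m)) (by
      rw [map_div₀, map_div₀, hσσm, hσm]
      rw [hσv] at hvl'
      field_simp at hvl' ⊢
      linear_combination -hvl')
    have hy3 : y ^ 3 = ζ ^ 2 := by
      apply (algebraMap k K).injective
      have hy1 : σ (σ δ) / σ (σ m) = κ y := by
        rw [← map_div₀, ← map_div₀, hy, AlgEquiv.commutes]
      have hy2 : δ / m = κ y := by
        rw [← h.sigma_cube (δ / m), hy, AlgEquiv.commutes, AlgEquiv.commutes]
      rw [map_div₀] at hy
      calc _ = (δ / m) * (σ δ / σ m) * (σ (σ δ) / σ (σ m)) := by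
            rw [hy, hy1, hy2, map_pow]; ring
        _ = (δ * σ δ * σ (σ δ)) / (m * σ m * σ (σ m)) := by
            rw [div_mul_div_comm, div_mul_div_comm]
        _ = _ := by
            rw [hδN', hσσm, hσm, hm, map_pow]
            field_simp
    have := h.cyclotomic
    have hfin : IsOfFinOrder y := isOfFinOrder_iff_pow_eq_one.mpr ⟨9, by norm_num, by
      calc y ^ 9 = (y ^ 3) ^ 3 := by ring
        _ = (ζ ^ 3) ^ 2 := by rw [hy3]; ring
        _ = 1 := by rw [h.zeta_cube, one_pow]⟩
    obtain ⟨j, -, rfl | rfl⟩ :=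
      IsPrimitiveRoot.exists_pow_or_neg_mul_pow_of_isOfFinOrder (K := k) (by decide) h.prim hfin
    all_goals
      have h2 : (ζ ^ j) ^ 3 = 1 := by rw [← pow_mul, mul_comm, pow_mul, h.zeta_cube, one_pow]
    · rw [h2] at hy3
      exact h.zeta_ne_one (by linear_combination h.zeta_cube + ζ * hy3)
    · rw [neg_pow, h2] at hy3
      exact h.zeta_ne (by linear_combination h.root + hy3)

/-- When `d` is divisible by two primes and `ζ` is a norm from `K`, one of them and an element
built from `ζ` generate the ideal cubes of `L` modulo cubes. -/
theorem exists_cubeGens_of_norm {p₁ p₂ e₁ e₂ : ℕ} (hp₁ : p₁.Prime) (hp₂ : p₂.Prime)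
    (h12 : p₁ ≠ p₂) (he₁ : e₁ = 1 ∨ e₁ = 2) (hd : d = p₁ ^ e₁ * p₂ ^ e₂)
    (hS : ∀ p : ℕ, p.Prime → p ∣ 3 * d → p = p₁ ∨ p = p₂ ∨
      (p = 3 ∧ (d % 9 = 1 ∨ d % 9 = 8)))
    (hd3 : ∀ p : ℕ, p.Prime → p ∣ d → p = 3 ∨ p % 3 = 2)
    (hc₂ : IsIdealCube (𝓞 L) (p₂ : L)) (hx : ∃ x, pureCubicNorm ζ x = (d : k)) :
    ∃ g : L, CubeGens (p₂ : L) g := by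
  obtain ⟨β, hβ⟩ := h.exists_norm_zeta hx
  obtain ⟨g, hg0, hgc, hgt, hg⟩ := h.exists_isTwist_zeta hβ
  have h2 : (p₂ : L) ≠ 0 := by exact_mod_cast hp₂.ne_zero
  have hp₂ℚ : (p₂ : ℚ) ≠ 0 := by exact_mod_cast hp₂.ne_zero
  refine ⟨g, h2, hg0, hc₂, hgc, fun γ hγ hγc ↦ ?_, fun a b l hl ↦ ?_⟩
  · obtain ⟨i, hi⟩ := h.exists_isTwist hd3 hγ hγc
    have htw := hi.mul (hgt.pow (2 * i))
    rw [← pow_add, show i + 2 * i = 3 * i by ring, pow_mul ζ, h.zeta_cube, one_pow] at htw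
    obtain ⟨r, l, hr, hrl⟩ := h.eq_rat_mul_pow_of_isTwist htw
    have hl : l ≠ 0 := by
      rintro rfl
      simp [hγ, hg0] at hrl
    have hrc : IsIdealCube (𝓞 L) (r : L) := by
      have := (hγc.mul (hgc.pow (2 * i))).div (isIdealCube_pow_three (R := 𝓞 L) l)
      rwa [hrl, mul_div_cancel_right₀ _ (pow_ne_zero 3 hl)] at this
    obtain ⟨a, b, c, s, rfl⟩ := h.exists_rat_eq hp₁ hp₂ hp₂
      (fun p hp hpd ↦ by rcases hS p hp hpd with h' | h' | h' <;> simp [h']) hr hrc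
    obtain ⟨x, t, hxt⟩ : ∃ (x : ℕ) (t : L), (p₁ : L) = p₂ ^ x * t ^ 3 := by
      have hθ : θ ^ 3 = p₁ ^ e₁ * p₂ ^ e₂ := by rw [h.cube, hd]; push_cast; ring
      have hθ0 := h.theta_ne
      rcases he₁ with rfl | rfl
      · refine ⟨2 * e₂, θ / p₂ ^ e₂, ?_⟩
        rw [div_pow, hθ]; field_simp; ring
      · refine ⟨e₂, p₁ / θ, ?_⟩
        rw [div_pow, hθ]
        have h1 : (p₁ : L) ≠ 0 := by exact_mod_cast hp₁.ne_zero
        field_simp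
    refine ⟨x * a + b + c, i, t ^ a * s * l / g ^ i, ?_⟩
    push_cast at hrl
    rw [hxt] at hrl
    field_simp
    linear_combination hrl
  · have h3b : 3 ∣ b := by
      by_contra h3
      obtain ⟨b', hb⟩ : ∃ b', (∃ n, b * b' = 3 * n + 1) := by
        have : b % 3 = 1 ∨ b % 3 = 2 := by omega
        rcases this with h1 | h1
        · exact ⟨1, b / 3, by omega⟩
        · exact ⟨2, 2 * (b / 3) + 1, by omega⟩
      obtain ⟨n, hn⟩ := hb
      refine hg ((p₂ ^ (a * b'))⁻¹ : ℚ) (l ^ b' / g ^ n) ?_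
      have := congrArg (· ^ b') hl
      simp only [mul_pow, ← pow_mul, hn] at this
      push_cast
      field_simp
      linear_combination this
    refine ⟨?_, h3b⟩
    obtain ⟨n, rfl⟩ := h3b
    obtain ⟨s, hs⟩ := h.exists_eq_cube hp₁ he₁ (m := p₂ ^ e₂) (fun hdvd =>
        h12 ((Nat.prime_dvd_prime_iff_eq hp₁ hp₂).1 (hp₁.dvd_of_dvd_pow hdvd))) hd
      (r := p₂ ^ a) (l := l / g ^ n) (by simp [hp₂ℚ])
      (by simpa using padicValRat_mul_pow_eq_zero hp₁ hp₂ hp₂ h12 h12 a 0)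
      (by rw [div_pow, ← hl]; push_cast; field_simp; ring)
    exact (three_dvd_of_mul_pow_eq_cube (b := 0) hp₂ hp₁ h12.symm (by simpa using hs)).1

end KummerTower

section PGroup

variable {G : Type*} [CommGroup G] [Finite G] {p : ℕ}

lemma card_pow_prime_pow_eq_one_le (h : Nat.card {x : G // x ^ p = 1} ≤ p) (n : ℕ) :
    Nat.card {x : G // x ^ p ^ n = 1} ≤ p ^ n := by
  classical
  have := Fintype.ofFinite G
  simp only [Nat.card_eq_fintype_card, Fintype.card_subtype] at h ⊢
  induction n with
  | zero => simpa using Finset.card_le_one.2 fun a ha b hb ↦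
      (Finset.mem_filter.1 ha).2.trans (Finset.mem_filter.1 hb).2.symm
  | succ n ih =>
    rw [pow_succ']
    refine (Finset.card_le_mul_card_image_of_maps_to (f := (· ^ p))
      (t := {x : G | x ^ p ^ n = 1}) ?_ p ?_).trans (Nat.mul_le_mul_left p ih)
    · intro x hx
      simpa [← pow_mul, ← pow_succ'] using hx
    · intro b _
      obtain hemp | ⟨y, hy⟩ := Finset.eq_empty_or_nonempty
        {x ∈ ({x : G | x ^ (p * p ^ n) = 1} : Finset G) | x ^ p = b}
      · simp [hemp]
      · refine le_trans (Finset.card_le_card_of_injOn (· * y⁻¹) ?_ ?_) h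
        · intro x hx
          simp only [Finset.coe_filter, Finset.mem_filter, Finset.mem_univ, true_and,
            Set.mem_ofPred_eq] at hx hy ⊢
          rw [mul_pow, inv_pow, hx.2, hy.2, mul_inv_cancel]
        · exact fun x _ z _ hxz ↦ mul_right_cancel hxz

/-- A finite abelian `p`-group with at most `p` elements of order dividing `p` is cyclic. -/
lemma IsPGroup.isCyclic_of_card_le [Fact p.Prime] (hG : IsPGroup p G)
    (h : Nat.card {x : G // x ^ p = 1} ≤ p) : IsCyclic G := by
  classical
  have hp : p.Prime := Fact.out
  have := Fintype.ofFinite G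
  refine isCyclic_of_card_pow_eq_one_le fun n hn ↦ ?_
  obtain ⟨a, m, hm, rfl⟩ := Nat.exists_eq_pow_mul_and_not_dvd hn.ne' p hp.ne_one
  have h1 := card_pow_prime_pow_eq_one_le h a
  simp only [Nat.card_eq_fintype_card, Fintype.card_subtype] at h1
  refine le_trans (Finset.card_le_card fun x hx ↦ ?_)
    (h1.trans (Nat.le_mul_of_pos_right _ (Nat.pos_of_ne_zero (by rintro rfl; simp at hm))))
  simp only [Finset.mem_filter, Finset.mem_univ, true_and] at hx ⊢
  obtain ⟨j, hj⟩ := hG x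
  rw [← orderOf_dvd_iff_pow_eq_one] at hx hj ⊢
  refine Nat.Coprime.dvd_of_dvd_mul_right ?_ hx
  exact Nat.Coprime.coprime_dvd_left hj (Nat.Coprime.pow_left j ((hp.coprime_iff_not_dvd).2 hm))

end PGroup

/-- Modulo cubes, the unit group is cyclic of order `3` with generator `ε`. -/
structure IsCubeGenerator {L : Type} [Field L] [NumberField L] (ε : (𝓞 L)ˣ) : Prop where
  gen : ∀ u : (𝓞 L)ˣ, ∃ (n : ℕ) (w : (𝓞 L)ˣ), u = ε ^ n * w ^ 3
  ne : ∀ w : (𝓞 L)ˣ, ε ≠ w ^ 3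

section Units

variable {L : Type} [Field L] [NumberField L]

lemma exists_isCubeGenerator (hodd : Odd (Module.finrank ℚ L)) (hr : Units.rank L = 1) :
    ∃ ε : (𝓞 L)ˣ, IsCubeGenerator ε := by
  have hu : Unique (Fin (Units.rank L)) := by rw [hr]; infer_instance
  have htors : ∀ x : Units.torsion L, (x : (𝓞 L)ˣ) ^ 2 = 1 := by
    intro x
    obtain h | h := NumberField.Units.torsion_eq_one_or_neg_one_of_odd_finrank hodd x <;> simp [h]
  refine ⟨Units.fundSystem L default, fun u ↦ ?_, fun w hw ↦ ?_⟩
  · obtain ⟨⟨x, e⟩, he, -⟩ := Units.exist_unique_eq_mul_prod L u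
    simp only [Fintype.prod_unique] at he
    refine ⟨(e default % 3).toNat, x * Units.fundSystem L default ^ (e default / 3), ?_⟩
    rw [he, mul_pow, ← zpow_natCast, ← zpow_natCast (_ ^ (_ : ℤ)), ← zpow_mul, mul_left_comm,
      ← zpow_add, pow_succ, htors, one_mul]
    congr 2
    omega
  · obtain ⟨⟨x, e⟩, he, -⟩ := Units.exist_unique_eq_mul_prod L w
    have h1 := (Units.exist_unique_eq_mul_prod L (Units.fundSystem L default)).unique
      (y₁ := ⟨1, fun _ ↦ 1⟩) (y₂ := ⟨x ^ 3, fun i ↦ 3 * e i⟩) (by simp) (by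
        simp only [Fintype.prod_unique] at he ⊢
        conv_lhs => rw [hw, he]
        simp only [mul_pow, SubmonoidClass.coe_pow]
        rw [mul_comm 3, zpow_mul]
        norm_cast)
    have h3 := congrFun (congrArg Prod.snd h1) default
    simp only at h3
    omega

end Units

section ClassGroup

variable {L : Type} [Field L] [NumberField L]

lemma mk0_eq_mk0_of_pow_three {I J : (Ideal (𝓞 L))⁰} {g g' : 𝓞 L} {u : (𝓞 L)ˣ} {x : L} (hx : x ≠ 0)
    (hI : Ideal.span {g} = (I : Ideal (𝓞 L)) ^ 3) (hJ : Ideal.span {g'} = (J : Ideal (𝓞 L)) ^ 3)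
    (h : (g : L) = g' * (u : 𝓞 L) * x ^ 3) : ClassGroup.mk0 I = ClassGroup.mk0 J := by
  obtain ⟨y, z, hz, rfl⟩ := IsFractionRing.div_surjective (A := 𝓞 L) x
  have hz0 : z ≠ 0 := nonZeroDivisors.ne_zero hz
  have hz0' : (z : L) ≠ 0 := by simpa using hz0
  have hy0 : y ≠ 0 := by
    rintro rfl
    simp at hx
  refine ClassGroup.mk0_eq_mk0_iff.2 ⟨z, y, hz0, hy0, ?_⟩
  have h1 : z ^ 3 * g = y ^ 3 * g' * (u : 𝓞 L) := by
    apply RingOfIntegers.ext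
    simp only [map_mul, map_pow]
    change (z : L) ^ 3 * (g : L) = (y : L) ^ 3 * (g' : L) * ((u : 𝓞 L) : L)
    rw [h]
    field_simp
  have h2 : (Ideal.span {z} * (I : Ideal (𝓞 L))) ^ 3 = (Ideal.span {y} * J) ^ 3 := by
    rw [mul_pow, mul_pow, ← hI, ← hJ, Ideal.span_singleton_pow, Ideal.span_singleton_pow,
      Ideal.span_singleton_mul_span_singleton, Ideal.span_singleton_mul_span_singleton, h1,
      Ideal.span_singleton_mul_right_unit u.isUnit]
  exact dvd_antisymm
    ((UniqueFactorizationMonoid.pow_dvd_pow_iff_dvd three_ne_zero).1 h2.dvd)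
    ((UniqueFactorizationMonoid.pow_dvd_pow_iff_dvd three_ne_zero).1 h2.symm.dvd)

variable {ε : (𝓞 L)ˣ} {g₁ g₂ : L}

lemma CubeGens.exists_eq_unit (hg : CubeGens g₁ g₂) (hε : IsCubeGenerator ε) :
    ∃ (a b : ℕ) (l : L), ((ε : 𝓞 L) : L) = g₁ ^ a * g₂ ^ b * l ^ 3 ∧ ¬ (3 ∣ a ∧ 3 ∣ b) := by
  obtain ⟨a, b, l, h⟩ := hg.gen ((ε : 𝓞 L) : L) (by simp) (isIdealCube_unit ε)
  refine ⟨a, b, l, h, ?_⟩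
  rintro ⟨⟨a, rfl⟩, ⟨b, rfl⟩⟩
  obtain ⟨x, hx⟩ : ∃ x : L, x = g₁ ^ a * g₂ ^ b * l := ⟨_, rfl⟩
  have hx3 : x ^ 3 = ((ε : 𝓞 L) : L) := by rw [h, hx]; ring
  have hint : IsIntegral ℤ x :=
    IsIntegral.of_pow (n := 3) (by decide) (hx3 ▸ RingOfIntegers.isIntegral_coe _)
  obtain ⟨y, rfl⟩ : ∃ y : 𝓞 L, (y : L) = x := ⟨⟨x, hint⟩, rfl⟩
  have hy : y ^ 3 = ε := RingOfIntegers.ext hx3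
  have hu : IsUnit y := (isUnit_pow_iff three_ne_zero).1 (hy ▸ ε.isUnit)
  exact hε.ne hu.unit (Units.ext (by simp [hy]))

lemma exists_nat_smul_eq {a₀ b₀ x y : ZMod 3} (h₀ : ¬ (a₀ = 0 ∧ b₀ = 0)) (h : x * b₀ = y * a₀) :
    ∃ n : Fin 3, x = (n : ℕ) * a₀ ∧ y = (n : ℕ) * b₀ := by
  revert a₀ b₀ x y; decide

lemma CubeGens.card_le (hg : CubeGens g₁ g₂) (hε : IsCubeGenerator ε) :
    Nat.card {c : ClassGroup (𝓞 L) // c ^ 3 = 1} ≤ 3 := by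
  have h₁ := hg.ne₁
  have h₂ := hg.ne₂
  obtain ⟨a₀, b₀, l₀, hε₀, h₀⟩ := hg.exists_eq_unit hε
  have hex : ∀ c : {c : ClassGroup (𝓞 L) // c ^ 3 = 1}, ∃ (I : (Ideal (𝓞 L))⁰) (g : 𝓞 L)
      (a b : ℕ) (l : L), ClassGroup.mk0 I = c ∧ Ideal.span {g} = (I : Ideal (𝓞 L)) ^ 3 ∧ g ≠ 0 ∧
        (g : L) = g₁ ^ a * g₂ ^ b * l ^ 3 := by
    rintro ⟨c, hc⟩
    obtain ⟨⟨I, hI0⟩, rfl⟩ := ClassGroup.mk0_surjective c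
    rw [← map_pow, SubmonoidClass.mk_pow, ClassGroup.mk0_eq_one_iff] at hc
    obtain ⟨g, hg'⟩ := hc.principal
    rw [Ideal.submodule_span_eq] at hg'
    have hg0 : g ≠ 0 := by
      rintro rfl
      rw [Ideal.span_singleton_eq_bot.2 rfl] at hg'
      exact nonZeroDivisors.ne_zero hI0 (pow_eq_zero_iff three_ne_zero |>.1 hg')
    obtain ⟨a, b, l, h⟩ := hg.gen (g : L) (by simpa using hg0)
      (isIdealCube_of_span_eq_pow hg0 hg'.symm)
    exact ⟨⟨I, hI0⟩, g, a, b, l, rfl, hg'.symm, hg0, h⟩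
  choose I g a b l hI hgI hg0 hgl using hex
  have hinj : Function.Injective
      (fun c ↦ (a c * b₀ - b c * a₀ : ZMod 3)) := by
    intro c c' hcc
    refine Subtype.ext ?_
    rw [← hI c, ← hI c']
    obtain ⟨n, hn₁, hn₂⟩ := exists_nat_smul_eq (a₀ := a₀) (b₀ := b₀)
      (x := a c - a c') (y := b c - b c')
      (by simpa only [ZMod.natCast_eq_zero_iff] using h₀) (by linear_combination hcc)
    have h3 : (3 : ZMod 3) = 0 := rfl
    obtain ⟨A, hA⟩ := (ZMod.natCast_eq_zero_iff (a c + 2 * a c' + 2 * (n : ℕ) * a₀) 3).1 (by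
      push_cast; linear_combination hn₁ + (a c' + ((n : ℕ) : ZMod 3) * a₀) * h3)
    obtain ⟨B, hB⟩ := (ZMod.natCast_eq_zero_iff (b c + 2 * b c' + 2 * (n : ℕ) * b₀) 3).1 (by
      push_cast; linear_combination hn₂ + (b c' + ((n : ℕ) : ZMod 3) * b₀) * h3)
    have hgc : (g c : L) ≠ 0 := by simpa using hg0 c
    have hgc' : (g c' : L) ≠ 0 := by simpa using hg0 c'
    have hε0 : ((ε : 𝓞 L) : L) ≠ 0 := by simp
    have key : (g c : L) * (g c' * ((ε : 𝓞 L) : L) ^ (n : ℕ)) ^ 2 =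
        (g₁ ^ A * g₂ ^ B * (l c * l c' ^ 2 * l₀ ^ (2 * n : ℕ))) ^ 3 := by
      rw [mul_pow (g₁ ^ A * g₂ ^ B), mul_pow (g₁ ^ A), ← pow_mul, ← pow_mul, mul_comm A,
        mul_comm B, ← hA, ← hB, hgl, hgl, hε₀]
      ring
    obtain ⟨x, hx⟩ : ∃ x : L, x = (g₁ ^ A * g₂ ^ B * (l c * l c' ^ 2 * l₀ ^ (2 * n : ℕ))) /
      (g c' * ((ε : 𝓞 L) : L) ^ (n : ℕ)) := ⟨_, rfl⟩
    have hgx : (g c : L) = g c' * ((ε ^ (n : ℕ) : (𝓞 L)ˣ) : 𝓞 L) * x ^ 3 := by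
      rw [hx, div_pow, ← key]
      simp only [Units.val_pow_eq_pow_val, map_pow]
      field_simp
    refine mk0_eq_mk0_of_pow_three ?_ (hgI c) (hgI c') hgx
    rintro rfl
    simp [hgc] at hgx
  refine (Nat.card_le_card_of_injective _ hinj).trans ?_
  simp

lemma CubeGens.exists_ne_one (hg : CubeGens g₁ g₂) (hε : IsCubeGenerator ε) :
    ∃ c : ClassGroup (𝓞 L), c ≠ 1 ∧ c ^ 3 = 1 := by
  by_contra! hc
  have huc : ∀ γ : L, γ ≠ 0 → IsIdealCube (𝓞 L) γ →
      ∃ (n : ℕ) (w : L), γ = ((ε : 𝓞 L) : L) ^ n * w ^ 3 := by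
    intro γ hγ hγc
    obtain ⟨y, z, hz, rfl⟩ := IsFractionRing.div_surjective (A := 𝓞 L) γ
    have hz0 : z ≠ 0 := nonZeroDivisors.ne_zero hz
    have hz0' : (z : L) ≠ 0 := by simpa using hz0
    have hy0 : y ≠ 0 := by
      rintro rfl
      simp at hγ
    have hyz : y * z ^ 2 ≠ 0 := mul_ne_zero hy0 (pow_ne_zero 2 hz0)
    obtain ⟨I, hI⟩ := IsIdealCube.exists_span_eq_pow hyz (F := L) (by
      convert hγc.mul (isIdealCube_pow_three (R := 𝓞 L) (z : L)) using 1
      rw [map_mul, map_pow]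
      field_simp)
    have hI0 : I ∈ (Ideal (𝓞 L))⁰ := by
      refine mem_nonZeroDivisors_of_ne_zero ?_
      rintro rfl
      rw [Submodule.zero_eq_bot, Ideal.bot_pow three_ne_zero,
        Ideal.span_singleton_eq_bot] at hI
      exact hyz hI
    have h1 : ClassGroup.mk0 ⟨I, hI0⟩ = 1 := by
      by_contra hne
      refine hc _ hne ?_
      rw [← map_pow, SubmonoidClass.mk_pow, ClassGroup.mk0_eq_one_iff, ← hI]
      exact ⟨_, rfl⟩
    rw [ClassGroup.mk0_eq_one_iff] at h1
    obtain ⟨t, rfl⟩ := h1.principal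
    rw [Ideal.submodule_span_eq, Ideal.span_singleton_pow,
      Ideal.span_singleton_eq_span_singleton] at hI
    obtain ⟨u, hu⟩ := hI.symm
    obtain ⟨n, w, rfl⟩ := hε.gen u
    refine ⟨n, (w : 𝓞 L) * t / z, ?_⟩
    have := congrArg (algebraMap (𝓞 L) L) hu
    simp only [map_mul, map_pow, Units.val_mul, Units.val_pow_eq_pow_val] at this
    field_simp
    linear_combination -this
  obtain ⟨n, w, hw⟩ := huc g₁ hg.ne₁ hg.isIdealCube₁
  obtain ⟨m, w', hw'⟩ := huc g₂ hg.ne₂ hg.isIdealCube₂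
  have h1 := (hg.indep m (2 * n) (((ε : 𝓞 L) : L) ^ (m * n) * w ^ m * w' ^ (2 * n)) (by
    rw [hw, hw']; ring)).2
  obtain ⟨n, rfl⟩ : 3 ∣ n := by omega
  have h2 := (hg.indep 1 0 (((ε : 𝓞 L) : L) ^ n * w) (by
    rw [pow_one, pow_zero, mul_one, hw]; ring)).1
  omega

theorem CubeGens.isCyclic (hg : CubeGens g₁ g₂) (hε : IsCubeGenerator ε) :
    IsCyclic (CommGroup.primaryComponent (ClassGroup (𝓞 L)) 3) ∧
    ∃ w : ℕ, 1 ≤ w ∧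
      Nat.card (CommGroup.primaryComponent (ClassGroup (𝓞 L)) 3) = 3 ^ w := by
  have hP : IsPGroup 3 (CommGroup.primaryComponent (ClassGroup (𝓞 L)) 3) :=
    CommGroup.primaryComponent.isPGroup
  refine ⟨hP.isCyclic_of_card_le ((Nat.card_le_card_of_injective
    (fun x : {x : CommGroup.primaryComponent (ClassGroup (𝓞 L)) 3 // x ^ 3 = 1} ↦
      (⟨x.1.1, congrArg Subtype.val x.2⟩ : {c : ClassGroup (𝓞 L) // c ^ 3 = 1}))
    fun x y hxy ↦ ?_).trans (hg.card_le hε)), ?_⟩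
  · exact Subtype.ext (Subtype.ext
      (congrArg (fun c : {c : ClassGroup (𝓞 L) // c ^ 3 = 1} ↦ c.1) hxy))
  · obtain ⟨w, hw⟩ := IsPGroup.iff_card.1 hP
    refine ⟨w, Nat.one_le_iff_ne_zero.2 ?_, hw⟩
    rintro rfl
    obtain ⟨c, hc1, hc3⟩ := hg.exists_ne_one hε
    have := (Nat.card_eq_one_iff_unique.1 hw).1
    have hc : c ∈ CommGroup.primaryComponent (ClassGroup (𝓞 L)) 3 :=
      ⟨1, by rw [pow_one, hc3]⟩
    exact hc1 (congrArg Subtype.val (Subsingleton.elim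
      (⟨c, hc⟩ : CommGroup.primaryComponent (ClassGroup (𝓞 L)) 3) 1))

end ClassGroup

namespace KummerTower

variable {L k K : Type} [Field L] [Field k] [Field K] [NumberField L]
    [NumberField k] [NumberField K] [Algebra L K] [Algebra k K] {d : ℕ} {θ : L} {ζ : k}
    {σ : K ≃ₐ[k] K} {τ : K ≃ₐ[L] K} (h : KummerTower d θ ζ σ τ)
include h

lemma rank_eq_one : Units.rank L = 1 := by
  have h1 := InfinitePlace.card_eq_nrRealPlaces_add_nrComplexPlaces L
  have h2 := InfinitePlace.card_add_two_mul_card_eq_rank L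
  rw [h.finrankL] at h2
  have h3 : InfinitePlace.nrComplexPlaces L ≠ 0 := by
    intro h0
    have hreal : ∀ φ : L →+* ℂ, ∃ r : ℝ, φ θ = r := by
      intro φ
      have := (nrComplexPlaces_eq_zero_iff).1 h0
      have hφ := ComplexEmbedding.isReal_iff.1 (IsTotallyReal.complexEmbedding_isReal φ)
      obtain ⟨r, hr⟩ := Complex.conj_eq_iff_real.1 (RingHom.congr_fun hφ θ)
      exact ⟨r, hr⟩
    have hsub : Subsingleton (L →+* ℂ) := by
      refine ⟨fun φ ψ ↦ RingHom.ext fun x ↦ ?_⟩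
      obtain ⟨r, hr⟩ := hreal φ
      obtain ⟨s, hs⟩ := hreal ψ
      have hr3 : (r : ℂ) ^ 3 = d := by rw [← hr, ← map_pow, h.cube, map_natCast]
      have hs3 : (s : ℂ) ^ 3 = d := by rw [← hs, ← map_pow, h.cube, map_natCast]
      have hrs : r = s := by
        have : r ^ 3 = s ^ 3 := by exact_mod_cast hr3.trans hs3.symm
        exact (Odd.strictMono_pow (by decide : Odd 3)).injective this
      obtain ⟨a, b, c, rfl⟩ := h.repL x
      simp [hr, hs, hrs]
    have h4 : Fintype.card (L →+* ℂ) = 3 := by rw [NumberField.Embeddings.card, h.finrankL]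
    have := Fintype.card_le_one_iff_subsingleton.2 hsub
    omega
  rw [Units.rank]
  omega

end KummerTower

open Polynomial in
lemma exists_kummerExtension {k : Type} [Field k] {ζ a : k} (hζ : IsPrimitiveRoot ζ 3)
    (ha : ∀ b : k, b ^ 3 ≠ a) :
    ∃ (K : Type) (_ : Field K) (_ : Algebra k K) (α : K) (σ : K ≃ₐ[k] K),
      α ^ 3 = algebraMap k K a ∧ σ α = algebraMap k K ζ * α ∧ IsGalois k K ∧
      Module.finrank k K = 3 := by
  have hne : (primitiveRoots 3 k).Nonempty := ⟨ζ, (mem_primitiveRoots (by decide)).2 hζ⟩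
  have hirr : Irreducible (X ^ 3 - C a) := X_pow_sub_C_irreducible_of_prime Nat.prime_three ha
  have := Fact.mk hirr
  have := isSplittingField_AdjoinRoot_X_pow_sub_C hne hirr
  refine ⟨AdjoinRoot (X ^ 3 - C a), inferInstance, inferInstance, AdjoinRoot.root _,
    autAdjoinRootXPowSubC 3 a hζ.toRootsOfUnity, root_X_pow_sub_C_pow 3 a, ?_,
    isGalois_of_isSplittingField_X_pow_sub_C hne hirr _,
    finrank_of_isSplittingField_X_pow_sub_C hne hirr _⟩
  rw [autAdjoinRootXPowSubC_root, Algebra.smul_def]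
  rfl

lemma exists_eq_add_mul_of_finrank_eq_two {F E : Type*} [Field F] [Field E] [Algebra F E]
    (h2 : Module.finrank F E = 2) {z : E} (hz : ∀ a : F, algebraMap F E a ≠ z) (x : E) :
    ∃ a b : F, x = algebraMap F E a + algebraMap F E b * z := by
  have hli : LinearIndependent F ![(1 : E), z] := by
    rw [LinearIndependent.pair_iff' one_ne_zero]
    intro a
    rw [Algebra.smul_def, mul_one]
    exact hz a
  obtain ⟨B, hB⟩ : ∃ B : Module.Basis (Fin 2) F E, ⇑B = ![(1 : E), z] :=
    ⟨basisOfLinearIndependentOfCardEqFinrank hli (by simp [h2]), by simp⟩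
  refine ⟨B.repr x 0, B.repr x 1, (B.sum_repr x).symm.trans ?_⟩
  simp [hB, Algebra.smul_def]

lemma IsCubeFree.pow_three_ne {d : ℕ} (hd : 1 < d) (h : IsCubeFree d) (b : ℚ) : b ^ 3 ≠ d := by
  intro hb
  have hint : IsIntegral ℤ b := IsIntegral.of_pow (n := 3) (by decide) (hb ▸ isIntegral_natCast d)
  obtain ⟨y, rfl⟩ := IsIntegrallyClosed.isIntegral_iff.1 hint
  have hy : y ^ 3 = (d : ℤ) := by
    rw [← Int.cast_inj (α := ℚ)]
    simpa using hb
  have hy' : y.natAbs ^ 3 = d := by rw [← Int.natAbs_pow, hy, Int.natAbs_natCast]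
  refine h y.natAbs.minFac (Nat.minFac_prime ?_) ?_
  · intro h1
    rw [h1, one_pow] at hy'
    omega
  · rw [← hy']
    exact pow_dvd_pow_of_dvd (Nat.minFac_dvd _) 3

section PureCubic

variable {d : ℕ} (hd : ∀ b : ℚ, b ^ 3 ≠ d)
include hd

open Polynomial in
lemma minpoly_eq_of_pow_three_eq {E : Type*} [Field E] [Algebra ℚ E] {x : E} (hx : x ^ 3 = d) :
    minpoly ℚ x = X ^ 3 - C (d : ℚ) := by
  refine (minpoly.eq_of_irreducible_of_monic (X_pow_sub_C_irreducible_of_prime Nat.prime_three hd)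
    ?_ (monic_X_pow_sub_C _ three_ne_zero)).symm
  simp [hx]

omit hd in
/-- The generator `∛d` of `Lc d`. -/
def Lc.root (d : ℕ) : Lc d := AdjoinSimple.gen ℚ (cbrt d)

omit hd in
lemma Lc.root_pow_three (d : ℕ) : Lc.root d ^ 3 = d := Subtype.ext (cbrt_pow_three d)

lemma finrank_Lc : Module.finrank ℚ (Lc d) = 3 := by
  rw [Lc, adjoin.finrank (isIntegral_cbrt d), minpoly_eq_of_pow_three_eq hd (cbrt_pow_three d)]
  exact Polynomial.natDegree_X_pow_sub_C

lemma Lc.exists_eq (x : Lc d) : ∃ a b c : ℚ,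
    x = a + b * Lc.root d + c * Lc.root d ^ 2 := by
  obtain ⟨f, hf, rfl⟩ := (adjoin.powerBasis (isIntegral_cbrt d)).exists_eq_aeval x
  rw [adjoin.powerBasis_dim, minpoly_eq_of_pow_three_eq hd (cbrt_pow_three d),
    Polynomial.natDegree_X_pow_sub_C] at hf
  refine ⟨f.coeff 0, f.coeff 1, f.coeff 2, ?_⟩
  rw [Polynomial.aeval_eq_sum_range' hf]
  simp [Finset.sum_range_succ, Algebra.smul_def, Lc.root]
  rfl

lemma Lc.exists_algHom {K : Type*} [Field K] [Algebra ℚ K] {α : K} (hα : α ^ 3 = d) :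
    ∃ φ : Lc d →ₐ[ℚ] K, φ (Lc.root d) = α := by
  have h : Polynomial.aeval α (minpoly ℚ (adjoin.powerBasis (isIntegral_cbrt d)).gen) = 0 := by
    rw [minpoly_eq_of_pow_three_eq hd (by
      rw [adjoin.powerBasis_gen]
      exact Lc.root_pow_three d)]
    simp [hα]
  exact ⟨(adjoin.powerBasis (isIntegral_cbrt d)).lift α h,
    (adjoin.powerBasis (isIntegral_cbrt d)).lift_gen α h⟩

open Polynomial in
lemma exists_kummerTower (hd0 : d ≠ 0) :
    ∃ (k K : Type) (_ : Field k) (_ : Field K) (_ : NumberField k) (_ : NumberField K)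
      (_ : Algebra (Lc d) K) (_ : Algebra k K) (θ : Lc d) (ζ : k) (σ : K ≃ₐ[k] K)
      (τ : K ≃ₐ[Lc d] K), KummerTower d θ ζ σ τ := by
  obtain ⟨k, _, _, _⟩ : ∃ (k : Type) (_ : Field k) (_ : NumberField k),
    IsCyclotomicExtension {3} ℚ k := ⟨CyclotomicField 3 ℚ, inferInstance, inferInstance,
      CyclotomicField.isCyclotomicExtension 3 ℚ⟩
  have hk2 : Module.finrank ℚ k = 2 :=
    IsCyclotomicExtension.finrank (n := 3) k (cyclotomic.irreducible_rat (by decide))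
  obtain ⟨ζ, hζ⟩ : ∃ ζ : k, IsPrimitiveRoot ζ 3 := ⟨_, IsCyclotomicExtension.zeta_spec 3 ℚ k⟩
  have hroot : ζ ^ 2 + ζ + 1 = 0 := by
    have := hζ.geom_sum_eq_zero (by decide)
    rw [Finset.sum_range_succ, Finset.sum_range_succ, Finset.sum_range_one] at this
    linear_combination this
  obtain ⟨K, _, _, α, σ, hα, hσ, _, hKk⟩ := exists_kummerExtension (a := (d : k)) hζ (by
    intro b hb
    have h1 := minpoly.degree_dvd (IsIntegral.of_finite ℚ b)
    rw [minpoly_eq_of_pow_three_eq hd hb, natDegree_X_pow_sub_C, hk2] at h1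
    omega)
  rw [map_natCast] at hα
  have hfin : Module.Finite k K := Module.finite_of_finrank_pos (by omega)
  have hK : NumberField K := NumberField.of_module_finite k K
  obtain ⟨φ, hφ⟩ := Lc.exists_algHom hd hα
  let := φ.toRingHom.toAlgebra
  have hL3 := finrank_Lc hd
  have hKL : Module.finrank (Lc d) K = 2 := by
    have h1 := Module.finrank_mul_finrank ℚ (Lc d) K
    have h2 := Module.finrank_mul_finrank ℚ k K
    rw [hL3] at h1
    rw [hk2, hKk] at h2
    omega
  have : Algebra.IsQuadraticExtension (Lc d) K := ⟨hKL⟩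
  have hζL : ∀ a : Lc d, algebraMap (Lc d) K a ≠ algebraMap k K ζ := by
    intro a ha
    have ha' : a ^ 2 + a + 1 = 0 := by
      apply (algebraMap (Lc d) K).injective
      simp only [map_add, map_pow, map_one, map_zero, ha]
      simpa using congrArg (algebraMap k K) hroot
    have h1 := minpoly.degree_dvd (IsIntegral.of_finite ℚ a)
    rw [← minpoly.eq_of_irreducible_of_monic (cyclotomic.irreducible_rat (n := 3) (by decide))
      (by simpa [cyclotomic_three] using ha') (cyclotomic.monic 3 ℚ), natDegree_cyclotomic,
      hL3] at h1
    exact absurd h1 (by decide)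
  have hrepKL := exists_eq_add_mul_of_finrank_eq_two hKL hζL
  obtain ⟨τ, hτ⟩ : ∃ τ : K ≃ₐ[Lc d] K, τ ≠ 1 := by
    have h1 := IsGalois.card_aut_eq_finrank (Lc d) K
    rw [hKL] at h1
    have := (Finite.one_lt_card_iff_nontrivial (α := K ≃ₐ[Lc d] K)).1 (by omega)
    exact exists_ne 1
  refine ⟨k, K, inferInstance, inferInstance, inferInstance, inferInstance, inferInstance,
    inferInstance, Lc.root d, ζ, σ, τ, hd0, Lc.root_pow_three d, hroot, ?_, ?_, Lc.exists_eq hd,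
    hrepKL, ?_, hL3, hKL, hKk, inferInstance, inferInstance⟩
  · have h1 : algebraMap (Lc d) K (Lc.root d) = α := hφ
    rw [h1, hσ]
  · have hz : (algebraMap k K ζ) ^ 2 + algebraMap k K ζ + 1 = 0 := by
      simpa using congrArg (algebraMap k K) hroot
    have hz' : (τ (algebraMap k K ζ)) ^ 2 + τ (algebraMap k K ζ) + 1 = 0 := by
      simpa using congrArg τ hz
    have hne : τ (algebraMap k K ζ) - algebraMap k K ζ ≠ 0 := by
      intro h0
      refine hτ (AlgEquiv.ext fun x ↦ ?_)
      obtain ⟨a, b, rfl⟩ := hrepKL x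
      simp [sub_eq_zero.1 h0]
    refine mul_left_cancel₀ hne ?_
    linear_combination hz' - (1 + τ (algebraMap k K ζ) - algebraMap k K ζ) * hz
  · have := exists_eq_add_mul_of_finrank_eq_two hk2 (z := ζ) (by
      rintro a rfl
      have h1 : a ^ 2 + a + 1 = 0 := (algebraMap ℚ k).injective (by simpa using hroot)
      nlinarith)
    simpa using this

end PureCubic

section PureCubicClassGroup

variable {d : ℕ}

lemma CubeGens.isCyclic_Lc (hd : 1 < d) (hdcf : IsCubeFree d) {g₁ g₂ : Lc d}
    (hg : CubeGens g₁ g₂) :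
    IsCyclic (CommGroup.primaryComponent (ClassGroup (𝓞 (Lc d))) 3) ∧
    ∃ w : ℕ, 1 ≤ w ∧
      Nat.card (CommGroup.primaryComponent (ClassGroup (𝓞 (Lc d))) 3) = 3 ^ w := by
  obtain ⟨k, K, _, _, _, _, _, _, θ, ζ, σ, τ, h⟩ :=
    exists_kummerTower (hdcf.pow_three_ne hd) (by omega)
  obtain ⟨ε, hε⟩ := exists_isCubeGenerator (L := Lc d) (by rw [h.finrankL]; decide) h.rank_eq_one
  exact hg.isCyclic hε

lemma IsCubeFree.exists_eq_pow_mul (hd : 1 < d) (hdcf : IsCubeFree d) {p : ℕ} (hp : p.Prime)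
    (hpd : p ∣ d) : ∃ f m : ℕ, (f = 1 ∨ f = 2) ∧ ¬ p ∣ m ∧ d = p ^ f * m := by
  obtain ⟨f, m, hm, hf⟩ := Nat.exists_eq_pow_mul_and_not_dvd (by omega : d ≠ 0) p hp.ne_one
  refine ⟨f, m, ?_, hm, hf⟩
  have h3 : f < 3 := by
    by_contra! h
    exact hdcf p hp (hf ▸ (pow_dvd_pow p h).mul_right m)
  have h0 : f ≠ 0 := by
    rintro rfl
    exact hm (by simpa [hf] using hpd)
  omega

lemma Lc.isIdealCube_of_dvd (hd : 1 < d) (hdcf : IsCubeFree d) {p : ℕ} (hp : p.Prime)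
    (hpd : p ∣ d) : IsIdealCube (𝓞 (Lc d)) (p : Lc d) := by
  obtain ⟨f, m, hf, hpm, hdp⟩ := hdcf.exists_eq_pow_mul hd hp hpd
  exact isIdealCube_of_dvd_radicand hp hf hpm (by rw [← hdp]; exact Lc.root_pow_three d)

/-- If the radicand has at most three ramified primes and is not a norm from `ℚ(ζ₃, ∛ζ₃)`, then
the `3`-class group is cyclic. -/
lemma isCyclic_of_not_norm (hd : 1 < d) (hdcf : IsCubeFree d) {p₁ p₂ p₃ e₁ e₂ e₃ q : ℕ}
    (hp₁ : p₁.Prime) (hp₂ : p₂.Prime) (hp₃ : p₃.Prime) (h12 : p₁ ≠ p₂) (h13 : p₁ ≠ p₃)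
    (h23 : p₂ ≠ p₃) (he₁ : e₁ = 1 ∨ e₁ = 2) (hdp : d = p₁ ^ e₁ * (p₂ ^ e₂ * p₃ ^ e₃))
    (h₁ : p₁ = 3 ∨ p₁ % 3 = 2) (h₂ : p₂ = 3 ∨ p₂ % 3 = 2) (h₃ : p₃ = 3 ∨ p₃ % 3 = 2)
    (h3 : p₁ = 3 ∨ p₂ = 3 ∨ p₃ = 3 ∨ d % 9 = 1 ∨ d % 9 = 8)
    (hc₂ : IsIdealCube (𝓞 (Lc d)) (p₂ : Lc d)) (hc₃ : IsIdealCube (𝓞 (Lc d)) (p₃ : Lc d))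
    (hq : q.Prime) (hq9 : q % 9 = 2 ∨ q % 9 = 5) (hqd : q ∣ d) :
    IsCyclic (CommGroup.primaryComponent (ClassGroup (𝓞 (Lc d))) 3) ∧
    ∃ w : ℕ, 1 ≤ w ∧
      Nat.card (CommGroup.primaryComponent (ClassGroup (𝓞 (Lc d))) 3) = 3 ^ w := by
  obtain ⟨k, K, _, _, _, _, _, _, θ, ζ, σ, τ, h⟩ :=
    exists_kummerTower (hdcf.pow_three_ne hd) (by omega)
  obtain ⟨f, m, hf, hqm, hdq⟩ := hdcf.exists_eq_pow_mul hd hq hqd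
  have hdvd : ∀ p : ℕ, p.Prime → p ∣ d → p = p₁ ∨ p = p₂ ∨ p = p₃ := by
    intro p hp hpd
    rw [hdp, hp.dvd_mul, hp.dvd_mul] at hpd
    exact hpd.imp (Nat.prime_eq_prime_of_dvd_pow hp hp₁)
      (Or.imp (Nat.prime_eq_prime_of_dvd_pow hp hp₂) (Nat.prime_eq_prime_of_dvd_pow hp hp₃))
  refine (h.cubeGens_of_not_norm hp₁ hp₂ hp₃ h12 h13 h23 he₁ hdp (fun p hp hpd ↦ ?_)
    (fun p hp hpd ↦ ?_) hc₂ hc₃ hq hq9 hf hqm hdq).isCyclic_Lc hd hdcf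
  · rcases (hp.dvd_mul).1 hpd with hp3 | hpd
    · have := (Nat.prime_dvd_prime_iff_eq hp Nat.prime_three).1 hp3
      omega
    · have := hdvd p hp hpd
      omega
  · have := hdvd p hp hpd
    omega

/-- If the radicand has at most two ramified primes and is a norm from `ℚ(ζ₃, ∛ζ₃)`, then
the `3`-class group is cyclic. -/
lemma isCyclic_of_norm (hd : 1 < d) (hdcf : IsCubeFree d) {p₁ p₂ e₁ e₂ : ℕ}
    (hp₁ : p₁.Prime) (hp₂ : p₂.Prime) (h12 : p₁ ≠ p₂) (he₁ : e₁ = 1 ∨ e₁ = 2)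
    (he₂ : e₂ = 1 ∨ e₂ = 2) (hdp : d = p₁ ^ e₁ * p₂ ^ e₂)
    (h₁ : p₁ = 3 ∨ p₁ % 9 = 8) (h₂ : p₂ % 9 = 8) :
    IsCyclic (CommGroup.primaryComponent (ClassGroup (𝓞 (Lc d))) 3) ∧
    ∃ w : ℕ, 1 ≤ w ∧
      Nat.card (CommGroup.primaryComponent (ClassGroup (𝓞 (Lc d))) 3) = 3 ^ w := by
  obtain ⟨k, K, _, _, _, _, _, _, θ, ζ, σ, τ, h⟩ :=
    exists_kummerTower (hdcf.pow_three_ne hd) (by omega)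
  have hdvd : ∀ p : ℕ, p.Prime → p ∣ d → p = p₁ ∨ p = p₂ := by
    intro p hp hpd
    rw [hdp, hp.dvd_mul] at hpd
    exact hpd.imp (Nat.prime_eq_prime_of_dvd_pow hp hp₁) (Nat.prime_eq_prime_of_dvd_pow hp hp₂)
  have h3 : p₁ = 3 ∨ d % 9 = 1 ∨ d % 9 = 8 := by
    refine h₁.imp_right fun h₁ ↦ ?_
    rw [hdp, Nat.mul_mod, Nat.pow_mod, h₁, Nat.pow_mod p₂, h₂]
    rcases he₁ with rfl | rfl <;> rcases he₂ with rfl | rfl <;> decide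
  have hx : ∃ x, pureCubicNorm ζ x = (d : k) := by
    rw [hdp]
    push_cast
    refine exists_pureCubicNorm_mul (exists_pureCubicNorm_pow ?_ e₁)
      (exists_pureCubicNorm_pow (exists_pureCubicNorm_eq_natCast h.root hp₂ h₂) e₂)
    rcases h₁ with rfl | h₁
    · exact_mod_cast exists_pureCubicNorm_eq_three h.root
    · exact exists_pureCubicNorm_eq_natCast h.root hp₁ h₁
  have hp₂d : p₂ ∣ d := hdp ▸ (dvd_pow_self p₂ (by omega)).mul_left _
  obtain ⟨g, hg⟩ := h.exists_cubeGens_of_norm hp₁ hp₂ h12 he₁ hdp (fun p hp hpd ↦ by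
    rcases (hp.dvd_mul).1 hpd with hp3 | hpd
    · have := (Nat.prime_dvd_prime_iff_eq hp Nat.prime_three).1 hp3
      omega
    · have := hdvd p hp hpd
      omega) (fun p hp hpd ↦ by
    have := hdvd p hp hpd
    omega) (Lc.isIdealCube_of_dvd hd hdcf hp₂ hp₂d) hx
  exact hg.isCyclic_Lc hd hdcf

end PureCubicClassGroup

/-- For the listed forms of the radicand `d` (Theorem 2.7 cases), the `3`-class group of
the pure cubic field `L = ℚ(∛d)` is cyclic, of order `3^w` for some `w ≥ 1`. -/
theorem three_class_group_cyclic
    (d : ℕ) (hd : 1 < d) (hdcf : IsCubeFree d)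
    (hform :
      ((∃ q e f₁ : ℕ, q.Prime ∧ q % 9 = 8 ∧ (e = 1 ∨ e = 2) ∧ (f₁ = 1 ∨ f₁ = 2) ∧
        d = 3 ^ e * q ^ f₁) ∨
      (∃ q₁ q₂ f₁ f₂ : ℕ, q₁.Prime ∧ q₂.Prime ∧ q₁ ≠ q₂ ∧ q₁ % 9 = 8 ∧ q₂ % 9 = 8 ∧
        (f₁ = 1 ∨ f₁ = 2) ∧ (f₂ = 1 ∨ f₂ = 2) ∧ d = q₁ ^ f₁ * q₂ ^ f₂) ∨
      (∃ q₁ q₂ f₁ f₂ : ℕ, q₁.Prime ∧ q₂.Prime ∧ q₁ ≠ q₂ ∧ q₁ % 3 = 2 ∧ q₂ % 3 = 2 ∧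
        (q₁ % 9 ≠ 8 ∨ q₂ % 9 ≠ 8) ∧ (f₁ = 1 ∨ f₁ = 2) ∧ (f₂ = 1 ∨ f₂ = 2) ∧
        d = q₁ ^ f₁ * q₂ ^ f₂ ∧ ¬(d % 9 = 1 ∨ d % 9 = 8)) ∨
      (∃ q₁ q₂ e f₁ f₂ : ℕ, q₁.Prime ∧ q₂.Prime ∧ q₁ ≠ q₂ ∧ q₁ % 3 = 2 ∧ q₂ % 3 = 2 ∧
        (q₁ % 9 ≠ 8 ∨ q₂ % 9 ≠ 8) ∧ (e = 1 ∨ e = 2) ∧ (f₁ = 1 ∨ f₁ = 2) ∧ (f₂ = 1 ∨ f₂ = 2) ∧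
        d = 3 ^ e * q₁ ^ f₁ * q₂ ^ f₂) ∨
      (∃ q₁ q₂ q₃ f₁ f₂ f₃ : ℕ, q₁.Prime ∧ q₂.Prime ∧ q₃.Prime ∧
        q₁ ≠ q₂ ∧ q₁ ≠ q₃ ∧ q₂ ≠ q₃ ∧
        (q₁ % 9 = 2 ∨ q₁ % 9 = 5) ∧ (q₂ % 9 = 2 ∨ q₂ % 9 = 5) ∧ q₃ % 9 = 8 ∧
        (f₁ = 1 ∨ f₁ = 2) ∧ (f₂ = 1 ∨ f₂ = 2) ∧ (f₃ = 1 ∨ f₃ = 2) ∧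
        d = q₁ ^ f₁ * q₂ ^ f₂ * q₃ ^ f₃ ∧ (d % 9 = 1 ∨ d % 9 = 8)) ∨
      (∃ q₁ q₂ q₃ f₁ f₂ f₃ : ℕ, q₁.Prime ∧ q₂.Prime ∧ q₃.Prime ∧
        q₁ ≠ q₂ ∧ q₁ ≠ q₃ ∧ q₂ ≠ q₃ ∧
        (q₁ % 9 = 2 ∨ q₁ % 9 = 5) ∧ (q₂ % 9 = 2 ∨ q₂ % 9 = 5) ∧ (q₃ % 9 = 2 ∨ q₃ % 9 = 5) ∧
        (f₁ = 1 ∨ f₁ = 2) ∧ (f₂ = 1 ∨ f₂ = 2) ∧ (f₃ = 1 ∨ f₃ = 2) ∧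
        d = q₁ ^ f₁ * q₂ ^ f₂ * q₃ ^ f₃ ∧ (d % 9 = 1 ∨ d % 9 = 8)))) :
    IsCyclic ↥(CommGroup.primaryComponent (ClassGroup (𝓞 ↥(Lc d))) 3) ∧
    ∃ w : ℕ, 1 ≤ w ∧
      Nat.card ↥(CommGroup.primaryComponent (ClassGroup (𝓞 ↥(Lc d))) 3) = 3 ^ w := by
  have hdvd : ∀ {q f m n : ℕ}, (f = 1 ∨ f = 2) → d = m * q ^ f * n → q ∣ d := by
    rintro q f m n hf rfl
    exact ((dvd_pow_self q (by omega)).mul_left m).mul_right n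
  rcases hform with ⟨q, e, f, hq, hq8, he, hf, hdq⟩ |
    ⟨q₁, q₂, f₁, f₂, hq₁, hq₂, h12, h₁, h₂, hf₁, hf₂, hdq⟩ |
    ⟨q₁, q₂, f₁, f₂, hq₁, hq₂, h12, h₁, h₂, hor, hf₁, hf₂, hdq, h9⟩ |
    ⟨q₁, q₂, e, f₁, f₂, hq₁, hq₂, h12, h₁, h₂, hor, he, hf₁, hf₂, hdq⟩ |
    ⟨q₁, q₂, q₃, f₁, f₂, f₃, hq₁, hq₂, hq₃, h12, h13, h23, h₁, h₂, h₃, hf₁, hf₂, hf₃, hdq, h9⟩ |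
    ⟨q₁, q₂, q₃, f₁, f₂, f₃, hq₁, hq₂, hq₃, h12, h13, h23, h₁, h₂, h₃, hf₁, hf₂, hf₃, hdq, h9⟩
  · exact isCyclic_of_norm hd hdcf Nat.prime_three hq (by omega) he hf hdq (by omega) hq8
  · exact isCyclic_of_norm hd hdcf hq₁ hq₂ h12 hf₁ hf₂ hdq (by omega) h₂
  · have hd₁ : q₁ ∣ d := hdvd (m := 1) (n := q₂ ^ f₂) hf₁ (by rw [hdq, one_mul])
    have hd₂ : q₂ ∣ d := hdvd (n := 1) hf₂ (by rw [hdq, mul_one])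
    have h3 : ¬ 3 ∣ d := by
      rw [hdq, Nat.prime_three.dvd_mul]
      rintro (h | h) <;> have := Nat.prime_three.dvd_of_dvd_pow h <;> omega
    obtain ⟨q, hq, hq9, hqd⟩ : ∃ q : ℕ, q.Prime ∧ (q % 9 = 2 ∨ q % 9 = 5) ∧ q ∣ d := by
      rcases hor with h | h
      exacts [⟨q₁, hq₁, by omega, hd₁⟩, ⟨q₂, hq₂, by omega, hd₂⟩]
    exact isCyclic_of_not_norm hd hdcf (e₂ := f₂) (e₃ := 0) hq₁ hq₂ Nat.prime_three h12
      (by omega) (by omega)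
      hf₁ (by rw [hdq, pow_zero, mul_one]) (by omega) (by omega) (by omega) (by omega)
      (Lc.isIdealCube_of_dvd hd hdcf hq₂ hd₂)
      (by exact_mod_cast isIdealCube_three h3 h9 (Lc.root_pow_three d)) hq hq9 hqd
  · have hd₁ : q₁ ∣ d := hdvd hf₁ hdq
    have hd₂ : q₂ ∣ d := hdvd (n := 1) hf₂ (by rw [hdq, mul_one])
    obtain ⟨q, hq, hq9, hqd⟩ : ∃ q : ℕ, q.Prime ∧ (q % 9 = 2 ∨ q % 9 = 5) ∧ q ∣ d := by
      rcases hor with h | h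
      exacts [⟨q₁, hq₁, by omega, hd₁⟩, ⟨q₂, hq₂, by omega, hd₂⟩]
    exact isCyclic_of_not_norm hd hdcf Nat.prime_three hq₁ hq₂ (by omega) (by omega) h12
      he (by rw [hdq, mul_assoc]) (by omega) (by omega) (by omega) (by omega)
      (Lc.isIdealCube_of_dvd hd hdcf hq₁ hd₁) (Lc.isIdealCube_of_dvd hd hdcf hq₂ hd₂) hq hq9 hqd
  all_goals
    have hd₂ : q₂ ∣ d := hdvd hf₂ hdq
    have hd₃ : q₃ ∣ d := hdvd (n := 1) hf₃ (by rw [hdq, mul_one])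
    exact isCyclic_of_not_norm hd hdcf hq₁ hq₂ hq₃ h12 h13 h23 hf₁ (by rw [hdq, mul_assoc])
      (by omega) (by omega) (by omega) (by omega) (Lc.isIdealCube_of_dvd hd hdcf hq₂ hd₂)
      (Lc.isIdealCube_of_dvd hd hdcf hq₃ hd₃) hq₂ h₂ hd₂

end
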